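/- arXiv:2508.00351 — 4 statements merged into one kernel-verified Lean document; each statement's English description precedes it below -/
import Mathlib

section
/- Let p be a prime and let E be an elliptic curve defined over the finite field F_p. Then there exist positive integers m and k such that the group E(F_p) of F_p-rational points of E is isomorphic to (Z/mZ) × (Z/mkZ), and moreover m divides p − 1. -/
/-- The short Weierstrass curve `y² = x³ + Ax + B` over a field `F`. -/
def shortWeierstrass (F : Type) [Field F] (A B : F) : WeierstrassCurve.Affine F :=
  { a₁ := 0, a₂ := 0, a₃ := 0, a₄ := A, a₆ := B }

section
open Polynomial WeierstrassCurve WeierstrassCurve.Affine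

namespace EC

/-- The three quadratic forms of the addition-and-subtraction map of `y² = x³ + Ax + B`. -/
def q {R : Type*} [CommRing R] (A B : R) (v : Fin 3 → R) : Fin 3 → R :=
  ![v 0 ^ 2 - 2 * A * v 0 * v 2 - 4 * B * v 1 * v 2 + A ^ 2 * v 2 ^ 2,
    2 * v 1 * v 0 + 2 * A * v 1 * v 2 + 4 * B * v 2 ^ 2,
    v 1 ^ 2 - 4 * v 0 * v 2]

lemma q_eq {R : Type*} [CommRing R] (W : WeierstrassCurve R) (h1 : W.a₁ = 0) (h2 : W.a₂ = 0)
    (h3 : W.a₃ = 0) (v : Fin 3 → R) (i : Fin 3) :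
    q W.a₄ W.a₆ v i = (addSubMap W i).eval v := by
  fin_cases i <;> simp [q, addSubMap, b₂, b₄, b₆, b₈, h1, h2, h3]

lemma q_cert {R : Type*} [CommRing R] (A B : R) (h : IsUnit (-16 * (4 * A ^ 3 + 27 * B ^ 2))) :
    ∀ v : Fin 3 → R, ∃ c : Fin 3 → Fin 3 → R, ∀ i, ∑ j, c i j * q A B v j = v i ^ 4 := by
  intro v
  let W : WeierstrassCurve R := ⟨0, 0, 0, A, B⟩
  have : W.IsElliptic := ⟨by
    have : W.Δ = -16 * (4 * A ^ 3 + 27 * B ^ 2) := by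
      simp [W, Δ, b₂, b₄, b₆, b₈]; ring
    rwa [this]⟩
  refine ⟨fun i j => (MvPolynomial.C (↑W.Δ'⁻¹ : R) * addSubMapCoeff W (i, j)).eval v,
    fun i => ?_⟩
  rw [← addSubMapCoeff_condition W v i]
  refine Finset.sum_congr rfl fun j _ => ?_
  rw [← q_eq W rfl rfl rfl]

lemma addSub_spec {K : Type*} [Field K] [DecidableEq K] (W : WeierstrassCurve.Affine K)
    (h1 : W.a₁ = 0) (h2 : W.a₂ = 0)
    (h3 : W.a₃ = 0) (P Q : W.Point) :
    ∃ c : K, c ≠ 0 ∧ ∀ i, q W.a₄ W.a₆ (P.sym2x Q) i = c * (P + Q).sym2x (P - Q) i := by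
  have key : ∀ (x y : K) (h : W.Nonsingular x y),
      ∃ c : K, c ≠ 0 ∧ ∀ i, q W.a₄ W.a₆ ((Point.some x y h).sym2x (Point.some x y h)) i =
        c * (Point.some x y h + Point.some x y h).sym2x 0 i := by
    intro x y h
    have he := (W.equation_iff x y).1 h.1
    have hn := (W.nonsingular_iff' x y).1 h
    simp only [h1, h2, h3] at he hn
    by_cases hy : y = W.negY x y
    · rw [Point.add_self_of_Y_eq hy]
      have hy' : 2 * y = 0 := by
        rw [negY, h1, h3] at hy; linear_combination hy
      have hx : 3 * x ^ 2 + W.a₄ ≠ 0 := by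
        rcases hn.2 with h | h
        · intro h'; apply h; linear_combination -h'
        · exfalso; apply h; linear_combination hy'
      refine ⟨(3 * x ^ 2 + W.a₄) ^ 2, pow_ne_zero _ hx, fun i => ?_⟩
      fin_cases i <;> simp [q]
      · linear_combination (8 * x) * he - 4 * x * y * hy'
      · linear_combination (-4) * he + 2 * y * hy'
      · ring
    · rw [Point.add_self_of_Y_ne hy]
      have hy' : 2 * y ≠ 0 := by
        intro h'; apply hy; rw [negY, h1, h3]; linear_combination h'
      have hl : W.slope x x y y = (3 * x ^ 2 + W.a₄) / (2 * y) := by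
        rw [slope_of_Y_ne rfl hy, negY, h1, h2, h3]; congr 1 <;> ring
      refine ⟨(2 * y) ^ 2, pow_ne_zero _ hy', fun i => ?_⟩
      have hl2 : (2 * y) ^ 2 * ((3 * x ^ 2 + W.a₄) / (2 * y)) ^ 2 = (3 * x ^ 2 + W.a₄) ^ 2 := by
        rw [← mul_pow, mul_div_cancel₀ _ hy']
      fin_cases i <;> simp [q, addX, hl, h1, h2]
      · rw [mul_sub, mul_sub, hl2]; linear_combination (8 * x) * he
      · linear_combination (-4) * he
      · ring
  rcases P with _ | ⟨x₁, y₁, hP⟩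
  · refine ⟨1, one_ne_zero, fun i => ?_⟩
    rw [← Point.zero_def, zero_add, zero_sub, Point.sym2x_neg_right]
    rcases Q with _ | ⟨x₂, y₂, hQ⟩
    · rw [← Point.zero_def]; fin_cases i <;> simp [q]
    · fin_cases i <;> simp [q] <;> ring
  rcases Q with _ | ⟨x₂, y₂, hQ⟩
  · refine ⟨1, one_ne_zero, fun i => ?_⟩
    rw [← Point.zero_def, add_zero, sub_zero]
    fin_cases i <;> simp [q] <;> ring
  by_cases hx : x₁ = x₂
  · rcases Point.X_eq_iff.1 hx with h | h
    · rw [h, sub_self]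
      exact key _ _ _
    · rw [h, neg_add_cancel, Point.sym2x_comm 0, Point.sym2x_neg_left]
      obtain ⟨c, hc, H⟩ := key _ _ hQ
      refine ⟨c, hc, fun i => ?_⟩
      rw [H i, show -Point.some x₂ y₂ hQ - Point.some x₂ y₂ hQ =
        -(Point.some x₂ y₂ hQ + Point.some x₂ y₂ hQ) by abel, Point.sym2x_neg_left]
  · rw [sub_eq_add_neg, Point.neg_some, Point.add_some (fun h => hx h.1),
      Point.add_some (fun h => hx h.1)]
    have e1 := (W.equation_iff _ _).1 hP.1
    have e2 := (W.equation_iff _ _).1 hQ.1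
    simp only [h1, h2, h3] at e1 e2
    have hd := sub_ne_zero.2 hx
    refine ⟨(x₁ - x₂) ^ 2, pow_ne_zero _ hd, fun i => ?_⟩
    have f1 : y₁ ^ 2 = x₁ ^ 3 + W.a₄ * x₁ + W.a₆ := by linear_combination e1
    have f2 : y₂ ^ 2 = x₂ ^ 3 + W.a₄ * x₂ + W.a₆ := by linear_combination e2
    fin_cases i <;> simp [q, addX, slope_of_X_ne hx, negY, h1, h2, h3]
    · obtain ⟨l, hl⟩ : ∃ l, l = (y₁ - y₂) / (x₁ - x₂) := ⟨_, rfl⟩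
      obtain ⟨m, hm⟩ : ∃ m, m = (y₁ + y₂) / (x₁ - x₂) := ⟨_, rfl⟩
      rw [← hl, ← hm]
      have hl' : (x₁ - x₂) * l = y₁ - y₂ := by rw [hl, mul_div_cancel₀ _ hd]
      have hm' : (x₁ - x₂) * m = y₁ + y₂ := by rw [hm, mul_div_cancel₀ _ hd]
      have hlm : (x₁ - x₂) * (l * m) = x₁ ^ 2 + x₁ * x₂ + x₂ ^ 2 + W.a₄ := by
        apply mul_left_cancel₀ hd
        linear_combination (x₁ - x₂) * m * hl' + (y₁ - y₂) * hm' + f1 - f2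
      have a1 : ((x₁ - x₂) * l) ^ 2 = (y₁ - y₂) ^ 2 := by rw [hl']
      have a2 : ((x₁ - x₂) * m) ^ 2 = (y₁ + y₂) ^ 2 := by rw [hm']
      have a3 : ((x₁ - x₂) * (l * m)) ^ 2 = (x₁ ^ 2 + x₁ * x₂ + x₂ ^ 2 + W.a₄) ^ 2 := by
        rw [hlm]
      linear_combination (x₁ + x₂) * a1 + (x₁ + x₂) * a2 - a3 +
        2 * (x₁ + x₂) * f1 + 2 * (x₁ + x₂) * f2
    · field_simp
      linear_combination (-2) * f1 - 2 * f2
    · ring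

end EC
end

section
open Polynomial WeierstrassCurve WeierstrassCurve.Affine

namespace EC

section heights
variable {F : Type*} [Field F]

/-- `v` is a primitive triple of polynomials of exact maximal degree `N`. -/
structure Ht (v : Fin 3 → F[X]) (N : ℕ) : Prop where
  deg : ∀ i, (v i).natDegree ≤ N
  lead : ∃ i, (v i).coeff N ≠ 0
  prim : ∃ r : Fin 3 → F[X], ∑ i, r i * v i = 1

/-- `(a, b)` is a coprime pair of polynomials of exact maximal degree `n`. -/
structure Ht2 (a b : F[X]) (n : ℕ) : Prop where
  dega : a.natDegree ≤ n
  degb : b.natDegree ≤ n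
  lead : a.coeff n ≠ 0 ∨ b.coeff n ≠ 0
  prim : IsCoprime a b

lemma Ht.le {v w : Fin 3 → F[X]} {N M : ℕ} (hv : Ht v N) (hw : Ht w M)
    (h : ∀ i j, v i * w j = v j * w i) : N ≤ M := by
  obtain ⟨r, hr⟩ := hv.prim
  obtain ⟨s, hs⟩ := hw.prim
  obtain ⟨i, hi⟩ := hv.lead
  have h1 : v i ∣ w i := ⟨∑ j, r j * w j, by
    rw [Finset.mul_sum, ← mul_one (w i), ← hr, Finset.mul_sum]
    refine Finset.sum_congr rfl fun j _ => ?_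
    linear_combination r j * h j i⟩
  have h2 : w i ∣ v i := ⟨∑ j, s j * v j, by
    rw [Finset.mul_sum, ← mul_one (v i), ← hs, Finset.mul_sum]
    refine Finset.sum_congr rfl fun j _ => ?_
    linear_combination s j * h i j⟩
  have hvi : v i ≠ 0 := fun h0 => hi (by simp [h0])
  have hwi : w i ≠ 0 := fun h0 => hvi (by rw [h0] at h2; exact zero_dvd_iff.1 h2)
  exact (le_natDegree_of_ne_zero hi).trans ((natDegree_le_of_dvd h1 hwi).trans (hw.deg i))

lemma Ht.unique {v w : Fin 3 → F[X]} {N M : ℕ} (hv : Ht v N) (hw : Ht w M)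
    (h : ∀ i j, v i * w j = v j * w i) : N = M :=
  le_antisymm (hv.le hw h) (hw.le hv fun i j => by linear_combination -h i j)

lemma Ht2.mul {a b c d : F[X]} {n m : ℕ} (h : Ht2 a b n) (h' : Ht2 c d m) :
    Ht ![a * c, a * d + b * c, b * d] (n + m) := by
  have hac := coeff_mul_add_eq_of_natDegree_le h.dega h'.dega
  have had := coeff_mul_add_eq_of_natDegree_le h.dega h'.degb
  have hbc := coeff_mul_add_eq_of_natDegree_le h.degb h'.dega
  have hbd := coeff_mul_add_eq_of_natDegree_le h.degb h'.degb
  have dac := natDegree_mul_le_of_le h.dega h'.dega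
  have dad := natDegree_mul_le_of_le h.dega h'.degb
  have dbc := natDegree_mul_le_of_le h.degb h'.dega
  have dbd := natDegree_mul_le_of_le h.degb h'.degb
  refine ⟨fun i => ?_, ?_, ?_⟩
  · fin_cases i
    · exact dac
    · exact natDegree_add_le_of_degree_le dad dbc
    · exact dbd
  · by_contra! hcon
    have h0 := hcon 0
    have h1 := hcon 1
    have h2 := hcon 2
    simp only [Matrix.cons_val_zero, Matrix.cons_val_one, Matrix.cons_val, coeff_add, hac, had,
      hbc, hbd] at h0 h1 h2
    have := h.lead
    have := h'.lead
    grind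
  · obtain ⟨u, v, huv⟩ := IsCoprime.pow (m := 2) (n := 2) h.prim
    obtain ⟨s, t, hst⟩ := IsCoprime.pow (m := 2) (n := 2) h'.prim
    refine ⟨![u * s * (a * c) - u * t * (b * d), u * t * (a * d) + v * s * (b * c),
      v * t * (b * d) - v * s * (a * c)], ?_⟩
    simp [Fin.sum_univ_three]
    linear_combination (s * c ^ 2 + t * d ^ 2) * huv + hst

lemma coeff_qf {N : ℕ} {p r : F[X]} (hp : p.natDegree ≤ N) (hr : r.natDegree ≤ N) :
    (p * r).coeff (2 * N) = p.coeff N * r.coeff N := by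
  rw [two_mul]; exact coeff_mul_add_eq_of_natDegree_le hp hr

lemma Ht.q {v : Fin 3 → F[X]} {N : ℕ} (hv : Ht v N) (A B : F)
    (hΔ : -16 * (4 * A ^ 3 + 27 * B ^ 2) ≠ 0) :
    Ht (EC.q (C A) (C B) v) (2 * N) := by
  have C2 : (C 2 : F[X]) = 2 := rfl
  have C4 : (C 4 : F[X]) = 4 := rfl
  have e0 : EC.q (C A) (C B) v 0 = v 0 * v 0 - C (2 * A) * (v 0 * v 2) - C (4 * B) * (v 1 * v 2)
      + C (A ^ 2) * (v 2 * v 2) := by simp [EC.q, C2, C4]; ring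
  have e1 : EC.q (C A) (C B) v 1 = C 2 * (v 1 * v 0) + C (2 * A) * (v 1 * v 2)
      + C (4 * B) * (v 2 * v 2) := by simp [EC.q, C2, C4]; ring
  have e2 : EC.q (C A) (C B) v 2 = v 1 * v 1 - C 4 * (v 0 * v 2) := by simp [EC.q, C2, C4]; ring
  have d : ∀ i j, (v i * v j).natDegree ≤ 2 * N := fun i j => by
    rw [two_mul]; exact natDegree_mul_le_of_le (hv.deg i) (hv.deg j)
  have d' : ∀ (c : F) i j, (C c * (v i * v j)).natDegree ≤ 2 * N := fun c i j =>
    (natDegree_C_mul_le _ _).trans (d i j)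
  have cf : ∀ i j, (v i * v j).coeff (2 * N) = (v i).coeff N * (v j).coeff N := fun i j =>
    coeff_qf (hv.deg i) (hv.deg j)
  refine ⟨fun i => ?_, ?_, ?_⟩
  · fin_cases i
    · change (EC.q (C A) (C B) v 0).natDegree ≤ _
      rw [e0]
      exact natDegree_add_le_of_degree_le (natDegree_sub_le_of_le (natDegree_sub_le_of_le (d _ _)
        (d' _ _ _)) (d' _ _ _) |>.trans (by simp)) (d' _ _ _)
    · change (EC.q (C A) (C B) v 1).natDegree ≤ _
      rw [e1]
      exact natDegree_add_le_of_degree_le (natDegree_add_le_of_degree_le (d' _ _ _) (d' _ _ _))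
        (d' _ _ _)
    · change (EC.q (C A) (C B) v 2).natDegree ≤ _
      rw [e2]
      exact natDegree_sub_le_of_le (d _ _) (d' _ _ _) |>.trans (by simp)
  · by_contra! hcon
    obtain ⟨i, hi⟩ := hv.lead
    obtain ⟨c, hc⟩ := q_cert A B hΔ.isUnit (fun i => (v i).coeff N)
    have : ∀ j, EC.q A B (fun i => (v i).coeff N) j = 0 := by
      intro j
      rw [← hcon j]
      fin_cases j
      · change _ = (EC.q (C A) (C B) v 0).coeff _
        rw [e0]; simp only [coeff_add, coeff_sub, coeff_C_mul, cf]; simp [EC.q]; ring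
      · change _ = (EC.q (C A) (C B) v 1).coeff _
        rw [e1]; simp only [coeff_add, coeff_sub, coeff_C_mul, cf]; simp [EC.q]; ring
      · change _ = (EC.q (C A) (C B) v 2).coeff _
        rw [e2]; simp only [coeff_add, coeff_sub, coeff_C_mul, cf]; simp [EC.q]; ring
    apply hi
    have h5 := hc i
    simp only [this, mul_zero, Finset.sum_const_zero] at h5
    exact pow_eq_zero_iff (by norm_num) |>.1 h5.symm
  · obtain ⟨c, hc⟩ := q_cert (C A) (C B) (by
      have := (hΔ.isUnit).map (C : F →+* F[X])
      rw [map_mul, map_neg, map_add, map_mul, map_mul, map_pow, map_pow] at this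
      exact this) v
    have h1 : Ideal.span (Set.range v) = ⊤ := by
      rw [Ideal.eq_top_iff_one]
      obtain ⟨r, hr⟩ := hv.prim
      rw [← hr]
      exact Ideal.sum_mem _ fun i _ => Ideal.mul_mem_left _ _ (Ideal.subset_span ⟨i, rfl⟩)
    have h2 := Ideal.span_pow_eq_top _ h1 4
    have h3 : Ideal.span (Set.range (EC.q (C A) (C B) v)) = ⊤ := by
      rw [eq_top_iff, ← h2, Ideal.span_le]
      rintro _ ⟨_, ⟨i, rfl⟩, rfl⟩
      simp only [SetLike.mem_coe]
      rw [← hc i]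
      exact Ideal.sum_mem _ fun i _ => Ideal.mul_mem_left _ _ (Ideal.subset_span ⟨i, rfl⟩)
    rw [Ideal.eq_top_iff_one, Ideal.mem_span_range_iff_exists_fun] at h3
    exact h3

/-- degree of a rational function -/
noncomputable def rdeg (f : RatFunc F) : ℕ := max f.num.natDegree f.denom.natDegree

lemma rdeg_ht (f : RatFunc F) : Ht2 f.num f.denom (rdeg f) := by
  refine ⟨le_max_left _ _, le_max_right _ _, ?_, f.isCoprime_num_denom⟩
  rcases max_choice f.num.natDegree f.denom.natDegree with h | h
  · by_cases h0 : f.num = 0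
    · right
      have : f = 0 := RatFunc.num_eq_zero_iff.1 h0
      subst this
      simp [rdeg]
    · left
      rw [rdeg, h]; simpa using h0
  · right; rw [rdeg, h]; simpa using f.denom_ne_zero

section points
variable {K : Type*} [Field K] [Algebra (RatFunc F) K]
  {W : WeierstrassCurve.Affine K}

/-- The point `P` has an `x`-coordinate in `F(t)` of degree `n`. -/
def HH (P : W.Point) (n : ℕ) : Prop :=
  ∃ a b : F[X], Ht2 a b n ∧ ∃ c : K, c ≠ 0 ∧
    c * P.xRep 0 = algebraMap (RatFunc F) K (algebraMap F[X] (RatFunc F) a) ∧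
    c * P.xRep 1 = algebraMap (RatFunc F) K (algebraMap F[X] (RatFunc F) b)

lemma HH_zero : HH (F := F) (0 : W.Point) 0 :=
  ⟨1, 0, ⟨by simp, by simp, by simp, isCoprime_one_left⟩, 1, by simp, by simp, by simp⟩

lemma HH_some (f : RatFunc F) (x y : K) (h : W.Nonsingular x y)
    (hx : x = algebraMap (RatFunc F) K f) : HH (F := F) (Point.some x y h) (rdeg f) := by
  have hd : algebraMap F[X] (RatFunc F) f.denom ≠ 0 := RatFunc.algebraMap_ne_zero f.denom_ne_zero
  refine ⟨f.num, f.denom, rdeg_ht f, algebraMap (RatFunc F) K (algebraMap _ _ f.denom), ?_, ?_, ?_⟩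
  · simpa using f.denom_ne_zero
  · simp only [Point.xRep_some, hx, Matrix.cons_val_zero]
    rw [← map_mul]
    congr 1
    conv_lhs => enter [2]; rw [← RatFunc.num_div_denom f]
    exact mul_div_cancel₀ _ hd
  · simp

lemma parallelogram [DecidableEq K] (h1 : W.a₁ = 0) (h2 : W.a₂ = 0) (h3 : W.a₃ = 0) (A B : F)
    (h4 : W.a₄ = algebraMap (RatFunc F) K (algebraMap F[X] (RatFunc F) (C A)))
    (h6 : W.a₆ = algebraMap (RatFunc F) K (algebraMap F[X] (RatFunc F) (C B)))
    (hΔ : -16 * (4 * A ^ 3 + 27 * B ^ 2) ≠ 0)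
    {P Q : W.Point} {n m k l : ℕ} (hP : HH (F := F) P n) (hQ : HH (F := F) Q m)
    (hS : HH (F := F) (P + Q) k) (hD : HH (F := F) (P - Q) l) : k + l = 2 * (n + m) := by
  obtain ⟨a, b, hab, c1, hc1, pa, pb⟩ := hP
  obtain ⟨c, d, hcd, c2, hc2, qc, qd⟩ := hQ
  obtain ⟨e, f, hef, c3, hc3, se, sf⟩ := hS
  obtain ⟨g, h, hgh, c4, hc4, dg, dh⟩ := hD
  obtain ⟨z, hz, H⟩ := addSub_spec W h1 h2 h3 P Q
  set ι : F[X] →+* K := (algebraMap (RatFunc F) K).comp (algebraMap F[X] (RatFunc F)) with hι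
  have hinj : Function.Injective ι :=
    (algebraMap (RatFunc F) K).injective.comp (IsFractionRing.injective F[X] (RatFunc F))
  change _ = ι a at pa
  change _ = ι b at pb
  change _ = ι c at qc
  change _ = ι d at qd
  change _ = ι e at se
  change _ = ι f at sf
  change _ = ι g at dg
  change _ = ι h at dh
  change _ = ι _ at h4
  change _ = ι _ at h6
  have H1 := (hab.mul hcd).q A B hΔ
  have H2 := hef.mul hgh
  have k1 : ∀ i, ι (![a * c, a * d + b * c, b * d] i) = (c1 * c2) * P.sym2x Q i := by
    intro i
    fin_cases i <;> simp [Point.sym2x, ← pa, ← pb, ← qc, ← qd] <;> ring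
  have k2 : ∀ i, ι (![e * g, e * h + f * g, f * h] i) = (c3 * c4) * (P + Q).sym2x (P - Q) i := by
    intro i
    fin_cases i <;> simp [Point.sym2x, ← se, ← sf, ← dg, ← dh] <;> ring
  have k3 : ∀ (v : Fin 3 → F[X]) i, ι (EC.q (C A) (C B) v i) =
      EC.q W.a₄ W.a₆ (fun i => ι (v i)) i := by
    intro v i
    rw [h4, h6]
    have C2 : ι 2 = 2 := map_ofNat ι 2
    have C4 : ι 4 = 4 := map_ofNat ι 4
    fin_cases i <;> simp [EC.q, C2, C4]
  have k4 : ∀ (s : K) (v : Fin 3 → K) i, EC.q W.a₄ W.a₆ (fun i => s * v i) i =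
      s ^ 2 * EC.q W.a₄ W.a₆ v i := by
    intro s v i
    fin_cases i <;> simp [EC.q] <;> ring
  have k5 : ∀ i, ι (EC.q (C A) (C B) ![a * c, a * d + b * c, b * d] i) =
      (c1 * c2) ^ 2 * (z * (P + Q).sym2x (P - Q) i) := by
    intro i
    rw [k3]
    simp_rw [k1]
    rw [k4, H]
  refine (H1.unique H2 fun i j => hinj ?_).symm
  rw [map_mul, map_mul, k5, k5, k2, k2]
  ring

end points
end heights

end EC
end

section
open Polynomial WeierstrassCurve WeierstrassCurve.Affine

namespace EC

section gen
variable {F : Type*} [Field F]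

/-- the generic `x`-coordinate -/
noncomputable def gx (F K : Type*) [Field F] [Field K] [Algebra (RatFunc F) K] : K :=
  algebraMap (RatFunc F) K RatFunc.X

/-- `K` is the function field of `y² = x³ + Ax + B` over `F`, with `y` the generic `y`. -/
structure Gen (A B : F) {K : Type*} [Field K] [Algebra F K] [Algebra (RatFunc F) K] (y : K) :
    Prop where
  eq : y ^ 2 = gx F K ^ 3 + algebraMap F K A * gx F K + algebraMap F K B
  span : ∀ z : K, ∃ a b : RatFunc F,
    z = algebraMap (RatFunc F) K a + algebraMap (RatFunc F) K b * y
  rank : Module.finrank (RatFunc F) K = 2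
  lift : ∀ u v : K, Transcendental F u → v ^ 2 = u ^ 3 + algebraMap F K A * u + algebraMap F K B →
    ∃ φ : K →ₐ[F] K, φ (gx F K) = u ∧ φ y = v

lemma not_square (A B : F) (r : RatFunc F) :
    r ^ 2 ≠ algebraMap F[X] (RatFunc F) (X ^ 3 + C A * X + C B) := by
  intro h
  have hd : (X ^ 3 + C A * X + C B : F[X]).natDegree = 3 := by compute_degree!
  have h0 : (X ^ 3 + C A * X + C B : F[X]) ≠ 0 := by
    intro h; rw [h] at hd; simp at hd
  have hr : r ≠ 0 := by
    rintro rfl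
    rw [zero_pow two_ne_zero] at h
    exact RatFunc.algebraMap_ne_zero h0 h.symm
  have := congrArg RatFunc.intDegree h
  rw [pow_two, RatFunc.intDegree_mul hr hr, RatFunc.intDegree_polynomial, hd] at this
  push_cast at this
  omega

theorem exists_gen {F : Type} [Field F] (A B : F) :
    ∃ (K : Type) (_ : Field K) (_ : Algebra F K) (_ : Algebra (RatFunc F) K)
      (_ : IsScalarTower F (RatFunc F) K) (y : K), Gen A B y := by
  let f : RatFunc F := algebraMap F[X] (RatFunc F) (X ^ 3 + C A * X + C B)
  let P : (RatFunc F)[X] := X ^ 2 - C f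
  have hP : Irreducible P :=
    (X_pow_sub_C_irreducible_iff_of_prime Nat.prime_two).2 fun b => not_square A B b
  have hPm : P.Monic := monic_X_pow_sub_C _ two_ne_zero
  have hPd : P.natDegree = 2 := natDegree_X_pow_sub_C
  have : Fact (Irreducible P) := ⟨hP⟩
  have hf : f = RatFunc.X ^ 3 + algebraMap F (RatFunc F) A * RatFunc.X + algebraMap F _ B := by
    simp only [f, map_add, map_mul, map_pow, RatFunc.algebraMap_X, RatFunc.algebraMap_C,
      RatFunc.algebraMap_eq_C]
  have hroot : AdjoinRoot.root P ^ 2 = algebraMap (RatFunc F) (AdjoinRoot P) f := by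
    have := AdjoinRoot.eval₂_root P
    simp only [P, eval₂_sub, eval₂_pow, eval₂_X, eval₂_C] at this
    exact sub_eq_zero.1 this
  refine ⟨AdjoinRoot P, inferInstance, inferInstance, inferInstance, inferInstance,
    AdjoinRoot.root P, ?_, ?_, ?_, ?_⟩
  · rw [hroot, hf, gx]
    simp only [map_add, map_mul, map_pow]
    rw [← IsScalarTower.algebraMap_apply, ← IsScalarTower.algebraMap_apply]
  · intro z
    obtain ⟨g, rfl⟩ := AdjoinRoot.mk_surjective z
    have h1 : AdjoinRoot.mk P g = AdjoinRoot.mk P (g %ₘ P) := by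
      rw [AdjoinRoot.mk_eq_mk]
      exact ⟨g /ₘ P, by rw [eq_comm, ← sub_eq_iff_eq_add'.2 (modByMonic_add_div g P).symm]⟩
    have h2 : (g %ₘ P).natDegree ≤ 1 := by
      have := natDegree_modByMonic_lt g hPm (by intro h; rw [h] at hPd; simp at hPd)
      omega
    rw [h1, eq_X_add_C_of_natDegree_le_one h2]
    refine ⟨(g %ₘ P).coeff 0, (g %ₘ P).coeff 1, ?_⟩
    simp only [map_add, map_mul, AdjoinRoot.mk_C, AdjoinRoot.mk_X, AdjoinRoot.algebraMap_eq]
    rw [add_comm]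
  · rw [(AdjoinRoot.powerBasis hP.ne_zero).finrank, AdjoinRoot.powerBasis_dim, hPd]
  · intro u v hu huv
    have hinj : Function.Injective (aeval u : F[X] →ₐ[F] AdjoinRoot P) :=
      transcendental_iff_injective.1 hu
    let φ : RatFunc F →ₐ[F] AdjoinRoot P := RatFunc.liftAlgHom (aeval u)
      (nonZeroDivisors_le_comap_nonZeroDivisors_of_injective _ hinj)
    have hφ : φ RatFunc.X = u := by
      refine (RatFunc.liftAlgHom_apply _ _ _).trans ?_
      simp
    have hφf : P.eval₂ (φ : RatFunc F →+* AdjoinRoot P) v = 0 := by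
      simp only [P, eval₂_sub, eval₂_pow, eval₂_X, eval₂_C]
      have : (φ : RatFunc F →+* AdjoinRoot P) f = u ^ 3 + algebraMap F (AdjoinRoot P) A * u +
          algebraMap F (AdjoinRoot P) B := by
        refine (congrArg (φ : RatFunc F →+* AdjoinRoot P) hf).trans ?_
        simp only [RingHom.coe_coe, map_add, map_mul, map_pow, hφ, AlgHom.commutes]
      rw [huv, sub_eq_zero, this]
    refine ⟨AdjoinRoot.liftAlgHom P φ v hφf, ?_, ?_⟩
    · rw [gx, AdjoinRoot.algebraMap_eq, AdjoinRoot.liftAlgHom_of, hφ]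
    · simp

end gen
end EC
end

section
open Polynomial WeierstrassCurve WeierstrassCurve.Affine

namespace EC

section quad
variable {M : Type*} [AddCommGroup M] (h : M → ℤ)

lemma quad_zero (hp : ∀ P Q, h (P + Q) + h (P - Q) = 2 * (h P + h Q)) : h 0 = 0 := by
  have := hp 0 0
  rw [add_zero, sub_zero] at this
  omega

lemma quad_formula (hp : ∀ P Q, h (P + Q) + h (P - Q) = 2 * (h P + h Q)) (P Q : M) (n : ℕ) :
    h (n • P + Q) = n ^ 2 * h P + n * (h (P + Q) - h P - h Q) + h Q := by
  induction n using Nat.twoStepInduction with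
  | zero => simp
  | one => simp; ring
  | more n ih1 ih2 =>
    have := hp ((n + 1) • P + Q) P
    rw [show (n + 1) • P + Q + P = (n + 2) • P + Q by module,
      show (n + 1) • P + Q - P = n • P + Q by module, ih1, ih2] at this
    push_cast at this ⊢
    linear_combination this

lemma quad_nsmul (hp : ∀ P Q, h (P + Q) + h (P - Q) = 2 * (h P + h Q)) (P : M) (n : ℕ) :
    h (n • P) = n ^ 2 * h P := by
  have := quad_formula h hp P 0 n
  have h0 := quad_zero h hp
  simp only [add_zero, h0] at this
  rw [this]; ring

end quad

section deg
open IntermediateField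
variable {F : Type*} [Field F] {K : Type*} [Field K] [Algebra F K]

lemma finrank_range {E : Type*} [Field E] [Algebra F E] [Algebra E K] (φ : E →ₐ[F] K)
    (hφ : ∀ x, φ x = algebraMap E K x) :
    Module.finrank φ.fieldRange K = Module.finrank E K := by
  symm
  refine Algebra.finrank_eq_of_equiv_equiv
    (AlgEquiv.ofInjectiveField φ : E ≃ₐ[F] φ.fieldRange).toRingEquiv (RingEquiv.refl K) ?_
  ext x
  exact hφ x |>.symm ▸ rfl

lemma finrank_adjoin_map {E : Type*} [Field E] [Algebra F E] (φ : E →ₐ[F] K) (x : E) :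
    Module.finrank F⟮φ x⟯ K = Module.finrank F⟮x⟯ E * Module.finrank φ.fieldRange K := by
  have h1 : F⟮φ x⟯ = F⟮x⟯.map φ := by rw [adjoin_map]; simp
  have h2 : φ.fieldRange = (⊤ : IntermediateField F E).map φ := AlgHom.fieldRange_eq_map φ
  rw [h1, ← relfinrank_top_right F⟮x⟯, ← relfinrank_map_map F⟮x⟯ ⊤ φ, h2]
  exact (relfinrank_mul_finrank_top (IntermediateField.map_mono φ le_top)).symm

lemma finrank_ratFunc [Algebra (RatFunc F) K] [IsScalarTower F (RatFunc F) K] (f : RatFunc F)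
    (h2 : Module.finrank (RatFunc F) K = 2) :
    Module.finrank F⟮algebraMap (RatFunc F) K f⟯ K = rdeg f * 2 := by
  have := finrank_adjoin_map (IsScalarTower.toAlgHom F (RatFunc F) K) f
  rw [finrank_range _ fun _ => rfl, h2, RatFunc.finrank_eq_max_natDegree] at this
  exact this

lemma transcendental_of_rdeg [Algebra (RatFunc F) K] [IsScalarTower F (RatFunc F) K]
    (f : RatFunc F) (h : rdeg f ≠ 0) : Transcendental F (algebraMap (RatFunc F) K f) := by
  rw [transcendental_algebraMap_iff (algebraMap (RatFunc F) K).injective]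
  apply RatFunc.transcendental_of_ne_C
  rw [RatFunc.eq_C_iff]
  rintro ⟨h1, h2⟩
  exact h (by simp [rdeg, h1, h2])

lemma algHom_ratFunc_ext [Algebra (RatFunc F) K] [IsScalarTower F (RatFunc F) K] {L : Type*}
    [Field L] [Algebra F L] {φ ψ : K →ₐ[F] L} (h : φ (gx F K) = ψ (gx F K)) (f : RatFunc F) :
    φ (algebraMap (RatFunc F) K f) = ψ (algebraMap (RatFunc F) K f) := by
  have hp : ∀ p : F[X], φ (algebraMap (RatFunc F) K (algebraMap F[X] _ p)) =
      ψ (algebraMap (RatFunc F) K (algebraMap F[X] _ p)) := by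
    intro p
    have : ∀ χ : K →ₐ[F] L, χ (algebraMap (RatFunc F) K (algebraMap F[X] _ p)) =
        aeval (χ (gx F K)) p := by
      intro χ
      rw [aeval_algHom_apply, gx, aeval_algebraMap_apply]
      congr 2
      rw [← RatFunc.algebraMap_X, aeval_algebraMap_apply, aeval_X_left_apply]
    rw [this, this, h]
  rw [← RatFunc.num_div_denom f]
  simp only [map_div₀, hp]

lemma Gen.hom_ext [Algebra (RatFunc F) K] [IsScalarTower F (RatFunc F) K] {A B : F} {y : K}
    (hG : Gen A B y) {L : Type*} [Field L] [Algebra F L] {φ ψ : K →ₐ[F] L}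
    (h : φ (gx F K) = ψ (gx F K)) (hy : φ y = ψ y) : φ = ψ := by
  ext z
  obtain ⟨a, b, rfl⟩ := hG.span z
  simp only [map_add, map_mul, hy, algHom_ratFunc_ext h]

lemma rdeg_X_pow (n : ℕ) : rdeg (RatFunc.X ^ n : RatFunc F) = n := by
  rw [← RatFunc.algebraMap_X, ← map_pow, rdeg, RatFunc.num_algebraMap, RatFunc.denom_algebraMap]
  simp

lemma rdeg_X : rdeg (RatFunc.X : RatFunc F) = 1 := by
  simpa using rdeg_X_pow (F := F) 1

lemma transcendental_gx [Algebra (RatFunc F) K] [IsScalarTower F (RatFunc F) K] :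
    Transcendental F (gx F K) :=
  transcendental_of_rdeg _ (by rw [rdeg_X]; exact one_ne_zero)

end deg
end EC
end

section
open Polynomial WeierstrassCurve WeierstrassCurve.Affine

set_option linter.unusedSectionVars false

namespace EC

section pts
variable {F : Type} [Field F] (A B : F) (K L : Type) [Field K] [Algebra F K] [Field L] [Algebra F L]
  [DecidableEq F] [DecidableEq K] [DecidableEq L]

/-- points of the curve over an extension -/
abbrev Pt : Type := ((shortWeierstrass F A B)⁄K).Point

variable {K L}

/-- functoriality of points -/
noncomputable def pm (φ : K →ₐ[F] L) : Pt A B K →+ Pt A B L :=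
  Point.map (W' := shortWeierstrass F A B) φ

variable {A B}

lemma sw_ns (hΔ : (shortWeierstrass F A B).Δ ≠ 0) (x y : K) :
    ((shortWeierstrass F A B)⁄K).Nonsingular x y ↔
      y ^ 2 = x ^ 3 + algebraMap F K A * x + algebraMap F K B := by
  have h : ((shortWeierstrass F A B)⁄K).Δ ≠ 0 := by
    change ((shortWeierstrass F A B).map (algebraMap F K)).Δ ≠ 0
    rw [WeierstrassCurve.map_Δ]
    simpa using hΔ
  rw [← equation_iff_nonsingular_of_Δ_ne_zero h, equation_iff]
  change y ^ 2 + algebraMap F K 0 * x * y + algebraMap F K 0 * y = x ^ 3 + algebraMap F K 0 * x ^ 2 +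
    algebraMap F K A * x + algebraMap F K B ↔ _
  simp

/-- constructor for points -/
def mk (hΔ : (shortWeierstrass F A B).Δ ≠ 0) (x y : K)
    (h : y ^ 2 = x ^ 3 + algebraMap F K A * x + algebraMap F K B) : Pt A B K :=
  Point.some x y ((sw_ns hΔ x y).2 h)

lemma pt_cases (hΔ : (shortWeierstrass F A B).Δ ≠ 0) (P : Pt A B K) :
    P = 0 ∨ ∃ x y h, P = mk hΔ x y h := by
  rcases P with _ | ⟨x, y, h⟩
  · left; rfl
  · right; exact ⟨x, y, (sw_ns hΔ x y).1 h, rfl⟩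

lemma mk_inj {hΔ : (shortWeierstrass F A B).Δ ≠ 0} {x y x' y' : K} {h h'} :
    mk hΔ x y h = mk hΔ x' y' h' ↔ x = x' ∧ y = y' := by
  simp [mk]

lemma mk_ne_zero {hΔ : (shortWeierstrass F A B).Δ ≠ 0} {x y : K} {h} :
    mk hΔ x y h ≠ 0 := Point.some_ne_zero _

lemma neg_mk {hΔ : (shortWeierstrass F A B).Δ ≠ 0} {x y : K} {h} :
    - mk hΔ x y h = mk hΔ x (-y) (by rw [neg_sq, h]) := by
  rw [mk, mk, Point.neg_some]
  congr 1
  change - y - algebraMap F K 0 * x - algebraMap F K 0 = -y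
  simp

lemma pm_mk {hΔ : (shortWeierstrass F A B).Δ ≠ 0} {x y : K} {h} (φ : K →ₐ[F] L) :
    pm A B φ (mk hΔ x y h) = mk hΔ (φ x) (φ y) (by
      rw [← map_pow, h]; simp) := rfl

lemma pm_pm {N : Type} [Field N] [Algebra F N] [DecidableEq N] (φ : K →ₐ[F] L) (ψ : L →ₐ[F] N)
    (P : Pt A B K) : pm A B ψ (pm A B φ P) = pm A B (ψ.comp φ) P :=
  Point.map_map ..

lemma pm_inj (φ : K →ₐ[F] L) : Function.Injective (pm A B φ) := Point.map_injective φ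

/-- constant points -/
noncomputable def cst (K : Type) [Field K] [Algebra F K] [DecidableEq K] : Pt A B F →+ Pt A B K :=
  pm A B (Algebra.ofId F K)

lemma pm_cst (φ : K →ₐ[F] L) (T : Pt A B F) : pm A B φ (cst K T) = cst L T := by
  rw [cst, pm_pm, cst]
  congr 1
  exact congrArg _ (Subsingleton.elim _ _)

lemma cst_inj : Function.Injective (cst (A := A) (B := B) K) := pm_inj _

lemma range_iff (hΔ : (shortWeierstrass F A B).Δ ≠ 0) (φ : L →ₐ[F] K) (x y : K) (h) :
    (∃ P, pm A B φ P = mk hΔ x y h) ↔ (∃ u, φ u = x) ∧ ∃ v, φ v = y := by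
  constructor
  · rintro ⟨P, hP⟩
    rcases pt_cases hΔ P with rfl | ⟨u, v, h', rfl⟩
    · rw [map_zero] at hP; exact absurd hP.symm mk_ne_zero
    · rw [pm_mk, mk_inj] at hP; exact ⟨⟨_, hP.1⟩, _, hP.2⟩
  · rintro ⟨⟨u, rfl⟩, v, rfl⟩
    refine ⟨mk hΔ u v ?_, pm_mk _⟩
    apply φ.injective
    simp [h]

end pts
end EC
end

section
open Polynomial WeierstrassCurve WeierstrassCurve.Affine

set_option linter.unusedSectionVars false

namespace EC

section ht
variable {F : Type} [Field F] [DecidableEq F] {A B : F} {K : Type} [Field K] [Algebra F K]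
  [DecidableEq K] [Algebra (RatFunc F) K] [IsScalarTower F (RatFunc F) K] {y : K}
  (hΔ : (shortWeierstrass F A B).Δ ≠ 0) (hG : Gen A B y)

/-- generic point -/
noncomputable def gp : Pt A B K := mk hΔ (gx F K) y hG.eq

lemma disc_ne (hΔ : (shortWeierstrass F A B).Δ ≠ 0) : -16 * (4 * A ^ 3 + 27 * B ^ 2) ≠ 0 := by
  intro h
  apply hΔ
  rw [← h]
  simp only [shortWeierstrass, WeierstrassCurve.Δ, WeierstrassCurve.b₂, WeierstrassCurve.b₄,
    WeierstrassCurve.b₆, WeierstrassCurve.b₈]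
  ring

lemma two_ne (hΔ : (shortWeierstrass F A B).Δ ≠ 0) : (2 : K) ≠ 0 := by
  intro h
  apply disc_ne hΔ
  have : (2 : F) = 0 := by
    apply (algebraMap F K).injective
    rw [map_ofNat, h, map_zero]
  linear_combination (-8 * (4 * A ^ 3 + 27 * B ^ 2)) * this

include hΔ in
lemma par {P Q : Pt A B K} {n m k l : ℕ} (hP : HH (F := F) P n) (hQ : HH (F := F) Q m)
    (hS : HH (F := F) (P + Q) k) (hD : HH (F := F) (P - Q) l) : k + l = 2 * (n + m) := by
  have e : ∀ a : F, algebraMap F K a =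
      algebraMap (RatFunc F) K (algebraMap F[X] (RatFunc F) (C a)) := by
    intro a
    rw [IsScalarTower.algebraMap_apply F (RatFunc F) K, RatFunc.algebraMap_C,
      RatFunc.algebraMap_eq_C]
  exact parallelogram (W := (shortWeierstrass F A B)⁄K) (map_zero _) (map_zero _) (map_zero _) A B
    (e A) (e B) (disc_ne hΔ) hP hQ hS hD

include hΔ in
lemma HH_unique {P : Pt A B K} {n m : ℕ} (hn : HH (F := F) P n) (hm : HH (F := F) P m) :
    n = m := by
  have := par hΔ (k := m) (l := m) hn HH_zero (by rwa [add_zero]) (by rwa [sub_zero])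
  omega

open Classical in
/-- The degree of the `x`-coordinate. -/
noncomputable def ht (P : Pt A B K) : ℤ := if h : ∃ n, HH (F := F) P n then (h.choose : ℤ) else 0

include hΔ in
lemma ht_eq {P : Pt A B K} {n : ℕ} (h : HH (F := F) P n) : ht P = n := by
  have h' : ∃ n, HH (F := F) P n := ⟨n, h⟩
  rw [ht, dif_pos h', HH_unique hΔ h'.choose_spec h]

include hΔ in
lemma ht_zero : ht (0 : Pt A B K) = 0 := by
  have := ht_eq hΔ (HH_zero (F := F) (W := (shortWeierstrass F A B)⁄K))
  simpa using this

lemma ht_mk (f : RatFunc F) (v : K) (h) :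
    ht (mk hΔ (algebraMap (RatFunc F) K f) v h) = rdeg f :=
  ht_eq hΔ (HH_some f _ _ _ rfl)

lemma ht_gp : ht (gp hΔ hG) = 1 := by
  rw [gp]
  have := ht_mk hΔ RatFunc.X y hG.eq
  rw [rdeg_X] at this
  exact_mod_cast this

include hΔ hG in
lemma exists_sigma : ∃ σ : K →ₐ[F] K, pm A B σ (gp hΔ hG) = - gp hΔ hG := by
  obtain ⟨σ, h1, h2⟩ := hG.lift (gx F K) (-y) transcendental_gx (by rw [neg_sq, hG.eq])
  refine ⟨σ, ?_⟩
  rw [gp, neg_mk, pm_mk, mk_inj]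
  exact ⟨h1, h2⟩

lemma hom_ext {φ ψ : K →ₐ[F] K} (h : pm A B φ (gp hΔ hG) = pm A B ψ (gp hΔ hG)) : φ = ψ := by
  rw [gp, pm_mk, pm_mk, mk_inj] at h
  exact hG.hom_ext h.1 h.2

/-- Odd points -/
noncomputable def Odd (σ : K →ₐ[F] K) : AddSubgroup (Pt A B K) :=
  (pm A B σ + AddMonoidHom.id _).ker

lemma mem_Odd {σ : K →ₐ[F] K} {P : Pt A B K} : P ∈ Odd (A := A) (B := B) σ ↔ pm A B σ P = - P := by
  rw [Odd, AddMonoidHom.mem_ker, AddMonoidHom.add_apply, AddMonoidHom.id_apply,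
    add_eq_zero_iff_eq_neg]

variable {σ : K →ₐ[F] K} (hσ : pm A B σ (gp hΔ hG) = - gp hΔ hG)

include hσ in
lemma odd_x {u v : K} {h} (ho : mk hΔ u v h ∈ Odd (A := A) (B := B) σ) :
    ∃ f, u = algebraMap (RatFunc F) K f := by
  rw [mem_Odd, pm_mk, neg_mk, mk_inj] at ho
  rw [gp, pm_mk, neg_mk, mk_inj] at hσ
  obtain ⟨a, b, rfl⟩ := hG.span u
  have e : ∀ f, σ (algebraMap (RatFunc F) K f) = algebraMap (RatFunc F) K f := fun f =>
    algHom_ratFunc_ext (ψ := AlgHom.id F K) hσ.1 f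
  have := ho.1
  rw [map_add, map_mul, e, e, hσ.2] at this
  refine ⟨a, ?_⟩
  have h2 : (2 : K) * (algebraMap (RatFunc F) K b * y) = 0 := by linear_combination -this
  rw [(mul_eq_zero.1 h2).resolve_left (two_ne hΔ), add_zero]

include hG hσ in
lemma odd_HH {P : Pt A B K} (ho : P ∈ Odd (A := A) (B := B) σ) : ∃ n, HH (F := F) P n := by
  rcases pt_cases hΔ P with rfl | ⟨u, v, h, rfl⟩
  · exact ⟨0, HH_zero⟩
  · obtain ⟨f, rfl⟩ := odd_x hΔ hG hσ ho
    exact ⟨_, HH_some f _ _ _ rfl⟩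

include hG hσ hΔ in
lemma ht_par (P Q : Odd (A := A) (B := B) σ) :
    ht (P + Q : Odd (A := A) (B := B) σ).1 + ht (P - Q : Odd (A := A) (B := B) σ).1 =
      2 * (ht P.1 + ht Q.1) := by
  obtain ⟨n, hn⟩ := odd_HH hΔ hG hσ P.2
  obtain ⟨m, hm⟩ := odd_HH hΔ hG hσ Q.2
  obtain ⟨k, hk⟩ := odd_HH hΔ hG hσ (P + Q).2
  obtain ⟨l, hl⟩ := odd_HH hΔ hG hσ (P - Q).2
  have := par hΔ hn hm hk hl
  rw [ht_eq hΔ hn, ht_eq hΔ hm, ht_eq hΔ hk, ht_eq hΔ hl]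
  exact_mod_cast this

include hG hσ hΔ in
lemma odd_ht_ne {P : Pt A B K} (ho : P ∈ Odd (A := A) (B := B) σ) (h : ht P ≠ 0) :
    ∃ u v h, P = mk hΔ u v h ∧ Transcendental F u := by
  rcases pt_cases hΔ P with rfl | ⟨u, v, h', rfl⟩
  · exact absurd (ht_zero hΔ) h
  · obtain ⟨f, rfl⟩ := odd_x hΔ hG hσ ho
    refine ⟨_, v, h', rfl, transcendental_of_rdeg _ ?_⟩
    rw [ht_mk] at h
    exact_mod_cast h

include hG hσ hΔ in
/-- behaviour of the height under composition -/
lemma ht_comp (φ : K →ₐ[F] K) (hφ : φ.comp σ = σ.comp φ) {P : Pt A B K}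
    (ho : P ∈ Odd (A := A) (B := B) σ) :
    pm A B φ P ∈ Odd (A := A) (B := B) σ ∧
    ht (pm A B φ P) = ht P * Module.finrank φ.fieldRange K := by
  have h1 : pm A B φ P ∈ Odd (A := A) (B := B) σ := by
    rw [mem_Odd] at ho ⊢
    rw [pm_pm, ← hφ, ← pm_pm, ho, map_neg]
  refine ⟨h1, ?_⟩
  rcases pt_cases hΔ P with rfl | ⟨u, v, h, rfl⟩
  · rw [map_zero, ht_zero hΔ, zero_mul]
  · obtain ⟨f, rfl⟩ := odd_x hΔ hG hσ ho
    have h2 := h1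
    rw [pm_mk] at h2
    obtain ⟨g, hg⟩ := odd_x hΔ hG hσ h2
    have e1 := finrank_adjoin_map φ (algebraMap (RatFunc F) K f)
    rw [hg, finrank_ratFunc _ hG.rank, finrank_ratFunc _ hG.rank] at e1
    have e2 : pm A B φ (mk hΔ (algebraMap (RatFunc F) K f) v h) =
      mk hΔ (algebraMap (RatFunc F) K g) (φ v) (by rw [← hg, ← map_pow, h]; simp) := by
      rw [pm_mk, mk_inj]; exact ⟨hg, rfl⟩
    rw [e2, ht_mk, ht_mk]
    norm_cast
    nlinarith

include hσ in
lemma gp_odd : gp hΔ hG ∈ Odd (A := A) (B := B) σ := mem_Odd.2 hσ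

include hσ in
lemma exists_phi (m : ℕ) (hm : m ≠ 0) : ∃ φ : K →ₐ[F] K,
    pm A B φ (gp hΔ hG) = m • gp hΔ hG ∧ φ.comp σ = σ.comp φ ∧
    Module.finrank φ.fieldRange K = m ^ 2 := by
  have ho : m • gp hΔ hG ∈ Odd (A := A) (B := B) σ :=
    AddSubgroup.nsmul_mem _ (gp_odd hΔ hG hσ) m
  have h1 : ht (m • gp hΔ hG) = m ^ 2 := by
    have := quad_nsmul (fun P : Odd (A := A) (B := B) σ => ht P.1) (ht_par hΔ hG hσ)
      ⟨_, gp_odd hΔ hG hσ⟩ m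
    simpa [ht_gp] using this
  obtain ⟨u, v, h, e, hu⟩ := odd_ht_ne hΔ hG hσ ho (by rw [h1]; positivity)
  obtain ⟨φ, hφ1, hφ2⟩ := hG.lift u v hu h
  have h2 : pm A B φ (gp hΔ hG) = m • gp hΔ hG := by
    rw [e, gp, pm_mk, mk_inj]; exact ⟨hφ1, hφ2⟩
  have h3 : φ.comp σ = σ.comp φ := by
    apply hom_ext hΔ hG
    rw [← pm_pm, ← pm_pm, hσ, h2, map_neg, map_nsmul, h2, hσ, smul_neg]
  refine ⟨φ, h2, h3, ?_⟩
  have := (ht_comp hΔ hG hσ φ h3 (gp_odd hΔ hG hσ)).2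
  rw [h2, h1, ht_gp, one_mul] at this
  exact_mod_cast this.symm

end ht
end EC
end

section
open Polynomial WeierstrassCurve WeierstrassCurve.Affine

set_option linter.unusedSectionVars false

namespace EC

section tr
variable {F : Type} [Field F] [DecidableEq F] {A B : F} {K : Type} [Field K] [Algebra F K]
  [DecidableEq K] [Algebra (RatFunc F) K] [IsScalarTower F (RatFunc F) K] {y : K}
  (hΔ : (shortWeierstrass F A B).Δ ≠ 0) (hG : Gen A B y)

lemma exists_tau (T : Pt A B F) : ∃ τ : K →ₐ[F] K,
    pm A B τ (gp hΔ hG) = gp hΔ hG + cst K T := by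
  have hnr : ¬ ∃ P, pm A B (algebraicClosure F K).val P = gp hΔ hG + cst K T := by
    rintro ⟨P, hP⟩
    have h1 : pm A B (algebraicClosure F K).val (P - cst _ T) = gp hΔ hG := by
      rw [map_sub, hP, pm_cst, add_sub_cancel_right]
    obtain ⟨⟨u, hu⟩, -⟩ := (range_iff hΔ _ _ _ hG.eq).1 ⟨_, h1⟩
    have h2 := u.2
    rw [mem_algebraicClosure_iff] at h2
    have h3 : (u : K) = gx F K := hu
    exact transcendental_gx (F := F) (K := K) (h3 ▸ h2)
  rcases pt_cases hΔ (gp hΔ hG + cst K T) with h | ⟨u, v, h, e⟩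
  · exact absurd ⟨0, by rw [h, map_zero]⟩ hnr
  · have hu : Transcendental F u := by
      intro hu
      apply hnr
      rw [e, range_iff]
      have hu' : u ∈ algebraicClosure F K := mem_algebraicClosure_iff.2 hu
      have hv : v ∈ algebraicClosure F K := by
        rw [mem_algebraicClosure_iff]
        apply IsAlgebraic.of_pow two_pos
        rw [h, ← mem_algebraicClosure_iff]
        exact add_mem (add_mem (pow_mem hu' 3) (mul_mem (algebraMap_mem _ _) hu'))
          (algebraMap_mem _ _)
      exact ⟨⟨⟨u, hu'⟩, rfl⟩, ⟨v, hv⟩, rfl⟩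
    obtain ⟨τ, h1, h2⟩ := hG.lift u v hu h
    refine ⟨τ, ?_⟩
    rw [e, gp, pm_mk, mk_inj]
    exact ⟨h1, h2⟩

/-- translation by a rational point -/
noncomputable def tau (T : Pt A B F) : K →ₐ[F] K := (exists_tau hΔ hG T).choose

lemma tau_spec (T : Pt A B F) : pm A B (tau hΔ hG T) (gp hΔ hG) = gp hΔ hG + cst K T :=
  (exists_tau hΔ hG T).choose_spec

variable {m : ℕ} {φ : K →ₐ[F] K} (hφ : pm A B φ (gp hΔ hG) = m • gp hΔ hG)

include hφ in
lemma tau_comp (T : Pt A B F) (hT : m • T = 0) : (tau hΔ hG T).comp φ = φ := by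
  apply hom_ext hΔ hG
  rw [← pm_pm, hφ, map_nsmul, tau_spec, smul_add, ← map_nsmul, hT, map_zero, add_zero]

/-- translations by torsion as automorphisms over the image of multiplication. -/
noncomputable def tauM (T : {T : Pt A B F // m • T = 0}) : K →ₐ[φ.fieldRange] K where
  __ := (tau hΔ hG T.1).toRingHom
  commutes' := by
    rintro ⟨_, x, rfl⟩
    exact DFunLike.congr_fun (tau_comp hΔ hG hφ T.1 T.2) x

lemma tauM_inj : Function.Injective (tauM hΔ hG hφ) := by
  intro S T h
  have h1 : tau hΔ hG S.1 = tau hΔ hG T.1 := by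
    ext z
    exact DFunLike.congr_fun h z
  have h2 := tau_spec hΔ hG S.1
  rw [h1, tau_spec] at h2
  exact Subtype.ext (cst_inj (add_left_cancel h2)).symm

include hΔ hG in
theorem lemmaA (m : ℕ) (hm : m ≠ 0) :
    Nat.card {T : Pt A B F // m • T = 0} ≤ m ^ 2 := by
  obtain ⟨σ, hσ⟩ := exists_sigma hΔ hG
  obtain ⟨φ, hφ, -, hf⟩ := exists_phi hΔ hG hσ m hm
  have : FiniteDimensional φ.fieldRange K := .of_finrank_pos (by rw [hf]; positivity)
  have h1 := Nat.card_le_card_of_injective _ (tauM_inj hΔ hG hφ)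
  have h2 := AlgHom.card_le (F := φ.fieldRange) (K := K)
  rw [← Nat.card_eq_fintype_card, hf] at h2
  exact h1.trans h2

include hΔ hG in
theorem lemmaB [Fintype F] (m : ℕ) (hm : m ≠ 0)
    (hc : Nat.card {T : Pt A B F // m • T = 0} = m ^ 2) : m ∣ Fintype.card F - 1 := by
  obtain ⟨σ, hσ⟩ := exists_sigma hΔ hG
  obtain ⟨φ, hφ, hφσ, hf⟩ := exists_phi hΔ hG hσ m hm
  have : FiniteDimensional φ.fieldRange K := .of_finrank_pos (by rw [hf]; positivity)
  have h1 := Nat.card_le_card_of_injective _ (tauM_inj hΔ hG hφ)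
  have h2 := AlgHom.card_le (F := φ.fieldRange) (K := K)
  rw [← Nat.card_eq_fintype_card, hf] at h2
  rw [hc] at h1
  have h3 : Nat.card (K →ₐ[φ.fieldRange] K) = m ^ 2 := le_antisymm h2 h1
  have hsurj : Function.Surjective (tauM hΔ hG hφ) := by
    have : Finite {T : Pt A B F // m • T = 0} := .of_injective _ (tauM_inj hΔ hG hφ)
    exact ((Nat.bijective_iff_injective_and_card _).2 ⟨tauM_inj hΔ hG hφ, by rw [hc, h3]⟩).2
  have hgal : IsGalois φ.fieldRange K := by
    apply IsGalois.of_card_aut_eq_finrank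
    rw [Nat.card_congr (algEquivEquivAlgHom φ.fieldRange K).toEquiv, h3, hf]
  let Fr : K →ₐ[F] K := FiniteField.frobeniusAlgHom F K
  have hFr : ∀ ψ : K →ₐ[F] K, ψ.comp Fr = Fr.comp ψ := by
    intro ψ; ext z; simp [Fr]
  set π : Pt A B K := pm A B Fr (gp hΔ hG) with hπ
  have hD : ∃ β, pm A B φ β = π - gp hΔ hG := by
    have hfix : ∀ T : {T : Pt A B F // m • T = 0},
        pm A B (tau hΔ hG T.1) (π - gp hΔ hG) = π - gp hΔ hG := by
      intro T
      rw [map_sub, hπ, pm_pm, hFr, ← pm_pm, tau_spec, map_add, pm_cst]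
      abel
    rcases pt_cases hΔ (π - gp hΔ hG) with h | ⟨u, v, h, e⟩
    · exact ⟨0, by rw [h, map_zero]⟩
    · rw [e, range_iff]
      have key : ∀ z : K, (∀ T : {T : Pt A B F // m • T = 0}, tau hΔ hG T.1 z = z) →
          ∃ w, φ w = z := by
        intro z hz
        have : z ∈ Set.range (algebraMap φ.fieldRange K) := by
          rw [IsGalois.mem_range_algebraMap_iff_fixed]
          intro f
          obtain ⟨T, hT⟩ := hsurj (f : K →ₐ[φ.fieldRange] K)
          exact (DFunLike.congr_fun hT z).symm.trans (hz T)
        obtain ⟨⟨_, w, rfl⟩, rfl⟩ := this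
        exact ⟨w, rfl⟩
      simp only [e, pm_mk, mk_inj] at hfix
      exact ⟨key u fun T => (hfix T).1, key v fun T => (hfix T).2⟩
  obtain ⟨β, hβ⟩ := hD
  have hGo := gp_odd hΔ hG hσ
  have hπo : π ∈ Odd (A := A) (B := B) σ := by
    rw [mem_Odd, hπ, pm_pm, hFr, ← pm_pm, hσ, map_neg]
  have hβo : β ∈ Odd (A := A) (B := B) σ := by
    rw [mem_Odd]
    apply pm_inj φ
    rw [pm_pm, hφσ, ← pm_pm, map_neg, hβ]
    exact mem_Odd.1 (sub_mem hπo hGo)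
  have hπht : ht π = Fintype.card F := by
    have := ht_mk hΔ (RatFunc.X ^ Fintype.card F) (Fr y) (by
      have h8 := congrArg Fr hG.eq
      simp only [map_add, map_mul, map_pow, AlgHom.commutes] at h8
      rw [h8, map_pow]
      rfl)
    rw [rdeg_X_pow] at this
    rw [← this, hπ, gp, pm_mk]
    congr 1
    rw [mk_inj]
    exact ⟨by simp [Fr, gx], rfl⟩
  have h4 := (ht_comp hΔ hG hσ φ hφσ hβo).2
  have h5 := (ht_comp hΔ hG hσ φ hφσ (add_mem hGo hβo)).2
  rw [map_add, hφ, hβ, hf] at h5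
  rw [hβ, hf] at h4
  have h6 := quad_formula (fun P : Odd (A := A) (B := B) σ => ht P.1) (ht_par hΔ hG hσ)
      ⟨_, hGo⟩ ⟨_, sub_mem hπo hGo⟩ m
  simp only [AddSubgroup.coe_add, AddSubgroup.coe_nsmul, add_sub_cancel, ht_gp, hπht, h4, h5] at h6
  have h7 : (m : ℤ) ∣ ((Fintype.card F - 1 : ℕ) : ℤ) := by
    have hq : 1 ≤ Fintype.card F := Fintype.card_pos
    push_cast [hq] at h6 ⊢
    refine ⟨m * ht β + (ht (gp hΔ hG + β) - 1 - ht β), ?_⟩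
    have hm' : (m : ℤ) ≠ 0 := by exact_mod_cast hm
    apply mul_left_cancel₀ hm'
    linear_combination -h6
  exact_mod_cast h7

end tr
end EC
end

section
namespace EC
section grp

/-- torsion count -/
noncomputable def tc (X : Type*) [AddCommGroup X] (n : ℕ) : ℕ := Nat.card {x : X // n • x = 0}

lemma tc_congr {X Y : Type*} [AddCommGroup X] [AddCommGroup Y] (e : X ≃+ Y) (n : ℕ) :
    tc X n = tc Y n :=
  Nat.card_congr (e.toEquiv.subtypeEquiv fun x => by
    simp [← map_nsmul])

lemma tc_prod {X Y : Type*} [AddCommGroup X] [AddCommGroup Y] (n : ℕ) [Finite X] [Finite Y] :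
    tc X n * tc Y n ≤ tc (X × Y) n := by
  rw [tc, tc, tc, ← Nat.card_prod]
  refine Nat.card_le_card_of_injective
    (fun p => ⟨(p.1.1, p.2.1), by simp [p.1.2, p.2.2]⟩) ?_
  rintro ⟨a, b⟩ ⟨c, d⟩ h
  simp only [Subtype.mk.injEq, Prod.mk.injEq] at h
  exact Prod.ext (Subtype.ext h.1) (Subtype.ext h.2)

lemma tc_ge {X : Type*} [AddCommGroup X] [Finite X] (x : X) (n : ℕ) (h : addOrderOf x = n) :
    n ≤ tc X n := by
  subst h
  rw [← Nat.card_zmultiples, tc]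
  refine Nat.card_le_card_of_injective (fun z => ⟨z.1, ?_⟩) ?_
  · obtain ⟨_, k, rfl⟩ := z
    simp only
    rw [smul_comm, Nat.card_zmultiples, addOrderOf_nsmul_eq_zero, smul_zero]
  · intro a b h
    exact Subtype.ext (congrArg (fun z => z.1) h)

lemma tc_ge_prime {X : Type*} [AddCommGroup X] [Finite X] (l : ℕ) (hl : l.Prime)
    (h : l ∣ Nat.card X) : l ≤ tc X l := by
  have := Fact.mk hl
  obtain ⟨x, hx⟩ := exists_prime_addOrderOf_dvd_card' l h
  exact tc_ge x l hx

lemma exists_char {X : Type*} [AddCommGroup X] (e : ℕ) [NeZero e] (g : X)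
    (hg : addOrderOf g = e) (hx : ∀ x : X, e • x = 0) : ∃ f : X →+ ZMod e, f g = 1 := by
  let i : ZMod e →+ X := ZMod.lift e ⟨zmultiplesHom X g, by simp [hx]⟩
  have hi1 : i 1 = g := by
    have := ZMod.lift_coe e ⟨zmultiplesHom X g, by simp [hx]⟩ 1
    simpa using this
  have hi : Function.Injective i := by
    rw [injective_iff_map_eq_zero]
    intro a ha
    obtain ⟨k, rfl⟩ := ZMod.intCast_surjective a
    have h2 : i (k : ZMod e) = k • g := by
      rw [← hi1, ← map_zsmul]; simp
    rw [h2, ← addOrderOf_dvd_iff_zsmul_eq_zero, hg] at ha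
    exact (ZMod.intCast_zmod_eq_zero_iff_dvd k e).2 ha
  obtain ⟨c, hc⟩ := (Module.Baer.of_divisible UnitAddCircle).extension_property_addMonoidHom i hi
    (ZMod.toAddCircle (N := e))
  have hr : ∀ x, ∃ a : ZMod e, ZMod.toAddCircle a = c x := by
    intro x
    have h1 : e • c x = 0 := by rw [← map_nsmul, hx, map_zero]
    obtain ⟨r, hr⟩ := QuotientAddGroup.mk_surjective (c x)
    rw [← hr] at h1 ⊢
    have h2 : ((e • r : ℝ) : UnitAddCircle) = 0 := h1
    rw [AddCircle.coe_eq_zero_iff] at h2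
    obtain ⟨k, hk⟩ := h2
    refine ⟨k, ?_⟩
    rw [ZMod.toAddCircle_intCast]
    have he : (e : ℝ) ≠ 0 := by exact_mod_cast NeZero.ne e
    have : r = k / e := by
      rw [eq_div_iff he]
      simp at hk
      linarith
    rw [this]
  choose f hf using hr
  refine ⟨AddMonoidHom.mk' f fun x y => ?_, ?_⟩
  · apply ZMod.toAddCircle_injective e
    rw [map_add, hf, hf, hf, map_add]
  · apply ZMod.toAddCircle_injective e
    rw [AddMonoidHom.mk'_apply, hf, ← hi1]
    exact DFunLike.congr_fun hc 1

lemma split (X : Type) [AddCommGroup X] [Finite X] : ∃ (e : ℕ) (H : AddSubgroup X), e ≠ 0 ∧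
    (∀ x : X, e • x = 0) ∧ (∀ d : ℕ, (∀ x : X, d • x = 0) → e ∣ d) ∧
    Nonempty (X ≃+ ZMod e × H) := by
  obtain ⟨g, hg⟩ := AddMonoid.exists_addOrderOf_eq_exponent
    (AddMonoid.ExponentExists.of_finite (G := X))
  have he0 : AddMonoid.exponent X ≠ 0 := AddMonoid.exponent_ne_zero_of_finite
  have hx : ∀ x : X, AddMonoid.exponent X • x = 0 := AddMonoid.exponent_nsmul_eq_zero
  have hd : ∀ d : ℕ, (∀ x : X, d • x = 0) → AddMonoid.exponent X ∣ d := fun d h =>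
    AddMonoid.exponent_dvd_of_forall_nsmul_eq_zero h
  generalize AddMonoid.exponent X = e at *
  have : NeZero e := ⟨he0⟩
  obtain ⟨f, hf⟩ := exists_char e g hg hx
  let i : ZMod e →+ X := ZMod.lift e ⟨zmultiplesHom X g, by simp [hx]⟩
  have hi1 : i 1 = g := by
    have := ZMod.lift_coe e ⟨zmultiplesHom X g, by simp [hx]⟩ 1
    simpa using this
  have hfi : ∀ a, f (i a) = a := by
    intro a
    obtain ⟨k, rfl⟩ := ZMod.intCast_surjective a
    have h2 : i (k : ZMod e) = k • g := by
      rw [← hi1, ← map_zsmul]; simp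
    rw [h2, map_zsmul, hf]; simp
  refine ⟨e, f.ker, he0, hx, hd, ⟨
    { toFun := fun x => (f x, ⟨x - i (f x), by simp [AddMonoidHom.mem_ker, hfi]⟩)
      invFun := fun p => i p.1 + p.2.1
      left_inv := fun x => by simp
      right_inv := fun p => by
        have h : f p.2.1 = 0 := p.2.2
        ext <;> simp [hfi, h]
      map_add' := fun x y => by
        ext
        · simp
        · simp; abel }⟩⟩

theorem rank_two (X : Type) [AddCommGroup X] [Finite X] (h : ∀ n, n ≠ 0 → tc X n ≤ n ^ 2) :
    ∃ m k : ℕ, 0 < m ∧ 0 < k ∧ tc X m = m ^ 2 ∧ Nonempty (X ≃+ ZMod m × ZMod (m * k)) := by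
  obtain ⟨e, H, he0, hx, -, ⟨f⟩⟩ := split X
  obtain ⟨d, H', hd0, hy, hd, ⟨f'⟩⟩ := split H
  have : NeZero e := ⟨he0⟩
  have : NeZero d := ⟨hd0⟩
  obtain ⟨k, rfl⟩ : d ∣ e := hd e fun x => Subtype.ext (hx x)
  have hk : 0 < k := Nat.pos_of_ne_zero (right_ne_zero_of_mul he0)
  have f3 : X ≃+ ZMod (d * k) × (ZMod d × H') := f.trans (AddEquiv.prodCongr (AddEquiv.refl _) f')
  have hH : Subsingleton H' := by
    by_contra hns
    rw [not_subsingleton_iff_nontrivial] at hns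
    obtain ⟨l, hl, hlc⟩ := Nat.exists_prime_and_dvd (n := Nat.card H')
      (Finite.one_lt_card (α := H')).ne'
    have := Fact.mk hl
    obtain ⟨x, hxl⟩ := exists_prime_addOrderOf_dvd_card' l hlc
    have hld : l ∣ d := by
      rw [← hxl, addOrderOf_dvd_iff_nsmul_eq_zero]
      exact Subtype.ext (hy x.1)
    have h1 := tc_ge_prime (X := H') l hl hlc
    have h2 := tc_ge_prime (X := ZMod d) l hl (by simpa using hld)
    have h3 := tc_ge_prime (X := ZMod (d * k)) l hl (by simpa using hld.mul_right k)
    have h4 := h l hl.ne_zero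
    rw [tc_congr f3] at h4
    have h5 : l * (l * l) ≤ l ^ 2 := calc
      l * (l * l) ≤ tc (ZMod (d * k)) l * (tc (ZMod d) l * tc H' l) := by gcongr
      _ ≤ tc (ZMod (d * k)) l * tc (ZMod d × H') l := by gcongr; exact tc_prod l
      _ ≤ _ := tc_prod l
      _ ≤ _ := h4
    have := hl.two_le
    nlinarith [mul_pos hl.pos hl.pos]
  have : Unique H' := ⟨⟨0⟩, fun _ => Subsingleton.elim _ _⟩
  have f4 : X ≃+ ZMod d × ZMod (d * k) :=
    (f3.trans (AddEquiv.prodCongr (AddEquiv.refl _) AddEquiv.prodUnique)).trans AddEquiv.prodComm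
  refine ⟨d, k, Nat.pos_of_ne_zero hd0, hk, le_antisymm (h d hd0) ?_, ⟨f4⟩⟩
  rw [tc_congr f4]
  have h1 : d ≤ tc (ZMod d) d := tc_ge 1 d (by simp)
  have h2 : d ≤ tc (ZMod (d * k)) d := tc_ge (k • 1) d (by
    rw [addOrderOf_nsmul_of_dvd hk.ne' (by simp)]
    simp [hk])
  calc d ^ 2 = d * d := sq d
    _ ≤ tc (ZMod d) d * tc (ZMod (d * k)) d := by gcongr
    _ ≤ _ := tc_prod d

end grp
end EC
end

/-- For a prime `p` and an elliptic curve `E : y² = x³ + Ax + B` over `𝔽_p` (nonsingular,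
i.e. with nonzero discriminant), there are positive integers `m`, `k` with
`E(𝔽_p) ≃ ℤ/mℤ × ℤ/mkℤ` and `m ∣ p - 1`. -/
theorem stmt_0 (p : ℕ) [Fact p.Prime] (A B : ZMod p)
    (hΔ : (shortWeierstrass (ZMod p) A B).Δ ≠ 0) :
    ∃ m k : ℕ, 0 < m ∧ 0 < k ∧ m ∣ p - 1 ∧
      Nonempty ((shortWeierstrass (ZMod p) A B).Point ≃+ ZMod m × ZMod (m * k)) := by
  classical
  obtain ⟨K, _, _, _, _, y, hG⟩ := EC.exists_gen A B
  have hfin : Finite (EC.Pt A B (ZMod p)) := by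
    let f : EC.Pt A B (ZMod p) → Option (ZMod p × ZMod p) := fun P =>
      match P with
      | WeierstrassCurve.Affine.Point.zero => none
      | WeierstrassCurve.Affine.Point.some x y _ => Option.some (x, y)
    refine Finite.of_injective f ?_
    intro P Q h
    rcases P with _ | ⟨x, y, hP⟩ <;> rcases Q with _ | ⟨x', y', hQ⟩ <;> simp_all [f]
  obtain ⟨m, k, hm, hk, ht, hiso⟩ := EC.rank_two (EC.Pt A B (ZMod p))
    fun n hn => EC.lemmaA hΔ hG n hn
  have hd := EC.lemmaB hΔ hG m hm.ne' ht
  rw [ZMod.card] at hd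
  refine ⟨m, k, hm, hk, hd, ?_⟩
  have e : (shortWeierstrass (ZMod p) A B).baseChange (ZMod p) = shortWeierstrass (ZMod p) A B :=
    WeierstrassCurve.map_id _
  unfold EC.Pt at hiso
  have key : ∀ W : WeierstrassCurve.Affine (ZMod p), W = shortWeierstrass (ZMod p) A B →
      Nonempty (W.Point ≃+ ZMod m × ZMod (m * k)) →
      Nonempty ((shortWeierstrass (ZMod p) A B).Point ≃+ ZMod m × ZMod (m * k)) := by
    rintro _ rfl h; exact h
  exact key _ e hiso
end

section
/- (Hasse's theorem) Let E be an elliptic curve defined over the finite field F_p for a prime p. Then |#E(F_p) − p − 1| ≤ 2√p, where #E(F_p) is the number of F_p-rational points of E including the point at infinity. -/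
open Polynomial

set_option linter.unusedSectionVars false

section generic
variable {K : Type} [Field K] [DecidableEq K]

/-- The addition-subtraction formula on `x`-coordinates, affine generic case. -/
lemma addSub_aux (a b x₁ y₁ x₂ y₂ : K) (h₁ : y₁ ^ 2 = x₁ ^ 3 + a * x₁ + b)
    (h₂ : y₂ ^ 2 = x₂ ^ 3 + a * x₂ + b) (hx : x₁ - x₂ ≠ 0) :
    ((((y₁ - y₂) / (x₁ - x₂)) ^ 2 - x₁ - x₂) + (((y₁ + y₂) / (x₁ - x₂)) ^ 2 - x₁ - x₂))
      * (x₁ - x₂) ^ 2 = 2 * ((x₁ + x₂) * (x₁ * x₂ + a) + 2 * b) ∧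
    ((((y₁ - y₂) / (x₁ - x₂)) ^ 2 - x₁ - x₂) * (((y₁ + y₂) / (x₁ - x₂)) ^ 2 - x₁ - x₂))
      * (x₁ - x₂) ^ 2 = (x₁ * x₂ - a) ^ 2 - 4 * b * (x₁ + x₂) := by
  have e1 : (((y₁ - y₂) / (x₁ - x₂)) ^ 2 - x₁ - x₂) * (x₁ - x₂) ^ 2
      = (y₁ - y₂) ^ 2 - (x₁ + x₂) * (x₁ - x₂) ^ 2 := by field_simp; ring
  have e2 : (((y₁ + y₂) / (x₁ - x₂)) ^ 2 - x₁ - x₂) * (x₁ - x₂) ^ 2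
      = (y₁ + y₂) ^ 2 - (x₁ + x₂) * (x₁ - x₂) ^ 2 := by field_simp; ring
  constructor
  · rw [add_mul, e1, e2]
    linear_combination 2 * h₁ + 2 * h₂
  · have h0 : (x₁ - x₂) ^ 2 ≠ 0 := pow_ne_zero _ hx
    apply mul_right_cancel₀ h0
    set X3 := ((y₁ - y₂) / (x₁ - x₂)) ^ 2 - x₁ - x₂
    set X4 := ((y₁ + y₂) / (x₁ - x₂)) ^ 2 - x₁ - x₂
    have : X3 * X4 * (x₁ - x₂) ^ 2 * (x₁ - x₂) ^ 2
       = (X3 * (x₁ - x₂) ^ 2) * (X4 * (x₁ - x₂) ^ 2) := by ring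
    rw [this, e1, e2]
    have e3 : (y₁ - y₂) ^ 2 * (y₁ + y₂) ^ 2 = (y₁ ^ 2 - y₂ ^ 2) ^ 2 := by ring
    have e4 : (y₁ - y₂) ^ 2 + (y₁ + y₂) ^ 2 = 2 * (y₁ ^ 2 + y₂ ^ 2) := by ring
    have : ((y₁ - y₂) ^ 2 - (x₁ + x₂) * (x₁ - x₂) ^ 2) *
       ((y₁ + y₂) ^ 2 - (x₁ + x₂) * (x₁ - x₂) ^ 2) =
       (y₁ - y₂) ^ 2 * (y₁ + y₂) ^ 2 - (x₁ + x₂) * (x₁ - x₂) ^ 2 *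
        ((y₁ - y₂) ^ 2 + (y₁ + y₂) ^ 2) + ((x₁ + x₂) * (x₁ - x₂) ^ 2) ^ 2 := by ring
    rw [this, e3, e4, h₁, h₂]
    ring

lemma sW_equation (a b x y : K) :
    (shortWeierstrass K a b).Equation x y ↔ y ^ 2 = x ^ 3 + a * x + b := by
  rw [WeierstrassCurve.Affine.equation_iff]
  simp [shortWeierstrass]

lemma sW_negY (a b x y : K) : (shortWeierstrass K a b).negY x y = -y := by
  simp [shortWeierstrass, WeierstrassCurve.Affine.negY]

lemma sW_addX (a b x y l : K) : (shortWeierstrass K a b).addX x y l = l ^ 2 - x - y := by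
  simp [shortWeierstrass, WeierstrassCurve.Affine.addX]

/-- The relation between the `x`-coordinates of `R`, `R + P`, `R - P`. -/
lemma addSub (a b : K) (h2 : (2 : K) ≠ 0) (R : (shortWeierstrass K a b).Point) (x₂ y₂ : K)
    (h : (shortWeierstrass K a b).Nonsingular x₂ y₂) (hy : y₂ ≠ 0) :
    ∃ c : K, c ≠ 0 ∧
      (R + .some x₂ y₂ h).xRep 1 * (R - .some x₂ y₂ h).xRep 1 * c
        = (R.xRep 0 - x₂ * R.xRep 1) ^ 2 ∧
      ((R + .some x₂ y₂ h).xRep 0 * (R - .some x₂ y₂ h).xRep 1 +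
        (R - .some x₂ y₂ h).xRep 0 * (R + .some x₂ y₂ h).xRep 1) * c
        = 2 * ((R.xRep 0 + x₂ * R.xRep 1) * (R.xRep 0 * x₂ + a * R.xRep 1)
            + 2 * b * R.xRep 1 ^ 2) ∧
      (R + .some x₂ y₂ h).xRep 0 * (R - .some x₂ y₂ h).xRep 0 * c
        = (R.xRep 0 * x₂ - a * R.xRep 1) ^ 2
          - 4 * b * R.xRep 1 * (R.xRep 0 + x₂ * R.xRep 1) := by
  have hne : y₂ ≠ (shortWeierstrass K a b).negY x₂ y₂ := by
    rw [sW_negY]; intro h'; apply hy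
    have : 2 * y₂ = 0 := by linear_combination h'
    simpa [h2] using this
  have e₂ := (sW_equation a b x₂ y₂).1 h.1
  -- doubling
  have hdbl : ∃ x₃ : K, (WeierstrassCurve.Affine.Point.some x₂ y₂ h +
      WeierstrassCurve.Affine.Point.some x₂ y₂ h).xRep = ![x₃, 1] ∧
      x₃ * (4 * y₂ ^ 2) = (x₂ * x₂ - a) ^ 2 - 4 * b * (x₂ + x₂) := by
    rw [WeierstrassCurve.Affine.Point.add_self_of_Y_ne hne]
    refine ⟨_, rfl, ?_⟩
    rw [sW_addX, WeierstrassCurve.Affine.slope_of_Y_ne rfl hne, sW_negY]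
    simp only [shortWeierstrass]
    have : (y₂ - -y₂) = 2 * y₂ := by ring
    rw [this]
    field_simp
    rw [e₂]
    ring
  obtain ⟨x₃, hx₃, hx₃'⟩ := hdbl
  have h4 : (4 * y₂ ^ 2 : K) ≠ 0 := by
    have : (4 : K) = 2 ^ 2 := by norm_num
    rw [this]; positivity
  rcases R with _ | ⟨x₁, y₁, h₁⟩
  · refine ⟨1, one_ne_zero, ?_⟩
    rw [← WeierstrassCurve.Affine.Point.zero_def]
    simp only [zero_add, zero_sub, WeierstrassCurve.Affine.Point.xRep_neg]
    simp
    exact ⟨by ring, by ring⟩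
  · have e₁ := (sW_equation a b x₁ y₁).1 h₁.1
    by_cases hx : x₁ = x₂
    · subst hx
      refine ⟨4 * y₂ ^ 2, h4, ?_⟩
      have : y₁ = y₂ ∨ y₁ = -y₂ := sq_eq_sq_iff_eq_or_eq_neg.1 (e₁.trans e₂.symm)
      rcases this with rfl | rfl
      · rw [sub_self, hx₃]
        simp
        refine ⟨?_, ?_⟩
        · rw [e₂]; ring
        · rw [hx₃']
      · have hneg : (WeierstrassCurve.Affine.Point.some x₁ (-y₂) h₁) = 
            - (WeierstrassCurve.Affine.Point.some x₁ y₂ h) := by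
          rw [WeierstrassCurve.Affine.Point.neg_some]
          simp [shortWeierstrass]
        have : -(WeierstrassCurve.Affine.Point.some x₁ y₂ h) - 
           (WeierstrassCurve.Affine.Point.some x₁ y₂ h) = 
           -((WeierstrassCurve.Affine.Point.some x₁ y₂ h) + 
           (WeierstrassCurve.Affine.Point.some x₁ y₂ h)) := by abel
        rw [hneg, neg_add_cancel, this, WeierstrassCurve.Affine.Point.xRep_neg, 
          WeierstrassCurve.Affine.Point.xRep_neg, hx₃]
        simp
        refine ⟨?_, ?_⟩
        · rw [e₂]; ring
        · rw [hx₃']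
    · have hx' : x₁ - x₂ ≠ 0 := sub_ne_zero.2 hx
      refine ⟨(x₁ - x₂) ^ 2, pow_ne_zero _ hx', ?_⟩
      rw [sub_eq_add_neg, WeierstrassCurve.Affine.Point.neg_some,
        WeierstrassCurve.Affine.Point.add_of_X_ne hx, WeierstrassCurve.Affine.Point.add_of_X_ne hx]
      obtain ⟨k1, k2⟩ := addSub_aux a b x₁ y₁ x₂ y₂ e₁ e₂ hx'
      simp only [WeierstrassCurve.Affine.Point.xRep_some, sW_addX, sW_negY,
        WeierstrassCurve.Affine.slope_of_X_ne hx, sub_neg_eq_add, Matrix.cons_val_zero,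
        Matrix.cons_val_one, mul_one, one_mul]
      refine ⟨trivial, ?_, ?_⟩
      · rw [k1]; ring
      · rw [k2]

end generic

section poly
variable {F : Type} [Field F]

/-- `λ = t³ + A t + B`. -/
noncomputable def lam (A B : F) : F[X] := X ^ 3 + C A * X + C B

lemma lam_natDegree (A B : F) : (lam A B).natDegree = 3 := by
  unfold lam; compute_degree!

lemma lam_ne_zero (A B : F) : lam A B ≠ 0 := by
  intro h
  have := lam_natDegree A B
  rw [h] at this; simp at this

/-- First coordinate of the addition-subtraction map. -/
noncomputable def T0 (f g : F[X]) : F[X] := (f - X * g) ^ 2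
/-- Second coordinate of the addition-subtraction map. -/
noncomputable def T1 (A B : F) (f g : F[X]) : F[X] :=
  2 * ((f + X * g) * (X * f + C A * g) + 2 * C B * g ^ 2)
/-- Third coordinate of the addition-subtraction map. -/
noncomputable def T2 (A B : F) (f g : F[X]) : F[X] :=
  (X * f - C A * g) ^ 2 - 4 * C B * g * (f + X * g)

lemma two_unit (h2 : (2 : F) ≠ 0) : IsUnit (2 : F[X]) := by
  have : (2 : F[X]) = C 2 := (map_ofNat C 2).symm
  rw [this]; exact isUnit_C.2 (isUnit_iff_ne_zero.2 h2)

lemma T_prim (A B : F) (h2 : (2 : F) ≠ 0) (hD : 4 * A ^ 3 + 27 * B ^ 2 ≠ 0) (f g : F[X])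
    (hfg : IsCoprime f g) (q : F[X]) (hq : Prime q) (d0 : q ∣ T0 f g) (d1 : q ∣ T1 A B f g)
    (d2 : q ∣ T2 A B f g) : False := by
  have h0 : q ∣ f - X * g := hq.dvd_of_dvd_pow d0
  obtain ⟨k, hk⟩ := h0
  have hf : f = X * g + q * k := by linear_combination hk
  have hg : ¬ q ∣ g := by
    intro hg
    have : q ∣ f := by rw [hf]; exact dvd_add (hg.mul_left _) (dvd_mul_right _ _)
    exact hq.not_isUnit (hfg.isUnit_of_dvd' this hg)
  have e1 : q ∣ 2 * (2 * (g ^ 2 * lam A B)) := by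
    rw [← dvd_sub_right (b := T1 A B f g) d1] 
    subst hf
    unfold T1 lam
    refine ⟨2 * (k * (X * (X * g + q * k) + C A * g) + 2 * X * g * X * k), ?_⟩
    ring
  have u2 := two_unit h2
  rw [u2.dvd_mul_left, u2.dvd_mul_left] at e1
  have e2 : q ∣ lam A B := (hq.dvd_or_dvd e1).resolve_left (fun h => hg (hq.dvd_of_dvd_pow h))
  have e3 : q ∣ g ^ 2 * ((X ^ 2 - C A) ^ 2 - 8 * C B * X) := by
    rw [← dvd_sub_right (b := T2 A B f g) d2] 
    subst hf
    unfold T2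
    refine ⟨X * k * (2 * (X * (X * g) - C A * g) + X * q * k)  - 4 * C B * g * k, ?_⟩
    ring
  have e4 : q ∣ (3 * X ^ 2 + C A) ^ 2 := by
    have := (hq.dvd_or_dvd e3).resolve_left (fun h => hg (hq.dvd_of_dvd_pow h))
    have h : (3 * X ^ 2 + C A) ^ 2 = ((X ^ 2 - C A) ^ 2 - 8 * C B * X) + 8 * X * lam A B := by
      unfold lam; ring
    rw [h]; exact dvd_add this (e2.mul_left _)
  have e5 := hq.dvd_of_dvd_pow e4
  have e6 : q ∣ C (4 * A ^ 3 + 27 * B ^ 2) := by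
    have h : C (4 * A ^ 3 + 27 * B ^ 2) = lam A B * (-18 * C A * X + 27 * C B) +
      (3 * X ^ 2 + C A) * (6 * C A * X ^ 2 - 9 * C B * X + 4 * C A ^ 2) := by
      simp only [map_add, map_mul, map_pow, lam, map_ofNat]; ring
    rw [h]; exact dvd_add (e2.mul_right _) (e5.mul_right _)
  exact hq.not_isUnit (isUnit_of_dvd_unit e6 (isUnit_C.2 (isUnit_iff_ne_zero.2 hD)))

lemma S_prim (f₁ g₁ f₂ g₂ : F[X]) (h₁ : IsCoprime f₁ g₁) (h₂ : IsCoprime f₂ g₂)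
    (q : F[X]) (hq : Prime q) (d0 : q ∣ g₁ * g₂) (d1 : q ∣ f₁ * g₂ + f₂ * g₁)
    (d2 : q ∣ f₁ * f₂) : False := by
  have key : ∀ f₁ g₁ f₂ g₂ : F[X], IsCoprime f₁ g₁ → IsCoprime f₂ g₂ → q ∣ g₁ →
      q ∣ f₁ * g₂ + f₂ * g₁ → q ∣ f₁ * f₂ → False := by
    intro f₁ g₁ f₂ g₂ h₁ h₂ hg d1 d2
    have hf : ¬ q ∣ f₁ := fun hf => hq.not_isUnit (h₁.isUnit_of_dvd' hf hg)
    have hf2 := (hq.dvd_or_dvd d2).resolve_left hf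
    have : q ∣ f₁ * g₂ := (dvd_add_left (hg.mul_left _)).1 d1
    exact hq.not_isUnit (h₂.isUnit_of_dvd' hf2 ((hq.dvd_or_dvd this).resolve_left hf))
  rcases hq.dvd_or_dvd d0 with h | h
  · exact key _ _ _ _ h₁ h₂ h d1 d2
  · exact key _ _ _ _ h₂ h₁ h (by rwa [add_comm]) (by rwa [mul_comm])

lemma unit_of_prim (n s0 s1 s2 : F[X]) (hn : n ≠ 0)
    (h : ∀ q, Prime q → q ∣ s0 → q ∣ s1 → q ∣ s2 → False) (d0 : n ∣ s0) (d1 : n ∣ s1)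
    (d2 : n ∣ s2) : IsUnit n := by
  by_contra hu
  obtain ⟨q, hq, hd⟩ := WfDvdMonoid.exists_irreducible_factor hu hn
  exact h q hq.prime (hd.trans d0) (hd.trans d1) (hd.trans d2)

/-- Two primitive proportional triples agree up to a constant. -/
lemma prop_unit (s0 s1 s2 t0 t1 t2 : F[X])
    (hs : ∀ q, Prime q → q ∣ s0 → q ∣ s1 → q ∣ s2 → False)
    (ht : ∀ q, Prime q → q ∣ t0 → q ∣ t1 → q ∣ t2 → False) (e : RatFunc F) (he : e ≠ 0)
    (h0 : algebraMap F[X] (RatFunc F) t0 = e * algebraMap F[X] (RatFunc F) s0)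
    (h1 : algebraMap F[X] (RatFunc F) t1 = e * algebraMap F[X] (RatFunc F) s1)
    (h2 : algebraMap F[X] (RatFunc F) t2 = e * algebraMap F[X] (RatFunc F) s2) :
    ∃ w : F, w ≠ 0 ∧ t0 = C w * s0 ∧ t1 = C w * s1 ∧ t2 = C w * s2 := by
  have hc := RatFunc.isCoprime_num_denom e
  have hd0 := RatFunc.denom_ne_zero e
  have hn0 : RatFunc.num e ≠ 0 := RatFunc.num_ne_zero he
  have inj := RatFunc.algebraMap_injective F
  have key : ∀ s t : F[X], algebraMap F[X] (RatFunc F) t = e * algebraMap F[X] (RatFunc F) s →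
      e.denom * t = e.num * s := by
    intro s t h
    apply inj
    rw [map_mul, map_mul, h]
    nth_rewrite 2 [← RatFunc.num_div_denom e]
    have : algebraMap F[X] (RatFunc F) e.denom ≠ 0 := by
      rwa [Ne, map_eq_zero_iff _ inj]
    field_simp
  have k0 := key _ _ h0
  have k1 := key _ _ h1
  have k2 := key _ _ h2
  have ud : IsUnit e.denom := unit_of_prim _ _ _ _ hd0 hs
    (hc.symm.dvd_of_dvd_mul_left (Dvd.intro _ k0)) (hc.symm.dvd_of_dvd_mul_left (Dvd.intro _ k1))
    (hc.symm.dvd_of_dvd_mul_left (Dvd.intro _ k2))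
  have un : IsUnit e.num := unit_of_prim _ _ _ _ hn0 ht
    (hc.dvd_of_dvd_mul_left (Dvd.intro _ k0.symm)) (hc.dvd_of_dvd_mul_left (Dvd.intro _ k1.symm))
    (hc.dvd_of_dvd_mul_left (Dvd.intro _ k2.symm))
  obtain ⟨a, ha, hae⟩ := Polynomial.isUnit_iff.1 ud
  obtain ⟨b, hb, hbe⟩ := Polynomial.isUnit_iff.1 un
  have ha0 := ha.ne_zero
  have hb0 := hb.ne_zero
  rw [← hae, ← hbe] at k0 k1 k2
  have fin : ∀ s t : F[X], C a * t = C b * s → t = C (b / a) * s := by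
    intro s t h
    have : C a ≠ 0 := C_ne_zero.2 ha0
    apply mul_left_cancel₀ this
    rw [h, ← mul_assoc, ← C_mul]
    congr 2; field_simp
  exact ⟨b / a, div_ne_zero hb0 ha0, fin _ _ k0, fin _ _ k1, fin _ _ k2⟩

lemma degree_aux (d : ℕ) (f₁ g₁ f₂ g₂ : F[X]) (b0 : (g₁ * g₂).natDegree ≤ 2 * d)
    (b1 : (f₁ * g₂ + f₂ * g₁).natDegree ≤ 2 * d + 1) (b2 : (f₁ * f₂).natDegree = 2 * d + 2) :
    g₁.degree < f₁.degree := by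
  have hf : f₁ * f₂ ≠ 0 := by intro h; rw [h] at b2; simp at b2
  have hf₁ := left_ne_zero_of_mul hf
  have hf₂ := right_ne_zero_of_mul hf
  by_contra hcon
  rw [not_lt] at hcon
  have hg₁ : g₁ ≠ 0 := by
    rintro rfl; simp at hcon; exact hf₁ hcon
  have hn : f₁.natDegree ≤ g₁.natDegree := natDegree_le_natDegree hcon
  rw [natDegree_mul hf₁ hf₂] at b2
  have h1 : (f₂ * g₁).natDegree ≥ 2 * d + 2 := by rw [natDegree_mul hf₂ hg₁]; omega
  have h2 : (f₁ * g₂).natDegree ≥ 2 * d + 2 := by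
    by_contra hlt
    have : f₂ * g₁ = (f₁ * g₂ + f₂ * g₁) - f₁ * g₂ := by ring
    have h3 := natDegree_sub_le (f₁ * g₂ + f₂ * g₁) (f₁ * g₂)
    rw [← this] at h3
    have := h3.trans (max_le b1 (by omega : (f₁ * g₂).natDegree ≤ 2 * d + 1))
    omega
  have hg₂ : g₂ ≠ 0 := by rintro rfl; simp at h2
  rw [natDegree_mul hf₁ hg₂] at h2
  rw [natDegree_mul hg₁ hg₂] at b0
  omega

lemma T_degree (A B : F) (f g : F[X]) (h : g.degree < f.degree) :
    (T0 f g).natDegree ≤ 2 * f.natDegree ∧ (T1 A B f g).natDegree ≤ 2 * f.natDegree + 1 ∧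
    (T2 A B f g).natDegree = 2 * f.natDegree + 2 := by
  have hf : f ≠ 0 := by rintro rfl; simp at h
  set d := f.natDegree with hd
  have hg : g.natDegree ≤ d := natDegree_le_natDegree h.le
  have hXg : (X * g).natDegree ≤ d := by
    by_cases g0 : g = 0
    · simp [g0]
    · rw [natDegree_X_mul g0]
      exact natDegree_lt_natDegree g0 h
  have hXf : (X * f).natDegree = d + 1 := natDegree_X_mul hf
  have hCg : (C A * g).natDegree ≤ d := (natDegree_C_mul_le _ _).trans hg
  have hs : (f + X * g).natDegree ≤ d := natDegree_add_le_of_degree_le le_rfl hXg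
  have hs' : (X * f + C A * g).natDegree ≤ d + 1 :=
    natDegree_add_le_of_degree_le hXf.le (hCg.trans (Nat.le_succ _))
  have hm : (X * f - C A * g).natDegree = d + 1 := by
    rw [natDegree_sub_eq_left_of_natDegree_lt, hXf]; omega
  refine ⟨?_, ?_, ?_⟩
  · refine natDegree_pow_le.trans ?_
    have := (natDegree_sub_le f (X * g)).trans (max_le le_rfl hXg)
    omega
  · unfold T1
    have c2 : (2 : F[X]) = C 2 := (map_ofNat C 2).symm
    rw [c2]
    refine (natDegree_C_mul_le _ _).trans ?_
    refine natDegree_add_le_of_degree_le ?_ ?_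
    · refine natDegree_mul_le.trans ?_; omega
    · rw [← C_mul]
      refine (natDegree_C_mul_le _ _).trans ?_
      refine natDegree_pow_le.trans ?_; omega
  · unfold T2
    have c4 : (4 : F[X]) = C 4 := (map_ofNat C 4).symm
    have hr : (4 * C B * g * (f + X * g)).natDegree ≤ 2 * d := by
      rw [c4, ← C_mul, mul_assoc]
      refine (natDegree_C_mul_le _ _).trans ?_
      refine natDegree_mul_le.trans ?_; omega
    have hl : ((X * f - C A * g) ^ 2).natDegree = 2 * d + 2 := by
      rw [natDegree_pow, hm]; ring
    rw [natDegree_sub_eq_left_of_natDegree_lt, hl]; omega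

end poly

section rep
variable {F : Type} [Field F] [DecidableEq (RatFunc F)]

local notation "ι" => algebraMap F[X] (RatFunc F)

/-- The quadratic twist over the function field. -/
noncomputable abbrev TW (A B : F) : WeierstrassCurve.Affine (RatFunc F) :=
  shortWeierstrass (RatFunc F) (algebraMap F[X] (RatFunc F) (C A * lam A B ^ 2))
    (algebraMap F[X] (RatFunc F) (C B * lam A B ^ 3))

/-- `f / g` is the reduced fraction of the normalized `x`-coordinate of `P`. -/
def XFrac (A B : F) (P : (TW A B).Point) (f g : F[X]) : Prop :=
  IsCoprime f g ∧ ∃ s : RatFunc F, s ≠ 0 ∧ ι (lam A B) * ι f = s * P.xRep 0 ∧ ι g = s * P.xRep 1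

lemma iota_lam_ne (A B : F) : ι (lam A B) ≠ 0 := by
  rw [Ne, map_eq_zero_iff _ (RatFunc.algebraMap_injective F)]
  exact lam_ne_zero A B

lemma rep_exists (A B : F) (P : (TW A B).Point) : ∃ f g, XFrac A B P f g := by
  have hl := iota_lam_ne A B
  rcases P with _ | ⟨x, y, h⟩
  · refine ⟨1, 0, isCoprime_one_left, ι (lam A B), hl, ?_⟩
    rw [← WeierstrassCurve.Affine.Point.zero_def]
    simp
  · refine ⟨(x / ι (lam A B)).num, (x / ι (lam A B)).denom, RatFunc.isCoprime_num_denom _,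
      ι (x / ι (lam A B)).denom, ?_, ?_, ?_⟩
    · rw [Ne, map_eq_zero_iff _ (RatFunc.algebraMap_injective F)]
      exact RatFunc.denom_ne_zero _
    · have hd : ι (x / ι (lam A B)).denom ≠ 0 := by
        rw [Ne, map_eq_zero_iff _ (RatFunc.algebraMap_injective F)]
        exact RatFunc.denom_ne_zero _
      have := RatFunc.num_div_denom (x / ι (lam A B))
      rw [div_eq_div_iff hd hl] at this
      simp
      linear_combination this
    · simp

lemma rep_unique (A B : F) (P : (TW A B).Point) (f g f' g' : F[X]) (h : XFrac A B P f g)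
    (h' : XFrac A B P f' g') : f.natDegree = f'.natDegree := by
  obtain ⟨hc, s, hs, h1, h2⟩ := h
  obtain ⟨hc', s', hs', h1', h2'⟩ := h'
  have key : f * g' = f' * g := by
    apply RatFunc.algebraMap_injective F
    apply mul_left_cancel₀ (iota_lam_ne A B)
    rw [map_mul, map_mul, ← mul_assoc, ← mul_assoc, h1, h1', h2, h2']
    ring
  have d1 : f ∣ f' := hc.dvd_of_dvd_mul_right (Dvd.intro _ key)
  have d2 : f' ∣ f := hc'.dvd_of_dvd_mul_right (Dvd.intro _ key.symm)
  exact natDegree_eq_of_degree_eq (degree_eq_degree_of_associated (associated_of_dvd_dvd d1 d2))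

lemma rep_step (A B : F) (h2 : (2 : F) ≠ 0) (hD : 4 * A ^ 3 + 27 * B ^ 2 ≠ 0)
    (x y : RatFunc F) (hx : x = ι (lam A B) * ι X) (hy : y ≠ 0) (hP : (TW A B).Nonsingular x y)
    (R : (TW A B).Point) (f g f₁ g₁ f₂ g₂ : F[X])
    (r : XFrac A B R f g) (r₁ : XFrac A B (R + .some x y hP) f₁ g₁)
    (r₂ : XFrac A B (R - .some x y hP) f₂ g₂) (hdeg : g.degree < f.degree) :
    g₁.degree < f₁.degree ∧ g₂.degree < f₂.degree ∧
      f₁.natDegree + f₂.natDegree = 2 * f.natDegree + 2 := by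
  have hl := iota_lam_ne A B
  obtain ⟨hc, s, hs, e1, e2⟩ := r
  obtain ⟨hc₁, s₁, hs₁, e1₁, e2₁⟩ := r₁
  obtain ⟨hc₂, s₂, hs₂, e1₂, e2₂⟩ := r₂
  have h2' : (2 : RatFunc F) ≠ 0 := by
    have : (2 : RatFunc F) = ι (C 2) := by rw [map_ofNat, map_ofNat]
    rw [this, Ne, map_eq_zero_iff _ (RatFunc.algebraMap_injective F)]
    exact C_ne_zero.2 h2
  obtain ⟨c, hc0, k0, k1, k2⟩ := addSub _ _ h2' R x y hP hy
  generalize hu1 : (R + WeierstrassCurve.Affine.Point.some x y hP).xRep = U₁ at *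
  generalize hu2 : (R - WeierstrassCurve.Affine.Point.some x y hP).xRep = U₂ at *
  generalize hu : R.xRep = U at *
  simp only [map_mul, map_pow] at k0 k1 k2
  subst hx
  have hgoal : ∃ w : F, w ≠ 0 ∧ T0 f g = C w * (g₁ * g₂) ∧
      T1 A B f g = C w * (f₁ * g₂ + f₂ * g₁) ∧ T2 A B f g = C w * (f₁ * f₂) := by
    apply prop_unit _ _ _ _ _ _ (S_prim f₁ g₁ f₂ g₂ hc₁ hc₂) (T_prim A B h2 hD f g hc)
      (s ^ 2 * c / (s₁ * s₂ * ι (lam A B) ^ 2))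
    · positivity
    · rw [T0]
      simp only [map_mul, map_add, map_sub, map_pow]
      rw [div_mul_eq_mul_div, eq_div_iff (by positivity)]
      have a1 : (ι f - ι X * ι g) ^ 2 * (s₁ * s₂ * ι (lam A B) ^ 2) =
        (ι (lam A B) * ι f - ι (lam A B) * ι X * ι g) ^ 2 * (s₁ * s₂) := by ring
      rw [a1, e1, e2, e2₁, e2₂]
      linear_combination (-s ^ 2 * s₁ * s₂) * k0
    · rw [T1]
      simp only [map_mul, map_add, map_sub, map_pow, map_ofNat]
      rw [div_mul_eq_mul_div, eq_div_iff (by positivity)]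
      apply mul_left_cancel₀ hl
      have a1 : ι (lam A B) * (2 * ((ι f + ι X * ι g) * (ι X * ι f + ι (C A) * ι g) +
            2 * ι (C B) * ι g ^ 2) * (s₁ * s₂ * ι (lam A B) ^ 2)) =
        2 * ((ι (lam A B) * ι f + ι (lam A B) * ι X * ι g) *
          ((ι (lam A B) * ι f) * (ι (lam A B) * ι X) + ι (C A) * ι (lam A B) ^ 2 * ι g) +
            2 * (ι (C B) * ι (lam A B) ^ 3) * ι g ^ 2) * (s₁ * s₂) := by ring
      have a2 : ι (lam A B) * (s ^ 2 * c * (ι f₁ * ι g₂ + ι f₂ * ι g₁)) =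
        s ^ 2 * c * ((ι (lam A B) * ι f₁) * ι g₂ + (ι (lam A B) * ι f₂) * ι g₁) := by ring
      rw [a1, a2, e1, e2, e2₁, e2₂, e1₁, e1₂]
      linear_combination (-s ^ 2 * s₁ * s₂) * k1
    · rw [T2]
      simp only [map_mul, map_add, map_sub, map_pow, map_ofNat]
      rw [div_mul_eq_mul_div, eq_div_iff (by positivity)]
      apply mul_left_cancel₀ (pow_ne_zero 2 hl)
      have a1 : ι (lam A B) ^ 2 * (((ι X * ι f - ι (C A) * ι g) ^ 2 -
            4 * ι (C B) * ι g * (ι f + ι X * ι g)) * (s₁ * s₂ * ι (lam A B) ^ 2)) =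
          (((ι (lam A B) * ι f) * (ι (lam A B) * ι X) - ι (C A) * ι (lam A B) ^ 2 * ι g) ^ 2 -
            4 * (ι (C B) * ι (lam A B) ^ 3) * ι g *
            (ι (lam A B) * ι f + ι (lam A B) * ι X * ι g)) * (s₁ * s₂) := by ring
      have a2 : ι (lam A B) ^ 2 * (s ^ 2 * c * (ι f₁ * ι f₂)) =
        s ^ 2 * c * ((ι (lam A B) * ι f₁) * (ι (lam A B) * ι f₂)) := by ring
      rw [a1, a2, e1, e2, e1₁, e1₂]
      linear_combination (-s ^ 2 * s₁ * s₂) * k2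
  obtain ⟨w, hw, t0, t1, t2⟩ := hgoal
  obtain ⟨b0, b1, b2⟩ := T_degree A B f g hdeg
  rw [t0, natDegree_C_mul hw] at b0
  rw [t1, natDegree_C_mul hw] at b1
  rw [t2, natDegree_C_mul hw] at b2
  refine ⟨degree_aux _ f₁ g₁ f₂ g₂ b0 b1 b2, degree_aux f.natDegree f₂ g₂ f₁ g₁ ?_ ?_ ?_, ?_⟩
  · rwa [mul_comm]
  · rwa [add_comm]
  · rwa [mul_comm]
  · have hf : f₁ * f₂ ≠ 0 := by intro h; rw [h] at b2; simp at b2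
    rw [← natDegree_mul (left_ne_zero_of_mul hf) (right_ne_zero_of_mul hf), b2]

lemma rep_seq (A B : F) (h2 : (2 : F) ≠ 0) (hD : 4 * A ^ 3 + 27 * B ^ 2 ≠ 0)
    (x y : RatFunc F) (hx : x = ι (lam A B) * ι X) (hy : y ≠ 0) (hP : (TW A B).Nonsingular x y)
    (Q : (TW A B).Point) (f g : F[X]) (r : XFrac A B Q f g) (hdeg : g.degree < f.degree) :
    ∃ d : ℤ → ℤ, (∀ n, 0 ≤ d n) ∧ (∀ n, d (n + 1) + d (n - 1) = 2 * d n + 2) ∧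
      (d 0 = f.natDegree) ∧ (∀ f' g', XFrac A B (Q - .some x y hP) f' g' → d (-1) = f'.natDegree) := by
  set P := WeierstrassCurve.Affine.Point.some x y hP with hPdef
  have ex : ∀ n : ℤ, ∃ f g, XFrac A B (Q + n • P) f g := fun n => rep_exists A B _
  choose fs gs hr using ex
  have step : ∀ n, (gs n).degree < (fs n).degree → (gs (n + 1)).degree < (fs (n + 1)).degree ∧
      (gs (n - 1)).degree < (fs (n - 1)).degree ∧
      (fs (n + 1)).natDegree + (fs (n - 1)).natDegree = 2 * (fs n).natDegree + 2 := by
    intro n hn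
    refine rep_step A B h2 hD x y hx hy hP (Q + n • P) _ _ _ _ _ _ (hr n) ?_ ?_ hn
    · have := hr (n + 1)
      rwa [add_zsmul, one_zsmul, ← add_assoc] at this
    · have := hr (n - 1)
      rwa [sub_zsmul, one_zsmul, ← sub_eq_add_neg, ← add_sub_assoc] at this
  have h0 : (gs 0).degree < (fs 0).degree := by
    obtain ⟨hc, s, hs, h1, h2⟩ := r
    obtain ⟨hc', s', hs', h1', h2'⟩ := hr 0
    rw [zero_zsmul, add_zero] at h1' h2'
    have key : f * gs 0 = fs 0 * g := by
      apply RatFunc.algebraMap_injective F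
      apply mul_left_cancel₀ (iota_lam_ne A B)
      rw [map_mul, map_mul, ← mul_assoc, ← mul_assoc, h1, h1', h2, h2']
      ring
    have hf : f ≠ 0 := by rintro rfl; simp at hdeg
    have hf' : fs 0 ≠ 0 := by
      intro h
      rw [h, zero_mul] at key
      have h0 : gs 0 = 0 := (mul_eq_zero.1 key).resolve_left hf
      rw [h, h0] at hc'
      exact not_isCoprime_zero_zero hc'
    by_contra hcon
    rw [not_lt] at hcon
    by_cases hg : g = 0
    · rw [hg, mul_zero] at key
      have h0 : gs 0 = 0 := (mul_eq_zero.1 key).resolve_left hf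
      rw [h0] at hcon; simp at hcon; exact hf' hcon
    · have hg' : gs 0 ≠ 0 := by
        rintro h; rw [h] at hcon; simp at hcon; exact hf' hcon
      have k := congrArg natDegree key
      rw [natDegree_mul hf hg', natDegree_mul hf' hg] at k
      have := natDegree_lt_natDegree hg hdeg
      have := natDegree_le_natDegree hcon
      omega
  have hall : ∀ n, (gs n).degree < (fs n).degree := by
    intro n
    induction n with
    | zero => exact h0
    | succ n ih => exact (step _ ih).1
    | pred n ih => exact (step _ ih).2.1
  refine ⟨fun n => (fs n).natDegree, fun n => by positivity, fun n => ?_, ?_, ?_⟩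
  · beta_reduce; exact_mod_cast (step n (hall n)).2.2
  · have := hr 0
    rw [zero_zsmul, add_zero] at this
    beta_reduce; exact_mod_cast rep_unique _ _ _ _ _ _ _ this r
  · intro f' g' h
    have := hr (-1)
    rw [neg_zsmul, one_zsmul, ← sub_eq_add_neg] at this
    beta_reduce; exact_mod_cast rep_unique _ _ _ _ _ _ _ this h

end rep

lemma hasse_arith (p : ℕ) (hp : p.Prime) (hp2 : p ≠ 2) (d : ℤ → ℤ) (h0 : ∀ n, 0 ≤ d n)
    (hs : ∀ n, d (n + 1) + d (n - 1) = 2 * d n + 2) (hd0 : d 0 = p) :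
    (d (-1) - p - 1) ^ 2 ≤ 4 * p := by
  obtain ⟨a, ha⟩ : ∃ a : ℤ, a = p + 1 - d (-1) := ⟨_, rfl⟩
  have form : ∀ n : ℤ, d n = n ^ 2 + a * n + p ∧ d (n - 1) = (n - 1) ^ 2 + a * (n - 1) + p := by
    intro n
    induction n with
    | zero => exact ⟨by simp [hd0], by simp; linarith⟩
    | succ n ih =>
      have := hs n
      refine ⟨?_, ?_⟩
      · rw [ih.1, ih.2] at this; linear_combination this
      · have e : ((n : ℤ) + 1 - 1) = n := by ring
        rw [e]; exact ih.1
    | pred n ih =>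
      have := hs (-n - 1)
      have e : (-(n : ℤ) - 1 + 1) = -n := by ring
      rw [e, ih.1, ih.2] at this
      exact ⟨ih.2, by linear_combination this⟩
  have nn : ∀ n : ℤ, 0 ≤ n ^ 2 + a * n + p := fun n => (form n).1 ▸ h0 n
  have goal : a ^ 2 ≤ 4 * p := by
    by_contra hcon
    push Not at hcon
    rcases Int.even_or_odd' a with ⟨k, hk | hk⟩
    · have := nn (-k)
      subst hk
      nlinarith
    · have h1 := nn (-k)
      subst hk
      have e : (p : ℤ) = k * (k + 1) := by nlinarith
      have hev : Even (k * (k + 1)) := Int.even_mul_succ_self k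
      rw [← e] at hev
      have : Even p := by exact_mod_cast hev
      exact hp2 ((Nat.Prime.even_iff hp).1 this)
  have : (d (-1) - p - 1) = -a := by rw [ha]; ring
  rw [this]; simpa using goal

section count
variable (p : ℕ) [Fact p.Prime]

lemma prod_X_sub_C_zmod : ∏ a : ZMod p, (X - C a) = (X ^ p - X : (ZMod p)[X]) := by
  have h1 := FiniteField.roots_X_pow_card_sub_X (ZMod p)
  rw [ZMod.card] at h1
  have hp1 : 1 < p := (Fact.out : p.Prime).one_lt
  have hm : (X ^ p - X : (ZMod p)[X]).Monic := by
    apply monic_X_pow_sub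
    rw [degree_X]; exact_mod_cast hp1
  have := prod_multiset_X_sub_C_of_monic_of_roots_card_eq hm (by
    rw [h1, FiniteField.X_pow_card_sub_X_natDegree_eq _ hp1]; simp [ZMod.card])
  rw [h1] at this
  exact this

lemma lam_eval (A B a : ZMod p) : (lam A B).eval a = a ^ 3 + A * a + B := by
  simp [lam]

lemma lam_pow_p (A B : ZMod p) : lam A B ^ p = X ^ (3 * p) + C A * X ^ p + C B := by
  rw [← ZMod.expand_card]
  simp only [lam, map_add, map_mul, map_pow, expand_X, expand_C]
  rw [← pow_mul, mul_comm p 3]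

/-- Unreduced numerator of the normalized `x`-coordinate of `Q - P`. -/
noncomputable def N0 (A B : ZMod p) : (ZMod p)[X] :=
  lam A B * (lam A B ^ (p / 2) + 1) ^ 2 - (X ^ p + X) * (X ^ p - X) ^ 2

lemma N0_natDegree (hp2 : p ≠ 2) (A B : ZMod p) : (N0 p A B).natDegree = 2 * p + 1 := by
  have hp := (Fact.out : p.Prime)
  have hodd : p % 2 = 1 := (hp.eq_two_or_odd).resolve_left hp2
  have hp3 : 2 < p := lt_of_le_of_ne hp.two_le (Ne.symm hp2)
  obtain ⟨m, hm⟩ : ∃ m, m = p / 2 := ⟨_, rfl⟩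
  have hpm : p = 2 * m + 1 := by omega
  have e : N0 p A B = X ^ (2 * p + 1) + (X ^ (p + 2) + C A * X ^ p + C B - X ^ 3
      + C 2 * lam A B ^ (m + 1) + lam A B) := by
    have h1 : lam A B * (lam A B ^ m + 1) ^ 2 = lam A B ^ p + C 2 * lam A B ^ (m + 1) + lam A B := by
      have h2 : lam A B ^ p = lam A B ^ (2 * m + 1) := congrArg (lam A B ^ ·) hpm
      rw [map_ofNat, h2]
      ring
    rw [N0, ← hm, h1, lam_pow_p]
    ring
  have hr : (X ^ (p + 2) + C A * X ^ p + C B - X ^ 3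
      + C 2 * lam A B ^ (m + 1) + lam A B).natDegree ≤ 2 * p := by
    refine natDegree_add_le_of_degree_le (natDegree_add_le_of_degree_le ?_ ?_) ?_
    · refine (natDegree_sub_le _ _).trans (max_le ?_ ?_)
      · refine natDegree_add_le_of_degree_le (natDegree_add_le_of_degree_le ?_ ?_) ?_
        · rw [natDegree_X_pow]; omega
        · refine (natDegree_C_mul_le _ _).trans ?_
          rw [natDegree_X_pow]; omega
        · simp
      · rw [natDegree_X_pow]; omega
    · refine (natDegree_C_mul_le _ _).trans (natDegree_pow_le.trans ?_)
      rw [lam_natDegree]; omega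
    · rw [lam_natDegree]; omega
  rw [e, natDegree_add_eq_left_of_natDegree_lt, natDegree_X_pow]
  rw [natDegree_X_pow]; omega

/-- The multiplicity of cancellation at `a`. -/
noncomputable def ee (A B a : ZMod p) : ℕ := (1 - quadraticChar (ZMod p) (a ^ 3 + A * a + B)).toNat

lemma ee_cases (A B a : ZMod p) :
    (quadraticChar (ZMod p) (a ^ 3 + A * a + B) = -1 ∧ ee p A B a = 2) ∨
    (quadraticChar (ZMod p) (a ^ 3 + A * a + B) = 0 ∧ ee p A B a = 1) ∨
    (quadraticChar (ZMod p) (a ^ 3 + A * a + B) = 1 ∧ ee p A B a = 0) := by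
  rcases quadraticChar_isQuadratic (F := ZMod p) (a ^ 3 + A * a + B) with h | h | h <;>
  simp [ee, h]

lemma sq_dvd_frob (a : ZMod p) : (X - C a) ^ 2 ∣ (X ^ p - X : (ZMod p)[X]) ^ 2 := by
  apply pow_dvd_pow_of_dvd
  rw [← prod_X_sub_C_zmod]
  exact Finset.dvd_prod_of_mem _ (Finset.mem_univ a)

lemma dvd_N0_iff (A B a : ZMod p) (k : ℕ) (hk : k ≤ 2) :
    (X - C a) ^ k ∣ N0 p A B ↔ (X - C a) ^ k ∣ lam A B * (lam A B ^ (p / 2) + 1) ^ 2 := by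
  rw [N0]
  exact dvd_sub_left (((pow_dvd_pow _ hk).trans (sq_dvd_frob p a)).mul_left _)

lemma char_pow (hp2 : p ≠ 2) (b : ZMod p) :
    b ^ (p / 2) = (quadraticChar (ZMod p) b : ZMod p) := by
  have := quadraticChar_eq_pow_of_char_ne_two' (F := ZMod p) (by rwa [ZMod.ringChar_zmod_n]) b
  rw [ZMod.card] at this
  exact this.symm

lemma ee_dvd (hp2 : p ≠ 2) (A B a : ZMod p) : (X - C a) ^ (ee p A B a) ∣ N0 p A B := by
  rcases ee_cases p A B a with ⟨h, e⟩ | ⟨h, e⟩ | ⟨h, e⟩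
  · rw [e, dvd_N0_iff p A B a _ le_rfl]
    apply Dvd.dvd.mul_left
    apply pow_dvd_pow_of_dvd
    rw [dvd_iff_isRoot]
    simp [lam_eval, char_pow p hp2, h]
  · rw [e, dvd_N0_iff p A B a _ one_le_two, pow_one]
    apply Dvd.dvd.mul_right
    rw [dvd_iff_isRoot, IsRoot, lam_eval]
    exact quadraticChar_eq_zero_iff.1 h
  · rw [e]; simp

lemma two_ne (hp2 : p ≠ 2) : (2 : ZMod p) ≠ 0 := by
  have : ((2 : ℕ) : ZMod p) ≠ 0 := by
    rw [Ne, ZMod.natCast_eq_zero_iff]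
    intro h
    exact hp2 ((Nat.prime_dvd_prime_iff_eq Fact.out Nat.prime_two).1 h)
  exact_mod_cast this

lemma ee_not_dvd (hp2 : p ≠ 2) (A B a : ZMod p) (hD : 4 * A ^ 3 + 27 * B ^ 2 ≠ 0)
    (hlt : ee p A B a < 2) : ¬ (X - C a) ^ (ee p A B a + 1) ∣ N0 p A B := by
  rcases ee_cases p A B a with ⟨h, e⟩ | ⟨h, e⟩ | ⟨h, e⟩
  · omega
  · rw [e, dvd_N0_iff p A B a _ le_rfl]
    intro hd
    have h0 := quadraticChar_eq_zero_iff.1 h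
    have hc : IsCoprime ((X - C a) ^ (1 + 1)) ((lam A B ^ (p / 2) + 1) ^ 2) := by
      apply IsCoprime.pow
      rw [(irreducible_X_sub_C a).coprime_iff_not_dvd, dvd_iff_isRoot]
      simp [lam_eval, char_pow p hp2, h]
    have hd2 := hc.dvd_of_dvd_mul_right hd
    obtain ⟨k, hk⟩ := hd2
    have h1 : (derivative (lam A B)).eval a = 0 := by
      rw [hk]; simp [derivative_pow]
    have h1' : 3 * a ^ 2 + A = 0 := by
      have h3 : 3 * a ^ 2 + A = (derivative (lam A B)).eval a := by
        simp only [lam, derivative_add, derivative_mul, derivative_X_pow, derivative_C,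
          derivative_X, eval_add, eval_mul, eval_pow, eval_X, eval_C, eval_zero, eval_one]
        push_cast; ring
      rw [h3, h1]
    apply hD
    linear_combination (-18 * A * a + 27 * B) * h0 + (6 * A * a ^ 2 - 9 * B * a + 4 * A ^ 2) * h1'
  · rw [e, zero_add, dvd_N0_iff p A B a _ one_le_two, pow_one, dvd_iff_isRoot]
    have hne : a ^ 3 + A * a + B ≠ 0 := by
      intro h0; rw [h0] at h; simp at h
    have : (1 + 1 : ZMod p) ≠ 0 := by rw [one_add_one_eq_two]; exact two_ne p hp2
    simp [lam_eval, char_pow p hp2, h, hne, this]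

lemma reduced (hp2 : p ≠ 2) (A B : ZMod p) (hD : 4 * A ^ 3 + 27 * B ^ 2 ≠ 0) :
    ∃ h f g : (ZMod p)[X], N0 p A B = h * f ∧ (X ^ p - X) ^ 2 = h * g ∧ IsCoprime f g ∧
      (f.natDegree : ℤ) = p + 1 + ∑ a : ZMod p, quadraticChar (ZMod p) (a ^ 3 + A * a + B) := by
  have hcop : ∀ a b : ZMod p, a ≠ b → IsCoprime (X - C a) (X - C b) := fun a b hab =>
    pairwise_coprime_X_sub_C (s := fun x : ZMod p => x) Function.injective_id hab
  have hdvd : ∏ a : ZMod p, (X - C a) ^ (ee p A B a) ∣ N0 p A B := by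
    refine Finset.prod_dvd_of_coprime (fun a _ b _ h => ?_) fun a _ => ee_dvd p hp2 A B a
    exact (hcop a b h).pow
  obtain ⟨f, hf⟩ := hdvd
  have hN : N0 p A B ≠ 0 := by
    intro h
    have := N0_natDegree p hp2 A B
    rw [h] at this; simp at this
  refine ⟨_, f, ∏ a : ZMod p, (X - C a) ^ (2 - ee p A B a), hf, ?_, ?_, ?_⟩
  · rw [← prod_X_sub_C_zmod, ← Finset.prod_pow, ← Finset.prod_mul_distrib]
    refine Finset.prod_congr rfl fun a _ => ?_
    rw [← pow_add]
    congr 1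
    rcases ee_cases p A B a with h | h | h <;> omega
  · refine IsCoprime.prod_right fun a _ => ?_
    by_cases hlt : ee p A B a < 2
    · apply IsCoprime.pow_right
      apply IsCoprime.symm
      rw [(irreducible_X_sub_C a).coprime_iff_not_dvd]
      intro hd
      apply ee_not_dvd p hp2 A B a hD hlt
      rw [hf, pow_succ]
      exact mul_dvd_mul (Finset.dvd_prod_of_mem (fun a => (X - C a) ^ ee p A B a)
        (Finset.mem_univ a)) hd
    · have : 2 - ee p A B a = 0 := by omega
      rw [this, pow_zero]; exact isCoprime_one_right
  · have h1 := N0_natDegree p hp2 A B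
    rw [hf] at hN
    rw [hf, natDegree_mul (left_ne_zero_of_mul hN) (right_ne_zero_of_mul hN),
      natDegree_prod _ _ (fun a _ => pow_ne_zero _ (X_sub_C_ne_zero a))] at h1
    simp only [natDegree_pow, natDegree_X_sub_C, mul_one] at h1
    have h2 : ((∑ a, ee p A B a : ℕ) : ℤ) =
        ∑ a : ZMod p, (1 - quadraticChar (ZMod p) (a ^ 3 + A * a + B)) := by
      push_cast
      refine Finset.sum_congr rfl fun a _ => ?_
      rcases ee_cases p A B a with h | h | h <;> rw [h.1, h.2] <;> norm_num
    have h3 : ∑ a : ZMod p, (1 : ℤ) = p := by simp [ZMod.card]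
    rw [Finset.sum_sub_distrib, h3] at h2
    have h1' : ((∑ a, ee p A B a : ℕ) : ℤ) + f.natDegree = 2 * p + 1 := by exact_mod_cast h1
    linarith

lemma card_points (hp2 : p ≠ 2) (A B : ZMod p) (hΔ : (shortWeierstrass (ZMod p) A B).Δ ≠ 0) :
    (Nat.card (shortWeierstrass (ZMod p) A B).Point : ℤ) =
      p + 1 + ∑ a : ZMod p, quadraticChar (ZMod p) (a ^ 3 + A * a + B) := by
  classical
  rw [Nat.card_congr (WeierstrassCurve.Affine.nonsingularPointEquiv _)]
  have e1 : Nat.card (WithZero {xy : ZMod p × ZMod p //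
      (shortWeierstrass (ZMod p) A B).Nonsingular xy.1 xy.2}) = Nat.card {xy : ZMod p × ZMod p //
      (shortWeierstrass (ZMod p) A B).Nonsingular xy.1 xy.2} + 1 := Finite.card_option
  rw [e1]
  have e2 : ∀ xy : ZMod p × ZMod p, (shortWeierstrass (ZMod p) A B).Nonsingular xy.1 xy.2 ↔
      xy.2 ^ 2 = xy.1 ^ 3 + A * xy.1 + B := by
    intro xy
    rw [← WeierstrassCurve.Affine.equation_iff_nonsingular_of_Δ_ne_zero hΔ, sW_equation]
  have e3 : Nat.card {xy : ZMod p × ZMod p //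
      (shortWeierstrass (ZMod p) A B).Nonsingular xy.1 xy.2} =
      ∑ a : ZMod p, ({y : ZMod p | y ^ 2 = a ^ 3 + A * a + B}.toFinset).card := by
    rw [Nat.card_congr (Equiv.subtypeEquivRight e2), Nat.card_eq_fintype_card,
      Fintype.card_subtype]
    rw [← Finset.card_sigma]
    refine Finset.card_bij (fun xy _ => ⟨xy.1, xy.2⟩) ?_ ?_ ?_
    · intro xy h; simpa using h
    · rintro ⟨a, b⟩ _ ⟨c, d⟩ _ h
      simpa using h
    · rintro ⟨a, b⟩ h
      exact ⟨(a, b), by simpa using h, rfl⟩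
  rw [e3]
  push_cast
  have e4 : ∀ a : ZMod p, (({y : ZMod p | y ^ 2 = a ^ 3 + A * a + B}.toFinset).card : ℤ) =
      quadraticChar (ZMod p) (a ^ 3 + A * a + B) + 1 := fun a => by
    have := quadraticChar_card_sqrts (F := ZMod p) (by rwa [ZMod.ringChar_zmod_n])
      (a ^ 3 + A * a + B)
    convert this
  rw [Finset.sum_congr rfl fun a _ => e4 a, Finset.sum_add_distrib]
  simp [ZMod.card]
  ring

end count

section final
variable (p : ℕ) [Fact p.Prime] [DecidableEq (RatFunc (ZMod p))]

local notation "ι" => algebraMap (ZMod p)[X] (RatFunc (ZMod p))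

lemma TW_Δ_ne (hp2 : p ≠ 2) (A B : ZMod p) (hD : 4 * A ^ 3 + 27 * B ^ 2 ≠ 0) :
    (TW A B).Δ ≠ 0 := by
  have h : (TW A B).Δ = ι (C (-16 * (4 * A ^ 3 + 27 * B ^ 2)) * lam A B ^ 6) := by
    simp only [WeierstrassCurve.Δ, WeierstrassCurve.b₂, WeierstrassCurve.b₄, WeierstrassCurve.b₆,
      WeierstrassCurve.b₈, shortWeierstrass, map_mul, map_add, map_pow, map_neg, map_ofNat]
    ring
  rw [h, Ne, map_eq_zero_iff _ (RatFunc.algebraMap_injective _)]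
  have h16 : (-16 : ZMod p) ≠ 0 := by
    have : (-16 : ZMod p) = -(2 ^ 4) := by norm_num
    rw [this]
    exact neg_ne_zero.2 (pow_ne_zero _ (two_ne p hp2))
  exact mul_ne_zero (C_ne_zero.2 (mul_ne_zero h16 hD)) (pow_ne_zero _ (lam_ne_zero A B))

lemma lam_def_iota (A B : ZMod p) :
    ι (lam A B) = ι X ^ 3 + ι (C A) * ι X + ι (C B) := by
  simp only [lam, map_add, map_mul, map_pow]

lemma P_nonsing (hp2 : p ≠ 2) (A B : ZMod p) (hD : 4 * A ^ 3 + 27 * B ^ 2 ≠ 0) :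
    (TW A B).Nonsingular (ι (lam A B) * ι X) (ι (lam A B) ^ 2) := by
  rw [← WeierstrassCurve.Affine.equation_iff_nonsingular_of_Δ_ne_zero (TW_Δ_ne p hp2 A B hD),
    sW_equation]
  simp only [map_mul, map_pow]
  linear_combination ι (lam A B) ^ 3 * lam_def_iota p A B

lemma Q_nonsing (hp2 : p ≠ 2) (A B : ZMod p) (hD : 4 * A ^ 3 + 27 * B ^ 2 ≠ 0) :
    (TW A B).Nonsingular (ι (lam A B) * ι X ^ p) (ι (lam A B) ^ (p / 2 + 2)) := by
  rw [← WeierstrassCurve.Affine.equation_iff_nonsingular_of_Δ_ne_zero (TW_Δ_ne p hp2 A B hD),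
    sW_equation]
  have hodd : p % 2 = 1 := ((Fact.out : p.Prime).eq_two_or_odd).resolve_left hp2
  have h1 : (ι (lam A B) ^ (p / 2 + 2)) ^ 2 = ι (lam A B) ^ 3 * ι (lam A B) ^ p := by
    rw [← pow_mul, ← pow_add]; congr 1; omega
  have h2 := congrArg ι (lam_pow_p p A B)
  simp only [map_mul, map_pow, map_add] at h2
  rw [h1, h2]
  simp only [map_mul, map_pow]
  ring

lemma Q_frac (A B : ZMod p) 
    (h : (TW A B).Nonsingular (ι (lam A B) * ι X ^ p) (ι (lam A B) ^ (p / 2 + 2))) :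
    XFrac A B (.some _ _ h) (X ^ p) 1 := by
  refine ⟨isCoprime_one_right, 1, one_ne_zero, ?_, ?_⟩ <;> simp

lemma frob_ne : ι X ^ p - ι X ≠ 0 := by
  have : ι X ^ p - ι X = ι (X ^ p - X) := by simp
  rw [this, Ne, map_eq_zero_iff _ (RatFunc.algebraMap_injective _)]
  exact FiniteField.X_pow_card_sub_X_ne_zero _ (Fact.out : p.Prime).one_lt

lemma QP_frac (A B : ZMod p)
    (hQ : (TW A B).Nonsingular (ι (lam A B) * ι X ^ p) (ι (lam A B) ^ (p / 2 + 2)))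
    (hP : (TW A B).Nonsingular (ι (lam A B) * ι X) (ι (lam A B) ^ 2))
    (h f g : (ZMod p)[X]) (hf : N0 p A B = h * f) (hg : (X ^ p - X) ^ 2 = h * g)
    (hc : IsCoprime f g) : XFrac A B (.some _ _ hQ - .some _ _ hP) f g := by
  have hl := iota_lam_ne A B
  have hfr := frob_ne p
  have hx : ι (lam A B) * ι X ^ p ≠ ι (lam A B) * ι X := by
    intro e
    apply hfr
    rw [sub_eq_zero]
    exact mul_left_cancel₀ hl e
  have hg' := congrArg ι hg
  simp only [map_mul, map_pow, map_sub] at hg'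
  have hf' := congrArg ι hf
  simp only [N0, map_mul, map_pow, map_sub, map_add, map_one] at hf'
  have hgh : ι h * ι g ≠ 0 := by rw [← hg']; exact pow_ne_zero _ hfr
  have hh0 := left_ne_zero_of_mul hgh
  refine ⟨hc, ι g, right_ne_zero_of_mul hgh, ?_, ?_⟩
  · rw [sub_eq_add_neg, WeierstrassCurve.Affine.Point.neg_some,
      WeierstrassCurve.Affine.Point.add_of_X_ne hx]
    simp only [WeierstrassCurve.Affine.Point.xRep_some, sW_addX, sW_negY,
        WeierstrassCurve.Affine.slope_of_X_ne hx, sub_neg_eq_add, Matrix.cons_val_zero]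
    have e1 : (ι (lam A B) ^ (p / 2 + 2) + ι (lam A B) ^ 2) /
        (ι (lam A B) * ι X ^ p - ι (lam A B) * ι X) =
        ι (lam A B) * (ι (lam A B) ^ (p / 2) + 1) / (ι X ^ p - ι X) := by
      rw [← mul_sub, pow_add]
      field_simp
    rw [e1, div_pow]
    apply mul_left_cancel₀ hh0
    have e2 : ι h * (ι g * ((ι (lam A B) * (ι (lam A B) ^ (p / 2) + 1)) ^ 2 / (ι X ^ p - ι X) ^ 2 -
        ι (lam A B) * ι X ^ p - ι (lam A B) * ι X)) = (ι X ^ p - ι X) ^ 2 * 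
        ((ι (lam A B) * (ι (lam A B) ^ (p / 2) + 1)) ^ 2 / (ι X ^ p - ι X) ^ 2 -
        ι (lam A B) * ι X ^ p - ι (lam A B) * ι X) := by rw [hg']; ring
    rw [e2, mul_left_comm, ← hf']
    field_simp
    ring
  · rw [sub_eq_add_neg, WeierstrassCurve.Affine.Point.neg_some,
      WeierstrassCurve.Affine.Point.add_of_X_ne hx]
    simp

end final

/-- Hasse's theorem: for an elliptic curve `E : y² = x³ + Ax + B` over `𝔽_p`,
`|#E(𝔽_p) - p - 1| ≤ 2√p`. -/
theorem stmt_1 (p : ℕ) [Fact p.Prime] (A B : ZMod p)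
    (hΔ : (shortWeierstrass (ZMod p) A B).Δ ≠ 0) :
    |(Nat.card (shortWeierstrass (ZMod p) A B).Point : ℝ) - p - 1| ≤ 2 * Real.sqrt p := by
  classical
  have hΔ' : (shortWeierstrass (ZMod p) A B).Δ = -2 ^ 4 * (4 * A ^ 3 + 27 * B ^ 2) := by
    simp only [WeierstrassCurve.Δ, WeierstrassCurve.b₂, WeierstrassCurve.b₄, WeierstrassCurve.b₆,
      WeierstrassCurve.b₈, shortWeierstrass]
    ring
  have hp2 : p ≠ 2 := by
    rintro rfl
    apply hΔ
    rw [hΔ']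
    have : (2 : ZMod 2) = 0 := CharTwo.two_eq_zero
    rw [this]; simp
  have hD : 4 * A ^ 3 + 27 * B ^ 2 ≠ 0 := by
    intro h; apply hΔ; rw [hΔ', h, mul_zero]
  have hQ := Q_nonsing p hp2 A B hD
  have hP := P_nonsing p hp2 A B hD
  obtain ⟨h, f, g, hf, hg, hc, hdeg⟩ := reduced p hp2 A B hD
  have hfrac := QP_frac p A B hQ hP h f g hf hg hc
  have hp1 : 0 < p := (Fact.out : p.Prime).pos
  obtain ⟨d, d0, d1, d2, d3⟩ := rep_seq A B (two_ne p hp2) hD _ _ rfl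
    (pow_ne_zero 2 (iota_lam_ne A B)) hP _ _ _ (Q_frac p A B hQ)
    (by rw [degree_one, degree_X_pow]; exact_mod_cast hp1)
  rw [natDegree_X_pow] at d2
  have key := hasse_arith p Fact.out hp2 d d0 d1 d2
  rw [d3 f g hfrac, hdeg, ← card_points p hp2 A B hΔ] at key
  have key' : ((Nat.card (shortWeierstrass (ZMod p) A B).Point : ℝ) - p - 1) ^ 2 ≤ 4 * p := by
    exact_mod_cast key
  apply abs_le_of_sq_le_sq _ (by positivity)
  rw [mul_pow, Real.sq_sqrt (Nat.cast_nonneg p)]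
  linarith
end

section
/- (Pólya–Vinogradov inequality) There exists a constant C > 0 such that for every positive integer d, every non-principal Dirichlet character χ modulo d, and all positive integers n ≤ m, one has |∑_{k=n}^{m} χ(k)| ≤ C · √d · log d. -/
open ZMod in
theorem pv_gauss_norm {q : ℕ} [NeZero q] (χ : DirichletCharacter ℂ q) (hχ : χ.IsPrimitive) :
    ‖gaussSum χ (stdAddChar (N := q))‖ = Real.sqrt q := by
  have hχ' : (χ⁻¹).IsPrimitive := by
    rw [DirichletCharacter.isPrimitive_def, DirichletCharacter.conductor_inv]; exact hχ
  have hneg : ∀ ψ : DirichletCharacter ℂ q, ‖ψ (-1)‖ = 1 := by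
    intro ψ
    have := ψ.unit_norm_eq_one (-1)
    simpa using this
  have h1 : gaussSum χ⁻¹ (stdAddChar (N := q))⁻¹ = χ⁻¹ (-1) * gaussSum χ⁻¹ stdAddChar := by
    have := gaussSum_mulShift χ⁻¹ (stdAddChar (N := q)) (-1)
    have h2 : (stdAddChar (N := q)).mulShift ((-1 : (ZMod q)ˣ) : ZMod q) = (stdAddChar (N := q))⁻¹ := by
      ext x; simp [AddChar.mulShift_apply]
    rw [h2] at this
    rw [← this, ← mul_assoc, ← map_mul]
    norm_num
  have h3 : ‖gaussSum χ⁻¹ (stdAddChar (N := q))‖ = ‖gaussSum χ (stdAddChar (N := q))‖ := by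
    have := congrArg norm (star_gaussSum_eq χ (stdAddChar (N := q)))
    rw [h1, norm_star, norm_mul, hneg, one_mul] at this
    exact this.symm
  have h4 := congrFun (dft_dft (χ : ZMod q → ℂ)) (-1)
  have h5 : (ZMod.dft (χ : ZMod q → ℂ)) = fun k => χ⁻¹ (-k) * gaussSum χ stdAddChar := by
    ext k; exact hχ.fourierTransform_eq_inv_mul_gaussSum k
  rw [h5, dft_mul_const, dft_comp_neg (fun k => χ⁻¹ k)] at h4
  simp only [neg_neg] at h4
  rw [hχ'.fourierTransform_eq_inv_mul_gaussSum] at h4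
  have h6 := congrArg norm h4
  rw [norm_mul, norm_mul, hneg, h3] at h6
  simp at h6
  rw [← h6, Real.sqrt_mul_self (norm_nonneg _)]

theorem pv_sin {t : ℝ} (h0 : 0 < t) (h1 : t < 1) :
    1 / Real.sin (Real.pi * t) ≤ 1 / (2 * t) + 1 / (2 * (1 - t)) := by
  have hpi := Real.pi_pos
  have key : ∀ s : ℝ, 0 < s → s ≤ 1/2 → 1 / Real.sin (Real.pi * s) ≤ 1 / (2 * s) := by
    intro s hs hs'
    apply one_div_le_one_div_of_le (by positivity)
    have := Real.mul_le_sin (x := Real.pi * s) (by positivity) (by nlinarith)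
    calc 2 * s = 2 / Real.pi * (Real.pi * s) := by field_simp
      _ ≤ _ := this
  rcases le_total t (1/2) with h | h
  · have := key t h0 h
    have h2 : 0 ≤ 1 / (2 * (1 - t)) := by
      apply one_div_nonneg.2; linarith
    linarith
  · have := key (1 - t) (by linarith) (by linarith)
    rw [show Real.pi * (1 - t) = Real.pi - Real.pi * t by ring, Real.sin_pi_sub] at this
    have h2 : 0 ≤ 1 / (2 * t) := by positivity
    linarith

open ZMod in
theorem pv_geom {q : ℕ} [NeZero q] (a : ℕ) (h0 : 0 < a) (h1 : a < q) (N : ℕ) :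
    ‖∑ k ∈ Finset.Ioc 0 N, stdAddChar ((a : ZMod q) * (k : ZMod q))‖ ≤
      (q : ℝ) / 2 * (1 / (a : ℝ) + 1 / ((q : ℝ) - a)) := by
  have hq : (0:ℝ) < q := by exact_mod_cast (h0.trans h1)
  have ha : (0:ℝ) < a := by exact_mod_cast h0
  have haq : (a:ℝ) < q := by exact_mod_cast h1
  set z : ℂ := stdAddChar (a : ZMod q) with hz
  have hz1 : ‖z‖ = 1 := by rw [hz, stdAddChar_apply]; exact Circle.norm_coe _
  have hze : z = Complex.exp (Complex.I * ((2 * Real.pi * (a / q) : ℝ) : ℂ)) := by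
    have := stdAddChar_coe (N := q) (a : ℤ)
    rw [hz]
    push_cast at this ⊢
    rw [this]; congr 1; ring
  have hsin : 0 < Real.sin (Real.pi * (a / q)) := by
    apply Real.sin_pos_of_pos_of_lt_pi
    · have := Real.pi_pos; positivity
    · have : (a:ℝ) / q < 1 := by rw [div_lt_one hq]; exact haq
      nlinarith [Real.pi_pos]
  have hn : ‖z - 1‖ = 2 * Real.sin (Real.pi * (a / q)) := by
    rw [hze, Complex.norm_exp_I_mul_ofReal_sub_one]
    rw [show 2 * Real.pi * ((a:ℝ) / q) / 2 = Real.pi * (a / q) by ring]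
    rw [Real.norm_of_nonneg (by positivity)]
  have hz' : z ≠ 1 := by
    intro h
    rw [h] at hn; simp at hn; linarith
  have hsum : ∑ k ∈ Finset.Ioc 0 N, stdAddChar ((a : ZMod q) * (k : ZMod q)) =
      z * ((z ^ N - 1) / (z - 1)) := by
    rw [← geom_sum_eq hz', Finset.mul_sum, Finset.range_eq_Ico]
    rw [show Finset.Ioc 0 N = Finset.Ico (0+1) (N+1) by ext; simp; omega]
    rw [← Finset.sum_Ico_add']
    apply Finset.sum_congr rfl
    intro k _
    rw [← pow_succ', hz, ← AddChar.map_nsmul_eq_pow]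
    congr 1; simp [mul_comm]
  rw [hsum, norm_mul, norm_div, hz1, hn, one_mul]
  have h2 : ‖z ^ N - 1‖ ≤ 2 := by
    refine (norm_sub_le _ _).trans ?_
    simp [hz1]; norm_num
  calc ‖z ^ N - 1‖ / (2 * Real.sin (Real.pi * (a / q)))
      ≤ 2 / (2 * Real.sin (Real.pi * (a / q))) := by gcongr
    _ = 1 / Real.sin (Real.pi * (a / q)) := by field_simp
    _ ≤ _ := pv_sin (by positivity) (by rw [div_lt_one hq]; exact haq)
    _ = _ := by
      have : (q:ℝ) - a ≠ 0 := by linarith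
      field_simp

theorem pv_harm (q : ℕ) (hq : 0 < q) :
    ∑ a ∈ Finset.Ico 1 q, ((q : ℝ) / 2 * (1 / (a : ℝ) + 1 / ((q : ℝ) - a))) ≤
      q * (1 + Real.log q) := by
  have h1 : ∑ a ∈ Finset.Ico 1 q, 1 / (a : ℝ) ≤ 1 + Real.log q := by
    have := harmonic_le_one_add_log q
    rw [harmonic_eq_sum_Icc] at this
    push_cast at this
    refine le_trans ?_ this
    simp only [one_div]
    apply Finset.sum_le_sum_of_subset_of_nonneg
    · intro x; simp; omega
    · intros; positivity
  have h2 : ∑ a ∈ Finset.Ico 1 q, 1 / ((q:ℝ) - a) = ∑ a ∈ Finset.Ico 1 q, 1 / (a : ℝ) := by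
    apply Finset.sum_nbij' (fun a => q - a) (fun a => q - a)
    · intro a ha; simp at *; omega
    · intro a ha; simp at *; omega
    · intro a ha; simp at *; omega
    · intro a ha; simp at *; omega
    · intro a ha
      simp at ha
      rw [Nat.cast_sub ha.2.le]
  rw [← Finset.mul_sum, Finset.sum_add_distrib, h2]
  have : (0:ℝ) < q := by exact_mod_cast hq
  nlinarith

open ZMod in
theorem pv_prim {q : ℕ} [NeZero q] (χ : DirichletCharacter ℂ q) (hχ : χ.IsPrimitive)
    (hq : 2 ≤ q) (N : ℕ) :
    ‖∑ k ∈ Finset.Ioc 0 N, χ (k : ZMod q)‖ ≤ 3 * Real.sqrt q * Real.log q := by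
  have hq0 : (0:ℝ) < q := by exact_mod_cast (by omega : 0 < q)
  set τ := gaussSum χ (stdAddChar (N := q)) with hτ
  have h5 : (ZMod.dft (χ : ZMod q → ℂ)) = fun k => χ⁻¹ (-k) * τ := by
    ext k; exact hχ.fourierTransform_eq_inv_mul_gaussSum k
  have hinv : ∀ k : ZMod q, χ k = (q : ℂ)⁻¹ * ∑ a : ZMod q, stdAddChar (a * k) * (χ⁻¹ (-a) * τ) := by
    intro k
    have := invDFT_apply (ZMod.dft (χ : ZMod q → ℂ)) k
    rw [LinearEquiv.symm_apply_apply, h5] at this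
    simpa using this
  have hS : ∑ k ∈ Finset.Ioc 0 N, χ (k : ZMod q) = (q : ℂ)⁻¹ * ∑ a : ZMod q,
      (χ⁻¹ (-a) * τ) * ∑ k ∈ Finset.Ioc 0 N, stdAddChar (a * (k : ZMod q)) := by
    rw [Finset.sum_congr rfl (fun (k : ℕ) _ => hinv (k : ZMod q)), ← Finset.mul_sum, Finset.sum_comm]
    congr 1
    apply Finset.sum_congr rfl
    intro a _
    rw [Finset.mul_sum]
    apply Finset.sum_congr rfl
    intros; ring
  have hS2 : ∑ a : ZMod q,
      (χ⁻¹ (-a) * τ) * ∑ k ∈ Finset.Ioc 0 N, stdAddChar (a * (k : ZMod q)) =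
      ∑ a ∈ Finset.range q, (χ⁻¹ (-(a : ZMod q)) * τ) *
        ∑ k ∈ Finset.Ioc 0 N, stdAddChar ((a : ZMod q) * (k : ZMod q)) := by
    symm
    apply Finset.sum_nbij' (fun a : ℕ => (a : ZMod q)) (fun a : ZMod q => a.val)
    · simp
    · intro a _; simpa using ZMod.val_lt a
    · intro a ha; exact ZMod.val_cast_of_lt (by simpa using ha)
    · intro a _; simp
    · intros; rfl
  have hbound : ‖∑ a ∈ Finset.range q, (χ⁻¹ (-(a : ZMod q)) * τ) *
        ∑ k ∈ Finset.Ioc 0 N, stdAddChar ((a : ZMod q) * (k : ZMod q))‖ ≤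
        Real.sqrt q * (q * (1 + Real.log q)) := by
    rw [Finset.range_eq_Ico, Finset.sum_eq_sum_Ico_succ_bot (by omega)]
    have hz : χ⁻¹ (-((0:ℕ) : ZMod q)) = 0 := by
      simp only [Nat.cast_zero, neg_zero]
      exact DirichletCharacter.map_zero' _ (by omega)
    rw [hz, zero_mul, zero_mul, zero_add]
    refine (norm_sum_le _ _).trans ?_
    refine le_trans ?_ (mul_le_mul_of_nonneg_left (pv_harm q (by omega)) (Real.sqrt_nonneg _))
    rw [Finset.mul_sum]
    apply Finset.sum_le_sum
    intro a ha
    simp at ha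
    rw [norm_mul, norm_mul, hτ, pv_gauss_norm χ hχ]
    have h1 := (χ⁻¹).norm_le_one (-(a : ZMod q))
    have h2 := pv_geom (q := q) a (by omega) ha.2 N
    apply mul_le_mul _ h2 (norm_nonneg _) (Real.sqrt_nonneg _)
    nlinarith [Real.sqrt_nonneg (q:ℝ)]
  rw [hS, hS2, norm_mul]
  have hl : 1 + Real.log q ≤ 3 * Real.log q := by
    have : Real.log 2 ≤ Real.log q := Real.log_le_log (by norm_num) (by exact_mod_cast hq)
    linarith [Real.log_two_gt_d9]
  calc ‖(q:ℂ)⁻¹‖ * _ ≤ ‖(q:ℂ)⁻¹‖ * (Real.sqrt q * (q * (1 + Real.log q))) := by gcongr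
    _ = Real.sqrt q * (1 + Real.log q) := by simp; field_simp
    _ ≤ Real.sqrt q * (3 * Real.log q) := by gcongr
    _ = _ := by ring

theorem pv_divisors (r : ℕ) : (r.divisors.card : ℝ) ≤ 2 * Real.sqrt r := by
  have h : r.divisors ⊆ (Finset.Icc 1 r.sqrt) ∪ (Finset.Icc 1 r.sqrt).image (fun a => r / a) := by
    intro a ha
    rw [Nat.mem_divisors] at ha
    obtain ⟨⟨b, hb⟩, hr⟩ := ha
    have ha0 : 0 < a := Nat.pos_of_ne_zero (by rintro rfl; simp at hb; exact hr hb)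
    have hb0 : 0 < b := Nat.pos_of_ne_zero (by rintro rfl; simp at hb; exact hr hb)
    rw [Finset.mem_union, Finset.mem_image]
    by_cases hle : a ≤ r.sqrt
    · left; simp; omega
    · right
      refine ⟨b, ?_, ?_⟩
      · have : b ≤ r.sqrt := by
          by_contra hlt
          have h1 := Nat.lt_succ_sqrt r
          have : (r.sqrt + 1) * (r.sqrt + 1) ≤ a * b := Nat.mul_le_mul (by omega) (by omega)
          simp only [Nat.succ_eq_add_one] at h1
          omega
        simp; omega
      · simp [hb, hb0]
  have h1 := (Finset.card_le_card h).trans (Finset.card_union_le _ _)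
  have h2 := Finset.card_image_le (s := Finset.Icc 1 r.sqrt) (f := fun a => r / a)
  simp only [Nat.card_Icc, Nat.add_sub_cancel] at h1 h2
  have h3 : r.divisors.card ≤ 2 * r.sqrt := by omega
  have h4 : (r.sqrt : ℝ) ≤ Real.sqrt r := Real.nat_sqrt_le_real_sqrt
  have h5 : (r.divisors.card : ℝ) ≤ 2 * r.sqrt := by exact_mod_cast h3
  linarith

open ArithmeticFunction in
theorem pv_moebius (g : ℕ) (hg : g ≠ 0) :
    ∑ δ ∈ g.divisors, (moebius δ : ℂ) = if g = 1 then 1 else 0 := by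
  have h := congrArg (fun f => f g) moebius_mul_coe_zeta
  simp only [coe_mul_zeta_apply, one_apply] at h
  have := congrArg (Int.cast : ℤ → ℂ) h
  push_cast at this
  exact this

theorem pv_all {d : ℕ} (hd : 0 < d) (χ : DirichletCharacter ℂ d) (hχ : χ ≠ 1) (N : ℕ) :
    ‖∑ k ∈ Finset.Ioc 0 N, χ (k : ZMod d)‖ ≤ 6 * Real.sqrt d * Real.log d := by
  haveI : NeZero d := ⟨hd.ne'⟩
  obtain ⟨r, hr⟩ := χ.conductor_dvd_level
  have hq0 := χ.conductor_ne_zero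
  have hq1 : χ.conductor ≠ 1 := fun h => hχ (χ.eq_one_iff_conductor_eq_one.2 h)
  have hprim := χ.primitiveCharacter_isPrimitive
  have happ : ∀ k : ℕ, k.Coprime d → χ (k : ZMod d) = χ.primitiveCharacter (k : ZMod χ.conductor) := by
    intro k hk
    have := χ.primitiveCharacter_apply_of_isCoprime (a := (k : ℤ)) (Nat.isCoprime_iff_coprime.2 hk)
    simpa using this.symm
  generalize χ.primitiveCharacter = ψ at *
  generalize χ.conductor = q at *
  haveI : NeZero q := ⟨hq0⟩
  have hr0 : r ≠ 0 := by rintro rfl; simp at hr; omega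
  have hnz : ∀ (e : ℕ) (φ : DirichletCharacter ℂ e) (k : ℕ), ¬ k.Coprime e → φ (k : ZMod e) = 0 := by
    intro e φ k hk
    apply MulChar.map_nonunit
    rwa [ZMod.isUnit_iff_coprime]
  have hterm : ∀ k ∈ Finset.Ioc 0 N, χ (k : ZMod d) =
      ∑ δ ∈ r.divisors, if δ ∣ k then (ArithmeticFunction.moebius δ : ℂ) * ψ (k : ZMod q) else 0 := by
    intro k hk
    simp at hk
    have h1 : ∑ δ ∈ r.divisors, (if δ ∣ k then (ArithmeticFunction.moebius δ : ℂ) * ψ (k : ZMod q) else 0)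
        = (if k.gcd r = 1 then 1 else 0) * ψ (k : ZMod q) := by
      rw [← pv_moebius _ (Nat.gcd_ne_zero_right hr0), ← Finset.sum_filter, Finset.sum_mul]
      apply Finset.sum_congr _ (fun _ _ => rfl)
      ext δ
      simp [Nat.dvd_gcd_iff, hr0]
      tauto
    rw [h1]
    by_cases hc : k.Coprime d
    · rw [happ k hc, if_pos, one_mul]
      rw [hr] at hc
      exact Nat.Coprime.coprime_mul_left_right hc
    · rw [hnz d χ k hc]
      by_cases h2 : k.gcd r = 1
      · rw [hnz q ψ k, mul_zero]
        intro h3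
        exact hc (hr ▸ Nat.Coprime.mul_right h3 h2)
      · rw [if_neg h2, zero_mul]
  rw [Finset.sum_congr rfl hterm, Finset.sum_comm]
  have hin : ∀ δ ∈ r.divisors, ‖∑ k ∈ Finset.Ioc 0 N,
      (if δ ∣ k then (ArithmeticFunction.moebius δ : ℂ) * ψ (k : ZMod q) else 0)‖ ≤
      3 * Real.sqrt q * Real.log q := by
    intro δ hδ
    have hδ0 : 0 < δ := Nat.pos_of_mem_divisors hδ
    have : ∑ k ∈ Finset.Ioc 0 N,
      (if δ ∣ k then (ArithmeticFunction.moebius δ : ℂ) * ψ (k : ZMod q) else 0) =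
      (ArithmeticFunction.moebius δ : ℂ) * ψ (δ : ZMod q) *
        ∑ j ∈ Finset.Ioc 0 (N / δ), ψ (j : ZMod q) := by
      rw [← Finset.sum_filter, Finset.mul_sum]
      apply Finset.sum_nbij' (fun k => k / δ) (fun j => δ * j)
      · intro k hk
        simp at hk ⊢
        exact ⟨⟨hδ0, Nat.le_of_dvd hk.1.1 hk.2⟩, Nat.div_le_div_right hk.1.2⟩
      · intro j hj
        simp at hj ⊢
        refine ⟨⟨hδ0, hj.1⟩, ?_⟩
        rw [mul_comm]; exact (Nat.le_div_iff_mul_le hδ0).1 hj.2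
      · intro k hk
        simp at hk ⊢
        exact Nat.mul_div_cancel' hk.2
      · intro j hj
        simp [hδ0]
      · intro k hk
        simp at hk
        rw [mul_assoc, ← map_mul, ← Nat.cast_mul, Nat.mul_div_cancel' hk.2]
    rw [this, norm_mul, norm_mul]
    have h1 : ‖(ArithmeticFunction.moebius δ : ℂ)‖ ≤ 1 := by
      rw [Complex.norm_intCast]
      exact_mod_cast ArithmeticFunction.abs_moebius_le_one
    have h2 := ψ.norm_le_one (δ : ZMod q)
    have h3 := pv_prim ψ hprim (by omega) (N / δ)
    have h4 := mul_le_one₀ h1 (norm_nonneg _) h2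
    exact (mul_le_of_le_one_left (norm_nonneg _) h4).trans h3
  refine (norm_sum_le _ _).trans ((Finset.sum_le_sum hin).trans ?_)
  rw [Finset.sum_const, nsmul_eq_mul]
  have hqd : Real.log q ≤ Real.log d := by
    apply Real.log_le_log (by exact_mod_cast Nat.pos_of_ne_zero hq0)
    exact_mod_cast Nat.le_of_dvd hd ⟨r, hr⟩
  have hq' : 0 ≤ Real.log q := Real.log_natCast_nonneg q
  have hs : Real.sqrt d = Real.sqrt q * Real.sqrt r := by
    rw [← Real.sqrt_mul (by positivity)]; congr 1; exact_mod_cast hr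
  calc (r.divisors.card : ℝ) * (3 * Real.sqrt q * Real.log q)
      ≤ (2 * Real.sqrt r) * (3 * Real.sqrt q * Real.log d) := by
        gcongr
        exact pv_divisors r
    _ = _ := by rw [hs]; ring

/-- Pólya–Vinogradov inequality: there is a constant `C > 0` such that for every positive
integer `d`, every non-principal Dirichlet character `χ` mod `d`, and all positive integers
`n ≤ m`, `|∑_{k=n}^{m} χ(k)| ≤ C √d log d`. -/
theorem stmt_4 :
    ∃ C : ℝ, 0 < C ∧ ∀ d : ℕ, 0 < d → ∀ χ : DirichletCharacter ℂ d, χ ≠ 1 →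
      ∀ n m : ℕ, 0 < n → n ≤ m →
        ‖∑ k ∈ Finset.Icc n m, χ (k : ZMod d)‖ ≤ C * Real.sqrt d * Real.log d := by
  refine ⟨12, by norm_num, ?_⟩
  intro d hd χ hχ n m hn hnm
  have h : ∑ k ∈ Finset.Icc n m, χ (k : ZMod d) =
      ∑ k ∈ Finset.Ioc 0 m, χ (k : ZMod d) - ∑ k ∈ Finset.Ioc 0 (n - 1), χ (k : ZMod d) := by
    rw [eq_sub_iff_add_eq, ← Finset.sum_union]
    · congr 1
      ext x; simp; omega
    · rw [Finset.disjoint_left]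
      intro x; simp; omega
  rw [h]
  refine (norm_sub_le _ _).trans ?_
  have h1 := pv_all hd χ hχ m
  have h2 := pv_all hd χ hχ (n - 1)
  linarith
end

section
/- (Explicit Pólya–Vinogradov, even case) Let d ≥ 3 be a positive integer and let χ be an even primitive Dirichlet character modulo d (i.e., χ(−1) = 1). Then for all positive integers n ≤ m, |∑_{k=n}^{m} χ(k)| ≤ d^{1/2} · ( (2/π²) ln d + (4/π²) ln ln d + 3/2 ). -/
open Real

theorem abs_sin_coeff (f : C(AddCircle π, ℂ)) (hf : ∀ x : ℝ, f (x : AddCircle π) = (|Real.sin x| : ℝ)) [Fact (0 < π)] (n : ℤ) :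
    fourierCoeff f n = 2 / π * (1 / (1 - 4 * (n:ℂ)^2)) := by
  have hn : (1 - 4 * (n:ℂ)^2) ≠ 0 := by
    intro h
    have : (1 - 4 * n^2 : ℤ) = 0 := by exact_mod_cast h
    omega
  rw [fourierCoeff_eq_intervalIntegral f n 0]
  have key : ∀ x : ℝ, HasDerivAt (fun x : ℝ => Complex.exp (-2 * Complex.I * n * x) * (-2 * Complex.I * n * Complex.sin x - Complex.cos x) / (1 - 4 * (n:ℂ)^2)) (Complex.exp (-2 * Complex.I * n * x) * Complex.sin x) x := by
    intro x
    have h1 : HasDerivAt (fun z : ℂ => Complex.exp (-2 * Complex.I * n * z) * (-2 * Complex.I * n * Complex.sin z - Complex.cos z) / (1 - 4 * (n:ℂ)^2)) (Complex.exp (-2 * Complex.I * n * x) * Complex.sin x) (x:ℂ) := by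
      have := ((((hasDerivAt_id (x:ℂ)).const_mul (-2 * Complex.I * n)).cexp).mul
        (((Complex.hasDerivAt_sin (x:ℂ)).const_mul (-2 * Complex.I * n)).sub (Complex.hasDerivAt_cos (x:ℂ)))).div_const (1 - 4 * (n:ℂ)^2)
      convert! this using 1
      rw [eq_div_iff hn]
      simp only [id, Pi.sub_apply]
      linear_combination (-4 * (n:ℂ)^2 * Complex.exp (-2 * Complex.I * n * x) * Complex.sin x) * Complex.I_sq
    exact h1.comp_ofReal
  have hint : ∫ x in (0:ℝ)..(0+π), (fourier (-n)) (x : AddCircle π) • f x = ∫ x in (0:ℝ)..(0+π), Complex.exp (-2 * Complex.I * n * x) * Complex.sin x := by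
    apply intervalIntegral.integral_congr
    intro x hx
    rw [zero_add, Set.uIcc_of_le pi_pos.le] at hx
    simp only [hf, fourier_coe_apply, smul_eq_mul]
    rw [abs_of_nonneg (Real.sin_nonneg_of_nonneg_of_le_pi hx.1 hx.2)]
    rw [Complex.ofReal_sin]
    congr 2
    have : (π:ℂ) ≠ 0 := by exact_mod_cast pi_ne_zero
    field_simp
    push_cast; ring
  rw [hint, intervalIntegral.integral_eq_sub_of_hasDerivAt (fun x _ => key x) (Continuous.intervalIntegrable (by fun_prop) _ _)]
  have e : Complex.exp (-2 * Complex.I * n * (π:ℂ)) = 1 := by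
    rw [Complex.exp_eq_one_iff]; exact ⟨-n, by push_cast; ring⟩
  simp only [zero_add, e]
  simp
  field_simp
  ring

theorem abs_sin_hasSum (x : ℝ) :
    HasSum (fun m : ℕ => Real.cos (2 * (m+1) * x) * (1 / (4 * (m+1:ℝ)^2 - 1))) (1/2 - π/4 * |Real.sin x|) := by
  have : Fact (0 < π) := ⟨pi_pos⟩
  have hper : Function.Periodic (fun x : ℝ => ((|Real.sin x| : ℝ) : ℂ)) π := by
    intro x; simp [Real.sin_add_pi]
  let f : C(AddCircle π, ℂ) := ⟨hper.lift, by
    refine continuous_quot_lift _ ?_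
    fun_prop⟩
  have hf : ∀ x : ℝ, f (x : AddCircle π) = (|Real.sin x| : ℝ) := fun x => rfl
  have hc := abs_sin_coeff f hf
  have hs : Summable (fourierCoeff f) := by
    have : fourierCoeff f = fun n : ℤ => 2 / π * (1 / (1 - 4 * (n:ℂ)^2)) := funext hc
    rw [this]
    apply Summable.mul_left
    have h2 : Summable (fun n : ℤ => 1 / (n:ℝ)^2) := Real.summable_one_div_int_pow.2 (by norm_num)
    apply Summable.of_norm_bounded_eventually h2
    have : ∀ᶠ n : ℤ in Filter.cofinite, n ≠ 0 := by
      rw [Filter.eventually_cofinite]; simp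
    filter_upwards [this] with n hn
    have e : (1 - 4 * (n:ℂ)^2) = ((1 - 4 * (n:ℝ)^2 : ℝ) : ℂ) := by push_cast; ring
    rw [e, norm_div, norm_one, Complex.norm_real, Real.norm_eq_abs]
    have h1 : (1:ℝ) ≤ (n:ℝ)^2 := by
      have : 1 ≤ n^2 := by have := sq_nonneg n; have : n^2 ≠ 0 := pow_ne_zero _ hn; omega
      exact_mod_cast this
    apply one_div_le_one_div_of_le (by linarith)
    rw [abs_of_neg (by linarith)]; linarith
  have h := has_pointwise_sum_fourier_series_of_summable hs (x : AddCircle π)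
  rw [hf] at h
  have h' := Complex.hasSum_re (h.nat_add_neg)
  have h3 := (hasSum_nat_add_iff' 1).2 h'
  have h4 := h3.mul_left (-(π/4))
  convert! h4 using 1
  · ext m
    simp only [hc, fourier_coe_apply, smul_eq_mul]
    have hm : (4 * (m+1:ℝ)^2 - 1) ≠ 0 := by nlinarith [(Nat.cast_nonneg m : (0:ℝ) ≤ m)]
    have e1 : (2 / (π:ℂ) * (1 / (1 - 4 * (((m+1:ℕ):ℤ):ℂ)^2))) = ((-(2/π) * (1 / (4 * (m+1:ℝ)^2 - 1)) : ℝ) : ℂ) := by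
      have : (1 - 4 * (((m+1:ℕ):ℤ):ℂ)^2) = ((-(4 * (m+1:ℝ)^2 - 1) : ℝ) : ℂ) := by push_cast; ring
      rw [this]
      rw [show (-(2/π) * (1 / (4 * (m+1:ℝ)^2 - 1))) = 2/π * (1 / (-(4 * (m+1:ℝ)^2 - 1))) by rw [one_div_neg_eq_neg_one_div]; ring]
      push_cast; rfl
    have e2 : (2 / (π:ℂ) * (1 / (1 - 4 * ((-((m+1:ℕ):ℤ):ℤ):ℂ)^2))) = ((-(2/π) * (1 / (4 * (m+1:ℝ)^2 - 1)) : ℝ) : ℂ) := by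
      rw [← e1]; push_cast; ring
    rw [e1, e2]
    have g1 : 2 * (π:ℂ) * Complex.I * (((m+1:ℕ):ℤ):ℂ) * x / π = ((2 * (m+1) * x : ℝ) : ℂ) * Complex.I := by
      have : (π:ℂ) ≠ 0 := by exact_mod_cast pi_ne_zero
      field_simp; push_cast; ring
    have g2 : 2 * (π:ℂ) * Complex.I * ((-((m+1:ℕ):ℤ):ℤ):ℂ) * x / π = ((-(2 * (m+1) * x) : ℝ) : ℂ) * Complex.I := by
      have : (π:ℂ) ≠ 0 := by exact_mod_cast pi_ne_zero
      field_simp; push_cast; ring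
    rw [g1, g2, Complex.add_re, Complex.re_ofReal_mul, Complex.re_ofReal_mul, Complex.exp_ofReal_mul_I_re, Complex.exp_ofReal_mul_I_re, Real.cos_neg]
    have := pi_ne_zero
    field_simp; ring
  · simp only [Finset.sum_range_one, hc, fourier_coe_apply, smul_eq_mul]
    have e : ((|Real.sin x| : ℝ) : ℂ) + 2 / (π:ℂ) * (1 / (1 - 4 * ((0:ℤ):ℂ)^2)) * Complex.exp (2 * (π:ℂ) * Complex.I * ((0:ℤ):ℂ) * x / π) = ((|Real.sin x| + 2/π : ℝ):ℂ) := by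
      push_cast; simp
    have e2 : 2 / (π:ℂ) * (1 / (1 - 4 * (((0:ℕ):ℤ):ℂ)^2)) * Complex.exp (2 * (π:ℂ) * Complex.I * (((0:ℕ):ℤ):ℂ) * x / π) + 2 / (π:ℂ) * (1 / (1 - 4 * ((-((0:ℕ):ℤ):ℤ):ℂ)^2)) * Complex.exp (2 * (π:ℂ) * Complex.I * ((-((0:ℕ):ℤ):ℤ):ℂ) * x / π) = ((4/π : ℝ):ℂ) := by
      push_cast; simp; ring
    rw [e, e2, Complex.ofReal_re, Complex.ofReal_re]
    have := pi_ne_zero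
    field_simp; ring

theorem inv_hasSum : HasSum (fun m : ℕ => (1 / (4 * (m+1:ℝ)^2 - 1))) (1/2) := by
  have := abs_sin_hasSum 0
  simpa using this

theorem cos_log (r φ : ℝ) (h0 : 0 ≤ r) (h1 : r < 1) :
    ∃ s, HasSum (fun n : ℕ => r^(n+1) / (n+1:ℝ) * Real.cos ((n+1) * φ)) s ∧ -Real.log 2 ≤ s := by
  set z : ℂ := r * Complex.exp (φ * Complex.I) with hz
  have hzn : ‖z‖ = r := by
    rw [hz, norm_mul, Complex.norm_exp_ofReal_mul_I, Complex.norm_real, Real.norm_of_nonneg h0, mul_one]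
  have h := Complex.hasSum_re (Complex.hasSum_taylorSeries_neg_log (z := z) (by rw [hzn]; exact h1))
  have h3 := (hasSum_nat_add_iff' 1).2 h
  refine ⟨((-Complex.log (1 - z)).re - ∑ i ∈ Finset.range 1, (z ^ i / (i:ℂ)).re), ?_, ?_⟩
  · convert! h3 using 1
    ext n
    have : z^(n+1) / ((n+1:ℕ):ℂ) = ((r^(n+1) / (n+1:ℝ) : ℝ):ℂ) * Complex.exp (((n+1) * φ : ℝ) * Complex.I) := by
      rw [hz, mul_pow, ← Complex.exp_nat_mul]
      push_cast
      rw [mul_assoc ((n:ℂ)+1)]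
      ring
    rw [this, Complex.re_ofReal_mul, Complex.exp_ofReal_mul_I_re]
  · simp only [Finset.sum_range_one, Complex.neg_re, Complex.log_re]
    simp
    apply Real.log_le_log
    · rw [norm_pos_iff, sub_ne_zero]; intro h; rw [← h] at hzn; simp at hzn; linarith
    · calc _ ≤ ‖(1:ℂ)‖ + ‖z‖ := norm_sub_le _ _
        _ ≤ 2 := by rw [hzn]; simp; linarith

theorem sum_abs_sin_geom (r α : ℝ) (h0 : 0 ≤ r) (h1 : r < 1) :
    Summable (fun n : ℕ => r^(n+1) / (n+1:ℝ) * |Real.sin ((n+1) * α)|) ∧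
    ∑' n : ℕ, r^(n+1) / (n+1:ℝ) * |Real.sin ((n+1) * α)| ≤ 2/π * (-Real.log (1-r) + Real.log 2) := by
  set u : ℕ → ℝ := fun n => r^(n+1) / (n+1:ℝ) with hu
  set v : ℕ → ℝ := fun m => 1 / (4 * (m+1:ℝ)^2 - 1) with hv
  have hu0 : ∀ n, 0 ≤ u n := fun n => by simp only [hu]; positivity
  have hv0 : ∀ n, 0 ≤ v n := fun n => by
    simp only [hv]; apply one_div_nonneg.2; nlinarith [(Nat.cast_nonneg n : (0:ℝ) ≤ n)]
  have hus : HasSum u (-Real.log (1-r)) := Real.hasSum_pow_div_log_of_abs_lt_one (by rw [abs_of_nonneg h0]; exact h1)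
  have hvs : HasSum v (1/2) := inv_hasSum
  have hS : Summable (fun n : ℕ => u n * |Real.sin ((n+1) * α)|) := by
    apply Summable.of_nonneg_of_le (fun n => mul_nonneg (hu0 n) (abs_nonneg _)) _ hus.summable
    intro n
    exact mul_le_of_le_one_right (hu0 n) (Real.abs_sin_le_one _)
  refine ⟨hS, ?_⟩
  let F : ℕ → ℕ → ℝ := fun n m => u n * (Real.cos (2 * (m+1) * ((n+1) * α)) * v m)
  have hprod : Summable (Function.uncurry F) := by
    apply Summable.of_norm_bounded (hus.summable.mul_of_nonneg hvs.summable hu0 hv0)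
    rintro ⟨n, m⟩
    simp only [Function.uncurry, F]
    rw [Real.norm_eq_abs, abs_mul, abs_mul, abs_of_nonneg (hu0 n), abs_of_nonneg (hv0 m)]
    apply mul_le_mul_of_nonneg_left _ (hu0 n)
    exact mul_le_of_le_one_left (hv0 m) (Real.abs_cos_le_one _)
  have hF1 : ∀ n, HasSum (F n) (u n * (1/2 - π/4 * |Real.sin ((n+1) * α)|)) := fun n =>
    (abs_sin_hasSum ((n+1) * α)).mul_left (u n)
  have hF2 : ∀ m, ∃ s, HasSum (fun n => F n m) (v m * s) ∧ -Real.log 2 ≤ s := fun m => by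
    obtain ⟨s, hs, hs'⟩ := cos_log r (2 * (m+1) * α) h0 h1
    refine ⟨s, ?_, hs'⟩
    convert! hs.mul_left (v m) using 1
    ext n
    simp only [F, hu]
    rw [show 2 * ((m:ℝ)+1) * ((n+1) * α) = (n+1) * (2 * (m+1) * α) by ring]
    ring
  choose s hs hs' using hF2
  have hcomm := hprod.tsum_comm' (fun n => (hF1 n).summable) (fun m => (hs m).summable)
  have hL : ∑' n, ∑' m, F n m = 1/2 * (-Real.log (1-r)) - π/4 * ∑' n : ℕ, u n * |Real.sin ((n+1) * α)| := by
    have : ∀ n, ∑' m, F n m = 1/2 * u n - π/4 * (u n * |Real.sin ((n+1) * α)|) := fun n => by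
      rw [(hF1 n).tsum_eq]; ring
    simp_rw [this]
    rw [Summable.tsum_sub (hus.summable.mul_left _) (hS.mul_left _), tsum_mul_left, tsum_mul_left, hus.tsum_eq]
  have hR : -(Real.log 2) * (1/2) ≤ ∑' m, ∑' n, F n m := by
    rw [← hvs.tsum_eq, ← tsum_mul_left]
    apply Summable.tsum_le_tsum _ (hvs.summable.mul_left _)
    · have := hprod.prod_symm.prod
      exact this
    · intro m
      rw [(hs m).tsum_eq]
      nlinarith [hs' m, hv0 m]
  rw [hcomm, hL] at hR
  have hp := pi_pos
  rw [div_mul_eq_mul_div, le_div_iff₀ hp]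
  linarith

theorem sum_abs_sin (A : ℕ) (hA : 1 ≤ A) (α : ℝ) :
    ∑ n ∈ Finset.range A, |Real.sin ((n+1) * α)| / (n+1:ℝ) ≤ 1 + 2/π * (Real.log A + Real.log 2) := by
  have hA' : (1:ℝ) ≤ A := by exact_mod_cast hA
  set r : ℝ := 1 - 1/A with hr
  have h1A : 1/(A:ℝ) ≤ 1 := by rw [div_le_one (by linarith)]; exact hA'
  have h0 : 0 ≤ r := by linarith
  have h1 : r < 1 := by have : 0 < 1/(A:ℝ) := by positivity
                        linarith
  obtain ⟨hs, hb⟩ := sum_abs_sin_geom r α h0 h1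
  have e : -Real.log (1-r) = Real.log A := by rw [hr, sub_sub_cancel, one_div, Real.log_inv]; ring
  rw [e] at hb
  have hp := hs.sum_le_tsum (Finset.range A) (fun n _ => by positivity)
  have hterm : ∀ n ∈ Finset.range A, |Real.sin ((n+1) * α)| / (n+1:ℝ) ≤ 1/A + r^(n+1) / (n+1:ℝ) * |Real.sin ((n+1) * α)| := by
    intro n _
    have hn : (0:ℝ) < n+1 := by positivity
    have hb : 1 - (n+1) * (1/A:ℝ) ≤ r^(n+1) := by
      have := one_add_mul_le_pow (a := -(1/A:ℝ)) (by linarith) (n+1)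
      rw [hr]; push_cast at this; rw [← sub_eq_add_neg] at this; linarith
    have hx := Real.abs_sin_le_one ((n+1) * α)
    have hx0 := abs_nonneg (Real.sin ((n+1) * α))
    have e1 : 1/(A:ℝ) + r^(n+1) / (n+1:ℝ) * |Real.sin ((n+1) * α)| - |Real.sin ((n+1) * α)| / (n+1:ℝ)
       = ((n+1) * (1/A) - (1 - r^(n+1)) * |Real.sin ((n+1) * α)|) / (n+1) := by field_simp; ring
    have hr1 : r^(n+1) ≤ 1 := pow_le_one₀ h0 h1.le
    have : 0 ≤ ((n+1) * (1/A) - (1 - r^(n+1)) * |Real.sin ((n+1) * α)|) / (n+1) := by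
      apply div_nonneg _ hn.le
      nlinarith
    linarith
  have := Finset.sum_le_sum hterm
  rw [Finset.sum_add_distrib, Finset.sum_const, Finset.card_range, nsmul_eq_mul, mul_one_div_cancel (by positivity)] at this
  linarith

theorem norm_gauss_sq {d : ℕ} [NeZero d] (χ : DirichletCharacter ℂ d) (h : χ.IsPrimitive) :
    ‖gaussSum χ (ZMod.stdAddChar (N := d))‖ ^ 2 = d := by
  set τ := gaussSum χ (ZMod.stdAddChar (N := d)) with hτ
  have h1 := congrFun (ZMod.dft_dft (⇑χ)) (-1)
  have h2 : ZMod.dft (⇑χ) = fun k => χ⁻¹ (-k) * τ := funext h.fourierTransform_eq_inv_mul_gaussSum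
  rw [h2, ZMod.dft_apply] at h1
  simp only [neg_neg, map_one, smul_eq_mul, mul_one] at h1
  have h3 : ∑ j : ZMod d, ZMod.stdAddChar (-(j * -1)) * (χ⁻¹ (-j) * τ) = (starRingEnd ℂ) τ * τ := by
    have hc : (starRingEnd ℂ) τ = ∑ a, (starRingEnd ℂ) (χ a * ZMod.stdAddChar a) := by
      rw [hτ, gaussSum, map_sum]
    rw [hc, Finset.sum_mul]
    rw [← Equiv.sum_comp (Equiv.neg (ZMod d))]
    apply Finset.sum_congr rfl
    intro j _
    simp only [Equiv.neg_apply, neg_neg, mul_neg, mul_one, map_mul]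
    rw [← AddChar.map_neg_eq_conj, ← MulChar.star_apply']
    simp only [RCLike.star_def]
    ring
  rw [h3, mul_comm, Complex.mul_conj, Complex.normSq_eq_norm_sq] at h1
  exact_mod_cast h1

theorem norm_gauss {d : ℕ} [NeZero d] (χ : DirichletCharacter ℂ d) (h : χ.IsPrimitive) :
    ‖gaussSum χ (ZMod.stdAddChar (N := d))‖ = √d := by
  rw [← norm_gauss_sq χ h, Real.sqrt_sq (norm_nonneg _)]

/-- geometric sum -/
noncomputable def GG (d : ℕ) [NeZero d] (L : ℕ) (a : ZMod d) : ℂ :=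
  ∑ i ∈ Finset.range L, ZMod.stdAddChar (a * (i : ZMod d))

theorem GG_le (d : ℕ) [NeZero d] (L : ℕ) (a : ZMod d) : ‖GG d L a‖ ≤ L := by
  unfold GG
  refine (norm_sum_le _ _).trans ?_
  simp

theorem GG_neg (d : ℕ) [NeZero d] (L : ℕ) (a : ZMod d) : ‖GG d L (-a)‖ = ‖GG d L a‖ := by
  have : GG d L (-a) = (starRingEnd ℂ) (GG d L a) := by
    unfold GG
    rw [map_sum]
    apply Finset.sum_congr rfl
    intro i _
    rw [← AddChar.map_neg_eq_conj, neg_mul]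
  rw [this, RCLike.norm_conj]

theorem norm_exp_sub_one (t : ℝ) : ‖Complex.exp (2 * t * Complex.I) - 1‖ = 2 * |Real.sin t| := by
  have := Complex.norm_exp_I_mul_ofReal_sub_one (2 * t)
  rw [show Complex.I * ((2 * t : ℝ):ℂ) = 2 * t * Complex.I by push_cast; ring] at this
  rw [this]; simp

theorem GG_eq (d : ℕ) [NeZero d] (L k : ℕ) (hk : 0 < k) (hkd : k < d) :
    ‖GG d L (k : ZMod d)‖ = |Real.sin (k * (π * L / d))| / Real.sin (π * k / d) := by
  have hd : (0:ℝ) < d := by exact_mod_cast (hk.trans hkd)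
  have hk' : (0:ℝ) < k := by exact_mod_cast hk
  have hkd' : (k:ℝ) < d := by exact_mod_cast hkd
  have hs : 0 < Real.sin (π * k / d) := by
    apply Real.sin_pos_of_pos_of_lt_pi
    · positivity
    · rw [div_lt_iff₀ hd]; exact mul_lt_mul_of_pos_left hkd' pi_pos
  have e : ∀ i : ℕ, ZMod.stdAddChar ((k : ZMod d) * (i : ZMod d)) = Complex.exp (2 * ((π * k / d : ℝ)) * Complex.I) ^ i := by
    intro i
    have := ZMod.stdAddChar_coe (N := d) ((k * i : ℕ) : ℤ)
    rw [← Complex.exp_nat_mul]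
    push_cast at this
    rw [this]
    congr 1
    push_cast; ring
  have hne : Complex.exp (2 * ((π * k / d : ℝ)) * Complex.I) ≠ 1 := by
    intro h
    have := norm_exp_sub_one (π * k / d)
    rw [h, sub_self, norm_zero, abs_of_pos hs] at this
    linarith
  unfold GG
  simp_rw [e]
  rw [geom_sum_eq hne, norm_div, norm_exp_sub_one, ← Complex.exp_nat_mul,
    show (L:ℂ) * (2 * ((π * k / d : ℝ)) * Complex.I) = 2 * ((k * (π * L / d) : ℝ):ℂ) * Complex.I by push_cast; ring,
    norm_exp_sub_one, abs_of_pos hs]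
  rw [mul_div_mul_left _ _ two_ne_zero]

theorem sym_sum (d : ℕ) (g : ℕ → ℝ) (h0 : ∀ k, 0 ≤ g k) (hs : ∀ k, k ≤ d → g (d - k) = g k) :
    ∑ k ∈ Finset.Ico 1 d, g k ≤ 2 * ∑ n ∈ Finset.range (d/2), g (n+1) := by
  have e : ∑ n ∈ Finset.range (d/2), g (n+1) = ∑ k ∈ Finset.Ico 1 (d/2+1), g k := by
    rw [Finset.sum_Ico_eq_sum_range]; simp [add_comm]
  rcases Nat.lt_or_ge d 2 with h | h
  · rw [Finset.Ico_eq_empty (by omega)]; simp; exact Finset.sum_nonneg (fun i _ => h0 _)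
  rw [← Finset.sum_Ico_consecutive g (show 1 ≤ d/2+1 by omega) (show d/2+1 ≤ d by omega), e, two_mul]
  refine add_le_add le_rfl ?_
  calc ∑ k ∈ Finset.Ico (d/2+1) d, g k = ∑ k ∈ Finset.Ico (d/2+1) d, g (d - k) :=
        Finset.sum_congr rfl (fun k hk => (hs k (by rw [Finset.mem_Ico] at hk; omega)).symm)
    _ = ∑ k ∈ (Finset.Ico (d/2+1) d).image (fun k => d - k), g k := by
        rw [Finset.sum_image]
        intro a ha b hb hab
        simp only [Finset.coe_Ico, Set.mem_Ico] at ha hb hab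
        omega
    _ ≤ _ := by
        apply Finset.sum_le_sum_of_subset_of_nonneg
        · intro k hk
          simp only [Finset.mem_image, Finset.mem_Ico] at hk ⊢
          omega
        · intro i _ _; exact h0 i

/-- shifted sum -/
noncomputable def SS {d : ℕ} (χ : DirichletCharacter ℂ d) (N : ℕ) (x : ZMod d) : ℂ :=
  ∑ i ∈ Finset.range N, χ (x + i)

theorem SS_succ {d : ℕ} (χ : DirichletCharacter ℂ d) (N : ℕ) (x : ZMod d) :
    ‖SS χ N (x + 1) - SS χ N x‖ ≤ 2 := by
  have e : SS χ N (x+1) - SS χ N x = χ (x + N) - χ x := by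
    have h1 := Finset.sum_range_succ (fun i : ℕ => χ (x + i)) N
    have h2 := Finset.sum_range_succ' (fun i : ℕ => χ (x + i)) N
    rw [h1] at h2
    unfold SS
    have h3 : ∑ i ∈ Finset.range N, χ (x + 1 + i) = ∑ i ∈ Finset.range N, χ (x + (i+1:ℕ)) := by
      apply Finset.sum_congr rfl; intro i _; congr 1; push_cast; ring
    rw [h3]
    simp only [Nat.cast_zero, add_zero] at h2
    linear_combination -h2
  rw [e]
  refine (norm_sub_le _ _).trans ?_
  linarith [DirichletCharacter.norm_le_one χ (x + N), DirichletCharacter.norm_le_one χ x]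

theorem SS_shift {d : ℕ} (χ : DirichletCharacter ℂ d) (N : ℕ) (x : ZMod d) (j : ℕ) :
    ‖SS χ N (x + j) - SS χ N x‖ ≤ 2 * j := by
  induction j with
  | zero => simp
  | succ j ih =>
    have := SS_succ χ N (x + j)
    calc _ = ‖(SS χ N (x + j + 1) - SS χ N (x + j)) + (SS χ N (x + j) - SS χ N x)‖ := by
          congr 1; push_cast; rw [add_assoc x]; ring
      _ ≤ _ := norm_add_le _ _
      _ ≤ _ := by push_cast; linarith

theorem SS_avg {d : ℕ} (χ : DirichletCharacter ℂ d) (N H : ℕ) (hH : 1 ≤ H) (x : ZMod d) :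
    H * ‖SS χ N x‖ ≤ ‖∑ j ∈ Finset.range H, SS χ N (x + j)‖ + H * ((H:ℝ) - 1) := by
  have e : (H:ℂ) * SS χ N x = ∑ j ∈ Finset.range H, SS χ N (x + j) - ∑ j ∈ Finset.range H, (SS χ N (x + j) - SS χ N x) := by
    rw [Finset.sum_sub_distrib]; simp
  have h1 : ‖∑ j ∈ Finset.range H, (SS χ N (x + j) - SS χ N x)‖ ≤ H * ((H:ℝ) - 1) := by
    refine (norm_sum_le _ _).trans ?_
    refine (Finset.sum_le_sum (fun j _ => SS_shift χ N x j)).trans ?_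
    rw [← Finset.mul_sum]
    have := Finset.sum_range_id_mul_two H
    have h2 : (∑ i ∈ Finset.range H, (i:ℝ)) * 2 = H * ((H:ℝ) - 1) := by
      have : ((∑ i ∈ Finset.range H, i) * 2 : ℕ) = (H * (H - 1) : ℕ) := this
      have h3 : (((∑ i ∈ Finset.range H, i) * 2 : ℕ) : ℝ) = ((H * (H - 1) : ℕ) : ℝ) := by rw [this]
      push_cast [Nat.cast_sub hH] at h3; exact h3
    linarith
  have h2 : ‖(H:ℂ) * SS χ N x‖ = H * ‖SS χ N x‖ := by simp
  rw [← h2, e]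
  exact (norm_sub_le _ _).trans (by linarith)

theorem chi_inv {d : ℕ} [NeZero d] (χ : DirichletCharacter ℂ d) (y : ZMod d) :
    (d:ℂ) * χ y = ∑ a : ZMod d, ZMod.stdAddChar (a * y) * ZMod.dft (⇑χ) a := by
  have h1 := congrFun (ZMod.dft_dft (⇑χ)) (-y)
  rw [ZMod.dft_apply] at h1
  simp only [neg_neg, smul_eq_mul, mul_neg] at h1
  exact h1.symm

theorem avg_eq {d : ℕ} [NeZero d] (χ : DirichletCharacter ℂ d) (N H : ℕ) (x : ZMod d) :
    (d:ℂ) * ∑ j ∈ Finset.range H, SS χ N (x + j) =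
      ∑ a : ZMod d, ZMod.dft (⇑χ) a * ZMod.stdAddChar (a * x) * GG d N a * GG d H a := by
  unfold SS GG
  simp_rw [Finset.mul_sum, chi_inv, Finset.sum_mul]
  calc _ = ∑ j ∈ Finset.range H, ∑ a : ZMod d, ∑ i ∈ Finset.range N, ZMod.stdAddChar (a * (x + (j : ZMod d) + (i : ZMod d))) * ZMod.dft (⇑χ) a := by
        apply Finset.sum_congr rfl; intro j _; exact Finset.sum_comm
    _ = ∑ a : ZMod d, ∑ j ∈ Finset.range H, ∑ i ∈ Finset.range N, ZMod.stdAddChar (a * (x + (j : ZMod d) + (i : ZMod d))) * ZMod.dft (⇑χ) a := Finset.sum_comm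
    _ = _ := by
        apply Finset.sum_congr rfl; intro a _
        apply Finset.sum_congr rfl; intro j _
        apply Finset.sum_congr rfl; intro i _
        rw [mul_add, mul_add, AddChar.map_add_eq_mul, AddChar.map_add_eq_mul]; ring

theorem avg_le {d : ℕ} [NeZero d] (hd : 2 ≤ d) (χ : DirichletCharacter ℂ d) (hp : χ.IsPrimitive) (N H : ℕ) (x : ZMod d) :
    d * ‖∑ j ∈ Finset.range H, SS χ N (x + j)‖ ≤
      √d * (2 * ∑ n ∈ Finset.range (d/2), ‖GG d N ((n+1:ℕ) : ZMod d)‖ * ‖GG d H ((n+1:ℕ) : ZMod d)‖) := by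
  have h := congrArg norm (avg_eq χ N H x)
  rw [norm_mul, Complex.norm_natCast] at h
  rw [h]
  have hdft : ∀ a, ‖ZMod.dft (⇑χ) a‖ ≤ √d := by
    intro a
    rw [hp.fourierTransform_eq_inv_mul_gaussSum, norm_mul, norm_gauss χ hp]
    exact mul_le_of_le_one_left (Real.sqrt_nonneg _) (DirichletCharacter.norm_le_one _ _)
  have h0 : ZMod.dft (⇑χ) 0 = 0 := by
    rw [hp.fourierTransform_eq_inv_mul_gaussSum, neg_zero]
    have : Fact (1 < d) := ⟨hd⟩
    rw [MulChar.map_nonunit _ not_isUnit_zero, zero_mul]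
  refine (norm_sum_le _ _).trans ?_
  have h1 : ∀ a : ZMod d, ‖ZMod.dft (⇑χ) a * ZMod.stdAddChar (a * x) * GG d N a * GG d H a‖ ≤
      if a = 0 then 0 else √d * (‖GG d N a‖ * ‖GG d H a‖) := by
    intro a
    split_ifs with ha
    · rw [ha, h0]; simp
    · rw [norm_mul, norm_mul, norm_mul, AddChar.norm_apply, mul_one, mul_assoc]
      exact mul_le_mul_of_nonneg_right (hdft a) (by positivity)
  refine (Finset.sum_le_sum (fun a _ => h1 a)).trans ?_
  have h2 : ∑ a : ZMod d, (if a = 0 then 0 else √d * (‖GG d N a‖ * ‖GG d H a‖)) =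
      ∑ k ∈ Finset.Ico 1 d, √d * (‖GG d N (k : ZMod d)‖ * ‖GG d H (k : ZMod d)‖) := by
    rw [← Finset.sum_filter_add_sum_filter_not Finset.univ (fun a : ZMod d => a = 0)]
    rw [Finset.sum_eq_zero (by intro a ha; simp at ha; simp [ha]), zero_add]
    symm
    apply Finset.sum_bij (fun (k:ℕ) _ => (k : ZMod d))
    · intro k hk
      rw [Finset.mem_Ico] at hk
      simp only [Finset.mem_filter, Finset.mem_univ, true_and]
      intro h
      rw [ZMod.natCast_eq_zero_iff] at h
      exact absurd (Nat.le_of_dvd (by omega) h) (by omega)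
    · intro k hk l hl hkl
      rw [Finset.mem_Ico] at hk hl
      have := congrArg ZMod.val hkl
      rwa [ZMod.val_natCast_of_lt hk.2, ZMod.val_natCast_of_lt hl.2] at this
    · intro a ha
      simp only [Finset.mem_filter, Finset.mem_univ, true_and] at ha
      refine ⟨a.val, ?_, ZMod.natCast_zmod_val a⟩
      rw [Finset.mem_Ico]
      refine ⟨?_, ZMod.val_lt a⟩
      have : a.val ≠ 0 := by rwa [Ne, ZMod.val_eq_zero]
      omega
    · intro k hk
      rw [Finset.mem_Ico] at hk
      rw [if_neg]
      intro h
      rw [ZMod.natCast_eq_zero_iff] at h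
      exact absurd (Nat.le_of_dvd (by omega) h) (by omega)
  rw [h2, ← Finset.mul_sum]
  apply mul_le_mul_of_nonneg_left _ (Real.sqrt_nonneg _)
  apply sym_sum d (fun k => ‖GG d N (k : ZMod d)‖ * ‖GG d H (k : ZMod d)‖) (fun k => by positivity)
  intro k hk
  have : ((d - k : ℕ) : ZMod d) = -(k : ZMod d) := by rw [Nat.cast_sub hk]; simp
  simp only [this, GG_neg]

theorem inv_sin_bounds (t : ℝ) (h0 : 0 < t) (h1 : t ≤ π/2) :
    0 < Real.sin t ∧ 1 / Real.sin t ≤ 1/t + 2/7 * t ∧ 1 / (Real.sin t)^2 ≤ 1/t^2 + 1 := by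
  have hpi := Real.pi_lt_d4
  have hpi0 := Real.pi_pos
  have hs : 0 < Real.sin t := Real.sin_pos_of_pos_of_lt_pi h0 (by linarith)
  have ht2 : t^2 ≤ 2.5 := by nlinarith
  refine ⟨hs, ?_, ?_⟩
  · have h := Real.sin_gt_sub_cube h0
    have hpos : 0 < t - t^3/6 := by
      have : t - t^3/6 = t * (1 - t^2/6) := by ring
      rw [this]; apply mul_pos h0; linarith
    refine (one_div_le_one_div_of_le hpos h.le).trans ?_
    rw [div_le_iff₀ hpos]
    have : (1/t + 2/7*t) * (t - t^3/6) = 1 + t^2 * (5 - 2 * t^2) / 42 := by field_simp; ring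
    rw [this]
    have : 0 ≤ t^2 * (5 - 2 * t^2) / 42 := by
      apply div_nonneg _ (by norm_num)
      apply mul_nonneg (by positivity); linarith
    linarith
  · have hc : t * Real.cos t ≤ Real.sin t := by
      rcases h1.eq_or_lt with h | h
      · rw [h, Real.cos_pi_div_two, Real.sin_pi_div_two]; norm_num
      · have hcos : 0 < Real.cos t := Real.cos_pos_of_mem_Ioo ⟨by linarith, h⟩
        have := Real.lt_tan h0 h
        rw [Real.tan_eq_sin_div_cos, lt_div_iff₀ hcos] at this
        exact this.le
    have hc0 : 0 ≤ Real.cos t := Real.cos_nonneg_of_mem_Icc ⟨by linarith, h1⟩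
    have hsq : (t * Real.cos t)^2 ≤ (Real.sin t)^2 := pow_le_pow_left₀ (by positivity) hc 2
    have hid := Real.sin_sq_add_cos_sq t
    rw [div_add_one (by positivity), div_le_div_iff₀ (by positivity) (by positivity)]
    nlinarith

theorem tail_sum (A D : ℕ) (hA : 1 ≤ A) (hAD : A ≤ D) :
    ∑ n ∈ Finset.Ico A D, 1 / ((n:ℝ)+1)^2 ≤ 1/(A:ℝ) - 1/(D:ℝ) := by
  induction D, hAD using Nat.le_induction with
  | base => simp
  | succ D h ih =>
    rw [Finset.sum_Ico_succ_top h]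
    have hD : (0:ℝ) < D := by exact_mod_cast (by omega : 0 < D)
    have : 1/((D:ℝ)+1)^2 ≤ 1/D - 1/(D+1) := by
      rw [div_sub_div _ _ (by positivity) (by positivity), div_le_div_iff₀ (by positivity) (by positivity)]
      nlinarith
    push_cast
    linarith

theorem main_bound {d : ℕ} [NeZero d] (hd : 2 ≤ d) (χ : DirichletCharacter ℂ d) (hp : χ.IsPrimitive)
    (N H A : ℕ) (hH : 1 ≤ H) (hA : 1 ≤ A) (hAd : A ≤ d/2) (x : ZMod d) (T : ℝ)
    (hT : ∑ n ∈ Finset.Ico A (d/2), (1 / (Real.sin (π * (n+1:ℕ) / d))^2) ≤ T) :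
    ‖SS χ N x‖ ≤ ((H:ℝ) - 1) + √d * (2/π + 4/π^2 * (Real.log A + Real.log 2)
      + 2/7 * π * (A * (A+1)) / d^2 + 2 * T / (d * H)) := by
  have hd0 : (0:ℝ) < d := by exact_mod_cast (by omega : 0 < d)
  have hH0 : (0:ℝ) < H := by exact_mod_cast hH
  have hpi := Real.pi_pos
  have hth : ∀ n, n < d/2 → 0 < π * (n+1:ℕ) / d ∧ π * (n+1:ℕ) / d ≤ π/2 := by
    intro n hn
    refine ⟨by positivity, ?_⟩
    have : 2 * (n+1) ≤ d := by omega
    have h2 : (2:ℝ) * (n+1:ℕ) ≤ d := by exact_mod_cast this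
    rw [div_le_div_iff₀ hd0 two_pos]
    nlinarith
  set B : ℝ := ∑ n ∈ Finset.range A, |Real.sin ((n+1) * (π * N / d))| / (n+1:ℝ) with hB
  have hBb := sum_abs_sin A hA (π * N / d)
  rw [← hB] at hBb
  have hmain : ∑ n ∈ Finset.range (d/2), ‖GG d N ((n+1:ℕ) : ZMod d)‖ * ‖GG d H ((n+1:ℕ) : ZMod d)‖
      ≤ H * (d/π * B + 2/7 * (π/d) * (A * (A+1) / 2)) + T := by
    rw [Finset.range_eq_Ico, ← Finset.sum_Ico_consecutive _ (Nat.zero_le A) hAd]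
    apply add_le_add
    · rw [← Finset.range_eq_Ico]
      have hg : (A:ℝ) * (A+1) / 2 = ∑ n ∈ Finset.range A, ((n:ℝ)+1) := by
        clear * -
        induction A with
        | zero => simp
        | succ A ih => rw [Finset.sum_range_succ, ← ih]; push_cast; ring
      rw [hg, hB, Finset.mul_sum, Finset.mul_sum, ← Finset.sum_add_distrib, Finset.mul_sum]
      apply Finset.sum_le_sum
      intro n hn
      rw [Finset.mem_range] at hn
      obtain ⟨t0, t1⟩ := hth n (by omega)
      obtain ⟨s0, s1, _⟩ := inv_sin_bounds _ t0 t1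
      rw [GG_eq d N (n+1) (by omega) (by omega), mul_comm]
      apply mul_le_mul (GG_le d H _) _ (by positivity) hH0.le
      have ha := Real.abs_sin_le_one ((n+1:ℕ) * (π * N / d))
      have ha0 := abs_nonneg (Real.sin ((n+1:ℕ) * (π * N / d)))
      rw [← mul_one_div]
      refine (mul_le_mul_of_nonneg_left s1 ha0).trans ?_
      rw [mul_add]
      push_cast at *
      apply add_le_add
      · apply le_of_eq; field_simp
      · have : 2/7 * (π/d) * ((n:ℝ)+1) = 2/7 * (π * (n+1)/d) := by ring
        rw [this]
        exact mul_le_of_le_one_left (by positivity) ha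
    · refine (Finset.sum_le_sum ?_).trans hT
      intro n hn
      rw [Finset.mem_Ico] at hn
      obtain ⟨t0, t1⟩ := hth n (by omega)
      obtain ⟨s0, s1, _⟩ := inv_sin_bounds _ t0 t1
      rw [GG_eq d N (n+1) (by omega) (by omega), GG_eq d H (n+1) (by omega) (by omega),
        div_mul_div_comm, ← sq]
      apply div_le_div_of_nonneg_right _ (by positivity)
      exact mul_le_one₀ (Real.abs_sin_le_one _) (abs_nonneg _) (Real.abs_sin_le_one _)
  have h1 := avg_le hd χ hp N H x
  have h2 := SS_avg χ N H hH x
  have hsq := Real.sqrt_nonneg (d:ℝ)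
  have h3 : d * ‖∑ j ∈ Finset.range H, SS χ N (x + j)‖ ≤
      √d * (2 * (H * (d/π * (1 + 2/π * (Real.log A + Real.log 2)) + 2/7 * (π/d) * (A * (A+1) / 2)) + T)) := by
    refine h1.trans ?_
    refine mul_le_mul_of_nonneg_left (mul_le_mul_of_nonneg_left (hmain.trans ?_) zero_le_two) hsq
    gcongr
  have h4 : (d * H) * ‖SS χ N x‖ ≤ (d * H) * (((H:ℝ) - 1) + √d * (2/π + 4/π^2 * (Real.log A + Real.log 2)
      + 2/7 * π * (A * (A+1)) / d^2 + 2 * T / (d * H))) := by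
    have e : (d * H) * (((H:ℝ) - 1) + √d * (2/π + 4/π^2 * (Real.log A + Real.log 2)
      + 2/7 * π * (A * (A+1)) / d^2 + 2 * T / (d * H))) = d * (H * ((H:ℝ) - 1)) + √d * (2 * (H * (d/π * (1 + 2/π * (Real.log A + Real.log 2)) + 2/7 * (π/d) * (A * (A+1) / 2)) + T)) := by
      field_simp
      ring
    rw [e]
    have := mul_le_mul_of_nonneg_left h2 hd0.le
    linarith
  exact le_of_mul_le_mul_left h4 (by positivity)

theorem small_num (d L P : ℝ) (hd : 3 ≤ d) (hL1 : 1 ≤ L) (hP1 : 3.1415 < P) (hP2 : P < 3.1416)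
    (h : (L ≤ 4.86) ∨ (129 ≤ d ∧ 4 ≤ L ∧ L ≤ 6.935)) :
    2/P + 4/P^2 * L + 2/7 * P * (1/4 + 1/(2*d)) ≤ 2/P^2 * L + 4/P^2 * Real.log L + 3/2 := by
  have hP0 : 0 < P := by linarith
  have hl2 := Real.log_two_gt_d9
  have hlog : ∀ k : ℕ, k * Real.log 2 + 1 - 2^k / L ≤ Real.log L := by
    intro k
    have hk : (0:ℝ) < 2^k := by positivity
    have hx : 0 < L / 2^k := by positivity
    have := Real.one_sub_inv_le_log_of_pos hx
    rw [Real.log_div (by positivity) (by positivity), Real.log_pow, inv_div] at this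
    linarith
  have hi : 1/P ≤ 0.31832 := by rw [div_le_iff₀ hP0]; linarith
  have hq : 1/P^2 ≤ 0.10134 := by
    rw [div_le_iff₀ (by positivity)]; nlinarith
  have hq0 : 0 < 1/P^2 := by positivity
  have key : ∀ K, 0 ≤ K → L ≤ 2 * Real.log L + K → 0.63664 + 2 * 0.10134 * K + 2/7 * 3.1416 * (1/4 + 1/(2*d)) ≤ 3/2 →
    2/P + 4/P^2 * L + 2/7 * P * (1/4 + 1/(2*d)) ≤ 2/P^2 * L + 4/P^2 * Real.log L + 3/2 := by
    intro K hK0 hK hn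
    have e1 : 2/P = 2 * (1/P) := by ring
    have e2 : 4/P^2 * L = 4 * (1/P^2) * L := by ring
    have e3 : 2/P^2 * L = 2 * (1/P^2) * L := by ring
    have e4 : 4/P^2 * Real.log L = 4 * (1/P^2) * Real.log L := by ring
    rw [e1, e2, e3, e4]
    set q := 1/P^2
    have h1 : q * L ≤ q * (2 * Real.log L + K) := mul_le_mul_of_nonneg_left hK hq0.le
    have h2 : q * K ≤ 0.10134 * K := mul_le_mul_of_nonneg_right hq hK0
    have hdd : 0 < 1/(2*d) := by positivity
    have h3 : P * (1/4 + 1/(2*d)) ≤ 3.1416 * (1/4 + 1/(2*d)) := mul_le_mul_of_nonneg_right hP2.le (by linarith)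
    linarith
  have hL0 : 0 < L := by linarith
  rcases h with h | ⟨h1, h2, h3⟩
  · apply key 2.4 (by norm_num)
    · rcases le_total L 3.5 with h' | h'
      · have := hlog 0
        have h4 : 2 * (1 / L) ≤ 4.4 - L := by
          rw [mul_one_div, div_le_iff₀ hL0]; nlinarith
        norm_num at this h4
        linarith
      · have := hlog 2
        have h4 : 2 * (4 / L) ≤ 2 * 2.386 + 2.4 - L := by
          rw [mul_div, div_le_iff₀ hL0]; nlinarith
        norm_num at this h4
        linarith
    · have : 1/(2*d) ≤ 1/6 := one_div_le_one_div_of_le (by norm_num) (by linarith)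
      linarith
  · apply key 3.12 (by norm_num)
    · have := hlog 3
      have h4 : 2 * (8 / L) ≤ 2 * 3.079 + 3.12 - L := by
        rw [mul_div, div_le_iff₀ hL0]; nlinarith
      norm_num at this h4
      linarith
    · have : 1/(2*d) ≤ 1/258 := one_div_le_one_div_of_le (by norm_num) (by linarith)
      linarith

set_option maxHeartbeats 1000000 in
theorem stmt_5 (d : ℕ) (hd : 3 ≤ d) (χ : DirichletCharacter ℂ d)
    (hprim : χ.IsPrimitive) (heven : χ.Even) :
    ∀ n m : ℕ, 0 < n → n ≤ m →
      ‖∑ k ∈ Finset.Icc n m, χ (k : ZMod d)‖ ≤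
        Real.sqrt d * (2 / Real.pi ^ 2 * Real.log d
          + 4 / Real.pi ^ 2 * Real.log (Real.log d) + 3 / 2) := by
  intro n m _ _
  have : NeZero d := ⟨by omega⟩
  have hS : ∑ k ∈ Finset.Icc n m, χ (k : ZMod d) = SS χ (m + 1 - n) (n : ZMod d) := by
    unfold SS
    rw [← Finset.Ico_add_one_right_eq_Icc, Finset.sum_Ico_eq_sum_range]
    apply Finset.sum_congr rfl
    intro i _
    push_cast; rfl
  rw [hS]
  have hP1 := Real.pi_gt_d4
  have hP2 := Real.pi_lt_d4
  have hdR : (3:ℝ) ≤ d := by exact_mod_cast hd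
  have hd0 : (0:ℝ) < d := by linarith
  have hl2 := Real.log_two_gt_d9
  have hl2' := Real.log_two_lt_d9
  have hpi := Real.pi_pos
  rcases le_or_gt d 1024 with hsmall | hbig
  · have hb := main_bound (by omega) χ hprim (m+1-n) 1 (d/2) le_rfl (by omega) le_rfl (n : ZMod d) 0 (by simp)
    refine hb.trans ?_
    simp only [Nat.cast_one, sub_self, zero_add, mul_zero, zero_div, add_zero]
    apply mul_le_mul_of_nonneg_left _ (Real.sqrt_nonneg _)
    have hA0 : (0:ℝ) < (d/2 : ℕ) := by exact_mod_cast (by omega : 0 < d/2)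
    have hA : ((d/2 : ℕ):ℝ) ≤ d/2 := by
      have := @Nat.cast_div_le ℝ _ _ _ d 2
      simpa using this
    have hlogA : Real.log ((d/2 : ℕ):ℝ) + Real.log 2 ≤ Real.log d := by
      rw [← Real.log_mul (by positivity) (by norm_num)]
      apply Real.log_le_log (by positivity); linarith
    have hlogpow : ∀ k : ℕ, d ≤ 2^k → Real.log d ≤ k * Real.log 2 := by
      intro k hk
      rw [← Real.log_pow]
      apply Real.log_le_log hd0
      exact_mod_cast hk
    have hnum := small_num d (Real.log d) π hdR
      (by rw [Real.le_log_iff_exp_le hd0]; have := Real.exp_one_lt_d9; linarith) hP1 hP2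
      (by
        rcases le_or_gt d 128 with h | h
        · left
          have := hlogpow 7 (by norm_num; exact h)
          norm_num at this; linarith
        · right
          refine ⟨by exact_mod_cast h, ?_, ?_⟩
          · have : Real.log (2^7:ℝ) ≤ Real.log d := by
              apply Real.log_le_log (by positivity)
              norm_num; exact_mod_cast h.le
            rw [Real.log_pow] at this
            norm_num at this; linarith
          · have := hlogpow 10 (by norm_num; exact hsmall)
            norm_num at this; linarith)
    refine le_trans ?_ hnum
    have h1 : 4/π^2 * (Real.log ((d/2 : ℕ):ℝ) + Real.log 2) ≤ 4/π^2 * Real.log d :=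
      mul_le_mul_of_nonneg_left hlogA (by positivity)
    have h2 : 2/7 * π * (((d/2 : ℕ):ℝ) * (((d/2 : ℕ):ℝ) + 1)) / d^2 ≤ 2/7 * π * (1/4 + 1/(2*d)) := by
      rw [mul_div_assoc]
      apply mul_le_mul_of_nonneg_left _ (by positivity)
      have : 1/4 + 1/(2*(d:ℝ)) = ((d:ℝ)/2 * (d/2+1)) / d^2 := by field_simp; ring
      rw [this]
      gcongr
    linarith
  · set s := √(d:ℝ) with hs
    have hss : s * s = d := Real.mul_self_sqrt hd0.le
    have hs32 : 32 ≤ s := by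
      rw [hs]; apply Real.le_sqrt_of_sq_le
      have : (1024:ℝ) < d := by exact_mod_cast hbig
      norm_num; linarith
    set H := ⌈s/2⌉₊ with hH
    set A := ⌊s⌋₊ with hA
    have hH1 : s/2 ≤ H := Nat.le_ceil _
    have hH2 : (H:ℝ) < s/2 + 1 := Nat.ceil_lt_add_one (by linarith)
    have hA1 : (A:ℝ) ≤ s := Nat.floor_le (by linarith)
    have hA2 : s - 1 < A := Nat.sub_one_lt_floor s
    have hH0 : 1 ≤ H := by
      have : (0:ℝ) < H := by linarith
      exact_mod_cast this
    have hA0 : 1 ≤ A := by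
      have : (0:ℝ) < A := by linarith
      exact_mod_cast this
    have hAd : A ≤ d/2 := by
      rw [Nat.le_div_iff_mul_le two_pos]
      have : (A:ℝ) * 2 ≤ d := by rw [← hss]; nlinarith
      exact_mod_cast this
    have hT : ∑ n ∈ Finset.Ico A (d/2), (1 / (Real.sin (π * (n+1:ℕ) / d))^2) ≤ d^2/π^2 * (1/A) + d/2 := by
      have h1 : ∀ n ∈ Finset.Ico A (d/2), (1 / (Real.sin (π * (n+1:ℕ) / d))^2) ≤ d^2/π^2 * (1 / ((n:ℝ)+1)^2) + 1 := by
        intro n hn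
        rw [Finset.mem_Ico] at hn
        have t1 : π * (n+1:ℕ) / d ≤ π/2 := by
          have : 2 * (n+1) ≤ d := by omega
          have h2 : (2:ℝ) * (n+1:ℕ) ≤ d := by exact_mod_cast this
          rw [div_le_div_iff₀ hd0 two_pos]
          nlinarith
        obtain ⟨_, _, h⟩ := inv_sin_bounds (π * (n+1:ℕ) / d) (by positivity) t1
        refine h.trans (le_of_eq ?_)
        push_cast
        field_simp
      refine (Finset.sum_le_sum h1).trans ?_
      rw [Finset.sum_add_distrib, ← Finset.mul_sum]
      have h2 := tail_sum A (d/2) hA0 hAd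
      have h3 : (0:ℝ) ≤ 1/(d/2:ℕ) := by positivity
      have h4 : ∑ n ∈ Finset.Ico A (d/2), (1:ℝ) ≤ d/2 := by
        simp only [Finset.sum_const, Nat.card_Ico, nsmul_eq_mul, mul_one]
        have h5 : ((d/2 - A : ℕ):ℝ) ≤ ((d/2 : ℕ):ℝ) := by exact_mod_cast Nat.sub_le _ _
        have h6 := @Nat.cast_div_le ℝ _ _ _ d 2
        refine h5.trans (by simpa using h6)
      apply add_le_add _ h4
      apply mul_le_mul_of_nonneg_left _ (by positivity)
      linarith
    have hb := main_bound (by omega) χ hprim (m+1-n) H A hH0 hA0 hAd (n : ZMod d) _ hT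
    refine hb.trans ?_
    rw [← hs]
    have hA0' : (0:ℝ) < A := by linarith
    have hH0' : (0:ℝ) < H := by linarith
    have hs0 : 0 < s := by linarith
    have hlogs : Real.log d = 2 * Real.log s := by rw [← hss, Real.log_mul hs0.ne' hs0.ne']; ring
    have hlogA : Real.log A ≤ Real.log d / 2 := by
      rw [hlogs]; have := Real.log_le_log hA0' hA1; linarith
    have hLL : 1.38 ≤ Real.log (Real.log d) := by
      have h1 : Real.log (2^10:ℝ) ≤ Real.log d := by
        apply Real.log_le_log (by positivity)
        norm_num; exact_mod_cast hbig.le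
      rw [Real.log_pow] at h1
      norm_num at h1
      have h2 : Real.log (2^2:ℝ) ≤ Real.log (Real.log d) := by
        apply Real.log_le_log (by positivity); norm_num; linarith
      rw [Real.log_pow] at h2
      norm_num at h2; linarith
    have hq : 0.1013 ≤ 1/π^2 := by rw [le_div_iff₀ (by positivity)]; nlinarith
    have hq' : 1/π^2 ≤ 0.10134 := by rw [div_le_iff₀ (by positivity)]; nlinarith
    have hi : 1/π ≤ 0.31832 := by rw [div_le_iff₀ hpi]; linarith
    have c1 : 2/7 * π * (A * (A+1)) / (d:ℝ)^2 ≤ 0.01 := by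
      rw [div_le_iff₀ (by positivity)]
      have h1 : (A:ℝ) * (A+1) ≤ 2 * d := by nlinarith
      have h2 : (1024:ℝ) ≤ d := by exact_mod_cast hbig.le
      have h3 : 2/7 * π ≤ 1 := by linarith
      have h4 : 2/7 * π * ((A:ℝ) * (A+1)) ≤ 1 * (2 * d) := mul_le_mul h3 h1 (by positivity) zero_le_one
      have h5 : 1024 * (d:ℝ) ≤ d * d := mul_le_mul_of_nonneg_right h2 hd0.le
      rw [sq]
      linarith
    have c2 : 2 * ((d:ℝ)^2/π^2 * (1/A) + d/2) / (d * H) ≤ 4.2 * (1/π^2) + 0.0625 := by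
      have e : 2 * ((d:ℝ)^2/π^2 * (1/A) + d/2) / (d * H) = 2 * (1/π^2) * (d / (A * H)) + 1/H := by
        field_simp
      rw [e]
      have h1 : (d:ℝ) / (A * H) ≤ 2.1 := by
        rw [div_le_iff₀ (by positivity), ← hss]
        have : (s-1) * (s/2) ≤ A * H := mul_le_mul hA2.le hH1 (by positivity) hA0'.le
        nlinarith
      have h2 : 1/(H:ℝ) ≤ 0.0625 := by
        rw [div_le_iff₀ hH0']; linarith
      have h3 : 2 * (1/π^2) * (d / (A * H)) ≤ 2 * (1/π^2) * 2.1 := mul_le_mul_of_nonneg_left h1 (by positivity)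
      linarith
    have c3 : 4/π^2 * (Real.log A + Real.log 2) ≤ 2/π^2 * Real.log d + 4 * (1/π^2) * 0.6932 := by
      have : 4/π^2 * (Real.log A + Real.log 2) ≤ 4/π^2 * (Real.log d / 2 + 0.6932) :=
        mul_le_mul_of_nonneg_left (by linarith) (by positivity)
      refine this.trans (le_of_eq ?_)
      ring
    have c4 : 4 * (1/π^2) * 1.38 ≤ 4/π^2 * Real.log (Real.log d) := by
      have := mul_le_mul_of_nonneg_left hLL (by positivity : 0 ≤ 4/π^2)
      refine le_trans (le_of_eq ?_) this
      ring
    have c5 : 2/π = 2 * (1/π) := by ring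
    have c6 : (H:ℝ) - 1 ≤ s * (1/2) := by linarith
    have c7 : 1/2 + (2/π + 4/π^2 * (Real.log A + Real.log 2) + 2/7 * π * (A * (A+1)) / (d:ℝ)^2
        + 2 * ((d:ℝ)^2/π^2 * (1/A) + d/2) / (d * H)) ≤ 2 / Real.pi ^ 2 * Real.log d
          + 4 / Real.pi ^ 2 * Real.log (Real.log d) + 3 / 2 := by
      rw [c5]
      linarith
    have := mul_le_mul_of_nonneg_left c7 hs0.le
    rw [mul_add] at this
    linarith
end
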